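/- Let $d\in\{2,3\}$, let $\Omega\subset\mathbb R^d$ be a bounded open polygonal (polyhedral) set with Lipschitz boundary, let $\mathcal T_h$ be a (finite, conforming) simplicial triangulation of $\Omega$ with set of facets $\mathcal E_h$, and let $k\ge 1$, $\nu>0$, $0<\epsilon<1/2$. For $T\in\mathcal T_h$ let $h_T=\operatorname{diam}T$, let $\mathbf n$ be the outward unit normal on $\partial T$, and let $\eta|_{\partial T}=h_T^{-1}$. Write $(\cdot,\cdot)_{\mathcal T_h}=\sum_T(\cdot,\cdot)_{L^2(T)}$ and $\langle\cdot,\cdot\rangle_{\partial\mathcal T_h}=\sum_T\langle\cdot,\cdot\rangle_{L^2(\partial T)}$; $\nabla\cdot$ acts on tensors row by row, $(\nabla\mathbf u)_{ij}=\partial_j u_i$, and differential operators act elementwise on discrete functions. Let $\mathbf{RT}_k(T)=[\mathcal P_k(T)]^d+\mathbf x\,\mathcal P_k(T)$ and $$\begin{aligned} \Sigma_h&=\{\mathbb G:\ \mathbb G|_T\in[\mathcal P_k(T)]^{d\times d}\ \forall T\in\mathcal T_h\},\\ V_h^0&=\{\mathbf v\in H(\mathrm{div};\Omega):\ \mathbf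 v|_T\in \mathbf{RT}_k(T)\ \forall T\in\mathcal T_h,\ \mathbf v\cdot\mathbf n|_{\partial\Omega}=0\},\\ \widehat V_h^0&=\{\widehat{\mathbf v}\in [L^2(\mathcal E_h)]^d:\ \widehat{\mathbf v}|_E\in[\mathcal P_k(E)]^d\ \forall E\in\mathcal E_h,\ \widehat{\mathbf v}|_{\partial\Omega}=0\},\\ Q_h&=\{q\in L^2_0(\Omega):\ q|_T\in\mathcal P_k(T)\ \forall T\in\mathcal T_h\}. \end{aligned}$$ Let $\Pi_k^o$ and $\Pi_k^\partial$ be the $L^2$ projections (componentwise) onto $\mathcal P_k(T)$ on each element and onto $\mathcal P_k(E)$ on each facet. For $\mathbf w\in[H^1(\Omega)]^d$ let $\Pi_k^{RT}\mathbf w|_T\in \mathbf{RT}_k(T)$ be defined by $\langle\Pi_k^{RT}\mathbf w\cdot\mathbf n,\omega\rangle_E=\langle\mathbf w\cdot\mathbf n,\omega\rangle_E$ for all facets $E\subset\partial T$ and $\omega\in\mathcal P_k(E)$, and $(\Pi_k^{RT}\mathbf w,\boldsymbol\omega)_T=(\mathbf w,\boldsymbol\omega)_T$ for all $\boldsymbol\omega\in[\mathcal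 P_{k-1}(T)]^d$. Put $$\begin{aligned} \mathscr R(\mathbb L_h,\mathbf u_h,\widehat{\mathbf u}_h,p_h;\mathbb G_h,\mathbf v_h,\widehat{\mathbf v}_h,q_h)={}&\nu^{-1}(\mathbb L_h,\mathbb G_h)_{\mathcal T_h}+(\mathbf u_h,\nabla\cdot\mathbb G_h)_{\mathcal T_h}-\langle\widehat{\mathbf u}_h,\mathbb G_h\mathbf n\rangle_{\partial\mathcal T_h}\\ &-(\nabla\cdot\mathbb L_h,\mathbf v_h)_{\mathcal T_h}+\langle\mathbb L_h\mathbf n,\widehat{\mathbf v}_h\rangle_{\partial\mathcal T_h}-(p_h,\nabla\cdot\mathbf v_h)_{\mathcal T_h}\\ &+\nu\langle\eta(\Pi_k^\partial\mathbf u_h-\widehat{\mathbf u}_h),\Pi_k^\partial\mathbf v_h-\widehat{\mathbf v}_h\rangle_{\partial\mathcal T_h}+(\nabla\cdot\mathbf u_h,q_h)_{\mathcal T_h}. \end{aligned}$$ Let $\mathbf f\in[L^2(\Omega)]^d$ and suppose that $(\mathbb L,\mathbf u,p)\in[H^\epsilon(\Omega)]^{d\times d}\times[H^1(\Omega)]^d\times(H^\epsilon(\Omega)\cap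 L^2_0(\Omega))$ solves $$\nu^{-1}\mathbb L-\nabla\mathbf u=0,\qquad -\nabla\cdot\mathbb L+\nabla p=\mathbf f,\qquad\nabla\cdot\mathbf u=0\quad\text{in }\Omega,\qquad\mathbf u=\mathbf g\quad\text{on }\partial\Omega,$$ in the sense of weak derivatives and traces. Then, for all $(\mathbb G_h,\mathbf v_h,\widehat{\mathbf v}_h,q_h)\in\Sigma_h\times V_h^0\times\widehat V_h^0\times Q_h$, $$\mathscr R(\Pi_k^o\mathbb L,\Pi_k^{RT}\mathbf u,\Pi_k^\partial\mathbf u,\Pi_k^op;\mathbb G_h,\mathbf v_h,\widehat{\mathbf v}_h,q_h)=(\mathbf f,\mathbf v_h)_{\mathcal T_h}+E(\mathbb L,\mathbf u;\mathbf v_h,\widehat{\mathbf v}_h),$$ $$E(\mathbb L,\mathbf u;\mathbf v_h,\widehat{\mathbf v}_h)=\langle(\Pi_k^o\mathbb L-\mathbb L)\mathbf n,\widehat{\mathbf v}_h-\mathbf v_h\rangle_{\partial\mathcal T_h}+\nu\langle\eta(\Pi_k^{RT}\mathbf u-\mathbf u),\Pi_k^\partial\mathbf v_h-\widehat{\mathbf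 v}_h\rangle_{\partial\mathcal T_h}.$$ Here the part $\langle\mathbb L\mathbf n,\widehat{\mathbf v}_h-\mathbf v_h\rangle_{\partial\mathcal T_h}$ of $E$ is a duality pairing, the extension by density of the integral: it is the limit of $\langle\mathbb L_n\mathbf n,\widehat{\mathbf v}_h-\mathbf v_h\rangle_{\partial\mathcal T_h}$ for $\mathbb L_n,p_n\in C^\infty(\overline\Omega)$ such that, for some $\tilde p\in H^\epsilon(\Omega)$ with $\nabla\cdot(\mathbb L-\tilde p\,\mathbb I)\in[L^2(\Omega)]^d$, $\mathbb L_n\to\mathbb L$ and $p_n\to \tilde p$ in $H^\epsilon(\Omega)$ and $\nabla\cdot(\mathbb L_n-p_n\mathbb I)\to\nabla\cdot(\mathbb L-\tilde p\,\mathbb I)$ in $L^2(\Omega)$; such sequences exist, and the limit exists and does not depend on $\tilde p$ or on the sequences. Moreover, for every $T\in\mathcal T_h$, $\nabla\cdot\Pi_k^{RT}\mathbf u=0$ on $T$ and $\Pi_k^{RT}\mathbf u|_T\in[\mathcal P_k(T)]^d$. -/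

import Mathlib

open MeasureTheory Filter Topology Set
open scoped ContDiff ENNReal

noncomputable section

namespace StokesHDG

/-! ### Points, fields, polynomials -/

/-- Points of `ℝ^d` with the Euclidean norm. -/
abbrev Pt (d : ℕ) := EuclideanSpace ℝ (Fin d)

/-- Scalar fields; only the values on the set under consideration matter. -/
abbrev ScalarField (d : ℕ) := Pt d → ℝ

/-- Vector fields, by components: `u i x` is the `i`-th component of `u(x)`. -/
abbrev VectorField (d : ℕ) := Fin d → ScalarField d

/-- Tensor fields, by components: `L i j x` is the `(i, j)` entry of `L(x)`. -/
abbrev TensorField (d : ℕ) := Fin d → Fin d → ScalarField d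

variable {d : ℕ}

/-- The classical partial derivative `∂_i φ`. -/
def partialD (i : Fin d) (φ : ScalarField d) : ScalarField d :=
  fun x => fderiv ℝ φ x (EuclideanSpace.single i 1)

/-- The classical divergence `∑_i ∂_i v_i` of a vector field. -/
def divV (v : VectorField d) : ScalarField d := fun x => ∑ i, partialD i (v i) x

/-- The classical row-wise divergence `(∇·G)_i = ∑_j ∂_j G_{ij}` of a tensor field. -/
def divT (G : TensorField d) : VectorField d := fun i => divV (G i)

/-- The tensor field `L - p I`. -/
def stress (L : TensorField d) (p : ScalarField d) : TensorField d :=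
  fun i j x => L i j x - if i = j then p x else 0

/-- `q` is a polynomial in `d` variables of total degree at most `k`. -/
def IsPolyDeg (k : ℕ) (q : ScalarField d) : Prop :=
  ∃ P : MvPolynomial (Fin d) ℝ, P.totalDegree ≤ k ∧ ∀ x, q x = MvPolynomial.eval (fun i => x i) P

/-- `v ∈ RT_k = [P_k]^d + x P_k`. -/
def IsRT (k : ℕ) (v : VectorField d) : Prop :=
  ∃ (w : VectorField d) (q : ScalarField d), (∀ i, IsPolyDeg k (w i)) ∧ IsPolyDeg k q ∧
    ∀ i x, v i x = w i x + x i * q x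

/-! ### Lipschitz domains and Sobolev spaces -/

/-- `Ω` has a Lipschitz boundary: near every boundary point, `Ω` is the set of points lying on one
side (in the direction of a unit vector `e`) of the graph of a Lipschitz function `γ` of the
component `y - ⟪e, y⟫ e` orthogonal to `e`. -/
def HasLipschitzBoundary (Ω : Set (Pt d)) : Prop :=
  ∀ x ∈ frontier Ω, ∃ (e : Pt d) (γ : Pt d → ℝ) (C : NNReal) (r : ℝ),
    ‖e‖ = 1 ∧ LipschitzWith C γ ∧ 0 < r ∧
      ∀ y ∈ Metric.ball x r, y ∈ Ω ↔ γ (y - (inner ℝ e y) • e) < inner ℝ e y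

/-- `φ ∈ C_c^∞(Ω)`. -/
def IsTest (Ω : Set (Pt d)) (φ : ScalarField d) : Prop :=
  ContDiff ℝ ∞ φ ∧ HasCompactSupport φ ∧ tsupport φ ⊆ Ω

/-- `u ∈ L²(Ω)`. -/
def MemL2 (Ω : Set (Pt d)) (u : ScalarField d) : Prop := MemLp u 2 (volume.restrict Ω)

/-- `g ∈ L²(Ω)` is the weak derivative `∂_i u` in `Ω`. -/
def IsWeakDeriv (Ω : Set (Pt d)) (i : Fin d) (u g : ScalarField d) : Prop :=
  MemL2 Ω g ∧ ∀ φ, IsTest Ω φ → ∫ x in Ω, u x * partialD i φ x = - ∫ x in Ω, g x * φ x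

/-- `D ∈ L²(Ω)` is the weak divergence of the vector field `F` in `Ω`. -/
def IsWeakDiv (Ω : Set (Pt d)) (F : VectorField d) (D : ScalarField d) : Prop :=
  MemL2 Ω D ∧ ∀ φ, IsTest Ω φ →
    ∫ x in Ω, ∑ j, F j x * partialD j φ x = - ∫ x in Ω, D x * φ x

/-- `u ∈ H¹(Ω)`. -/
def MemH1 (Ω : Set (Pt d)) (u : ScalarField d) : Prop :=
  MemL2 Ω u ∧ ∀ i, ∃ g, IsWeakDeriv Ω i u g

/-- `v ∈ H(div; Ω)`. -/
def MemHdiv (Ω : Set (Pt d)) (v : VectorField d) : Prop :=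
  (∀ i, MemL2 Ω (v i)) ∧ ∃ D, IsWeakDiv Ω v D

/-- The squared Sobolev–Slobodeckij seminorm
`∫_Ω ∫_Ω |u(x) - u(y)|² / |x - y|^{d + 2 s} dx dy`, for `0 < s < 1`. -/
def slobodeckij (Ω : Set (Pt d)) (s : ℝ) (u : ScalarField d) : ℝ≥0∞ :=
  ∫⁻ x in Ω, ∫⁻ y in Ω, ENNReal.ofReal ((u x - u y) ^ 2 / ‖x - y‖ ^ ((d : ℝ) + 2 * s))

/-- `u ∈ H^s(Ω)`, for `0 < s < 1`. -/
def MemHs (Ω : Set (Pt d)) (s : ℝ) (u : ScalarField d) : Prop :=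
  MemL2 Ω u ∧ slobodeckij Ω s u < ⊤

/-- `u_n → u` in `L²(Ω)`. -/
def TendstoL2 (Ω : Set (Pt d)) (un : ℕ → ScalarField d) (u : ScalarField d) : Prop :=
  Tendsto (fun n => eLpNorm (un n - u) 2 (volume.restrict Ω)) atTop (𝓝 0)

/-- `u_n → u` in `H^s(Ω)`, for `0 < s < 1`. -/
def TendstoHs (Ω : Set (Pt d)) (s : ℝ) (un : ℕ → ScalarField d) (u : ScalarField d) : Prop :=
  TendstoL2 Ω un u ∧ Tendsto (fun n => slobodeckij Ω s (un n - u)) atTop (𝓝 0)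

/-- The `(d-1)`-dimensional surface measure in `ℝ^d`, normalized to agree with Lebesgue measure on
hyperplanes. -/
def surf (d : ℕ) : Measure (Pt d) := Measure.euclideanHausdorffMeasure (d - 1)

/-- `w` is the trace on `S` of `u ∈ H¹(Ω)`: the `L²(S)`-limit of the restrictions of functions of
class `C^∞` up to the boundary that converge to `u` in `H¹(Ω)`. -/
def IsTraceOn (Ω : Set (Pt d)) (u : ScalarField d) (S : Set (Pt d)) (w : ScalarField d) : Prop :=
  MemLp w 2 ((surf d).restrict S) ∧
    ∃ (gr : VectorField d) (un : ℕ → ScalarField d),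
      (∀ i, IsWeakDeriv Ω i u (gr i)) ∧ (∀ n, ContDiff ℝ ∞ (un n)) ∧
      TendstoL2 Ω un u ∧ (∀ i, TendstoL2 Ω (fun n => partialD i (un n)) (gr i)) ∧
      Tendsto (fun n => eLpNorm (un n - w) 2 ((surf d).restrict S)) atTop (𝓝 0)

/-- `(L, u, p)` solves the mixed Stokes system
`ν⁻¹ L - ∇u = 0`, `-∇·L + ∇p = f`, `∇·u = 0` in `Ω` (weak derivatives), `u = g` on `∂Ω` (trace). -/
structure IsStokesSolution (Ω : Set (Pt d)) (ν : ℝ) (f g : VectorField d)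
    (L : TensorField d) (u : VectorField d) (p : ScalarField d) : Prop where
  gradient : ∀ i j, IsWeakDeriv Ω j (u i) (fun x => ν⁻¹ * L i j x)
  momentum : ∀ i, IsWeakDiv Ω (stress L p i) (fun x => - f i x)
  divergence : IsWeakDiv Ω u 0
  boundary : ∀ i, IsTraceOn Ω (u i) (frontier Ω) (g i)

/-! ### Triangulations -/

/-- The closed simplex with vertex set `s`. -/
def simplex (s : Finset (Pt d)) : Set (Pt d) := convexHull ℝ (s : Set (Pt d))

/-- A (finite, conforming) simplicial triangulation of `Ω`. -/
structure Triangulation (Ω : Set (Pt d)) where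
  complex : Geometry.SimplicialComplex ℝ (Pt d)
  finite : complex.faces.Finite
  pure : ∀ s ∈ complex.faces, ∃ t ∈ complex.faces, s ⊆ t ∧ t.card = d + 1
  space_eq : complex.space = closure Ω

/-- `n` is the unit normal, pointing out of the simplex with vertex set `t`, of the facet opposite
to the vertex `a ∈ t`. -/
def IsOutwardNormal (t : Finset (Pt d)) (a n : Pt d) : Prop :=
  ‖n‖ = 1 ∧ (∀ x ∈ t, ∀ y ∈ t, x ≠ a → y ≠ a → inner ℝ n (x - y) = 0) ∧
    ∀ x ∈ t, x ≠ a → inner ℝ n (a - x) < 0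

/-- The outward unit normal of the simplex `t` on the facet opposite to `a ∈ t`. -/
def outwardNormal (t : Finset (Pt d)) (a : Pt d) : Pt d := Classical.epsilon (IsOutwardNormal t a)

open Classical in
/-- The vertex set of the facet of `t` opposite to `a ∈ t`. -/
def opp (t : Finset (Pt d)) (a : Pt d) : Finset (Pt d) := t.erase a

/-- Integration over the element with vertex set `t`. -/
def elemInt (t : Finset (Pt d)) (g : ScalarField d) : ℝ := ∫ x in simplex t, g x

/-- Integration over the facet with vertex set `e`. -/
def facetInt (e : Finset (Pt d)) (g : ScalarField d) : ℝ := ∫ x in simplex e, g x ∂(surf d)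

/-! Elementwise fields: `v t` is the field on the element `t`. Facetwise fields: `w e` is the field
on the facet `e`. Fields on `∂T_h`: `F t a` is the field on the facet of the element `t` opposite
to `a`, seen from `t`, so that interior facets carry two values. -/

abbrev ElemScalar (d : ℕ) := Finset (Pt d) → ScalarField d
abbrev ElemVector (d : ℕ) := Finset (Pt d) → VectorField d
abbrev ElemTensor (d : ℕ) := Finset (Pt d) → TensorField d
abbrev FacetVector (d : ℕ) := Finset (Pt d) → VectorField d
abbrev BdryVector (d : ℕ) := Finset (Pt d) → Pt d → VectorField d

/-- The trace on `∂T_h` of an elementwise vector field, taken from inside each element. -/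
def elemTrace (v : ElemVector d) : BdryVector d := fun t _ => v t

/-- A (single-valued) facetwise field seen as a field on `∂T_h`. -/
def facetwise (w : FacetVector d) : BdryVector d := fun t a => w (opp t a)

/-- The normal trace `G n` on `∂T_h`. -/
def normalTrace (G : ElemTensor d) : BdryVector d :=
  fun t a i x => ∑ j, G t i j x * outwardNormal t a j

/-- Multiplication by `η`, where `η = h_T⁻¹` on `∂T` and `h_T` is the diameter of `T`. -/
def etaMul (F : BdryVector d) : BdryVector d :=
  fun t a i x => (Metric.diam (simplex t))⁻¹ * F t a i x

/-! ### Projections -/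

/-- The `L²` projection `Π_k^o` onto `P_k(T)`. -/
def elemProj (k : ℕ) (t : Finset (Pt d)) (g : ScalarField d) : ScalarField d :=
  Classical.epsilon fun w => IsPolyDeg k w ∧
    ∀ q, IsPolyDeg k q → elemInt t (fun x => w x * q x) = elemInt t (fun x => g x * q x)

/-- The `L²` projection `Π_k^∂` onto `P_k(E)`; it is determined by its values on the facet. -/
def facetProj (k : ℕ) (e : Finset (Pt d)) (g : ScalarField d) : ScalarField d :=
  Classical.epsilon fun w => IsPolyDeg k w ∧
    ∀ q, IsPolyDeg k q → facetInt e (fun x => w x * q x) = facetInt e (fun x => g x * q x)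

/-- `Π_k^∂` applied to a field on `∂T_h`. -/
def projBdry (k : ℕ) (F : BdryVector d) : BdryVector d :=
  fun t a i => facetProj k (opp t a) (F t a i)

/-- The trace of `u ∈ [H¹(Ω)]^d` on the facets. -/
def facetTrace (Ω : Set (Pt d)) (u : VectorField d) : FacetVector d :=
  fun e i => Classical.epsilon (IsTraceOn Ω (u i) (simplex e))

/-- `w` is the Raviart–Thomas projection of `u ∈ [H¹(Ω)]^d` on the element `t`. -/
def IsRTProj (Ω : Set (Pt d)) (k : ℕ) (u : VectorField d) (t : Finset (Pt d))
    (w : VectorField d) : Prop :=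
  IsRT k w ∧
  (∀ a ∈ t, ∀ q, IsPolyDeg k q →
    facetInt (opp t a) (fun x => (∑ i, w i x * outwardNormal t a i) * q x) =
      facetInt (opp t a)
        (fun x => (∑ i, facetTrace Ω u (opp t a) i x * outwardNormal t a i) * q x)) ∧
  ∀ q : VectorField d, (∀ i, IsPolyDeg (k - 1) (q i)) →
    elemInt t (fun x => ∑ i, w i x * q i x) = elemInt t (fun x => ∑ i, u i x * q i x)

/-- `Π_k^{RT} u`. -/
def projRT (Ω : Set (Pt d)) (k : ℕ) (u : VectorField d) : ElemVector d :=
  fun t => Classical.epsilon (IsRTProj Ω k u t)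

/-- `Π_k^o L`, componentwise. -/
def projTensor (k : ℕ) (L : TensorField d) : ElemTensor d := fun t i j => elemProj k t (L i j)

/-- `Π_k^o p`. -/
def projScalar (k : ℕ) (p : ScalarField d) : ElemScalar d := fun t => elemProj k t p

/-- `Π_k^∂ u`, for the trace of `u ∈ [H¹(Ω)]^d` on the facets. -/
def projFacet (Ω : Set (Pt d)) (k : ℕ) (u : VectorField d) : FacetVector d :=
  fun e i => facetProj k e (facetTrace Ω u e i)

namespace Triangulation

variable {Ω : Set (Pt d)} (𝒯 : Triangulation Ω)

open Classical in
/-- The elements (`d`-simplices) of the triangulation, given by their vertex sets. -/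
def elements : Finset (Finset (Pt d)) := 𝒯.finite.toFinset.filter fun t => t.card = d + 1

open Classical in
/-- The facets (edges for `d = 2`, faces for `d = 3`), given by their vertex sets. -/
def facets : Finset (Finset (Pt d)) := 𝒯.finite.toFinset.filter fun e => e.card = d

/-- `(p, q)_{T_h}` for scalar fields. -/
def innerS (p q : ElemScalar d) : ℝ := ∑ t ∈ 𝒯.elements, elemInt t (fun x => p t x * q t x)

/-- `(u, v)_{T_h}` for vector fields. -/
def innerV (u v : ElemVector d) : ℝ :=
  ∑ t ∈ 𝒯.elements, elemInt t (fun x => ∑ i, u t i x * v t i x)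

/-- `(L, G)_{T_h}` for tensor fields. -/
def innerT (L G : ElemTensor d) : ℝ :=
  ∑ t ∈ 𝒯.elements, elemInt t (fun x => ∑ i, ∑ j, L t i j x * G t i j x)

/-- `⟨F, W⟩_{∂T_h}`: the sum of the integrals over the boundaries of all elements. -/
def innerB (F W : BdryVector d) : ℝ :=
  ∑ t ∈ 𝒯.elements, ∑ a ∈ t, facetInt (opp t a) (fun x => ∑ i, F t a i x * W t a i x)

/-- The field on `Ω` (defined almost everywhere) that is given elementwise by `v`. -/
def glue (v : ElemVector d) : VectorField d :=
  fun i x => ∑ t ∈ 𝒯.elements, (interior (simplex t)).indicator (v t i) x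

/-! ### Discrete spaces -/

/-- `Σ_h`. -/
def Sigma (k : ℕ) : Set (ElemTensor d) := {G | ∀ t ∈ 𝒯.elements, ∀ i j, IsPolyDeg k (G t i j)}

/-- `V_h^0`: the fields in `H(div; Ω)` that are elementwise in `RT_k` and whose normal component
vanishes on `∂Ω`. -/
def V0 (k : ℕ) : Set (ElemVector d) :=
  {v | (∀ t ∈ 𝒯.elements, IsRT k (v t)) ∧ MemHdiv Ω (𝒯.glue v) ∧
    ∀ t ∈ 𝒯.elements, ∀ a ∈ t, simplex (opp t a) ⊆ frontier Ω →
      ∀ x ∈ simplex (opp t a), ∑ i, v t i x * outwardNormal t a i = 0}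

/-- `V̂_h^0`: the facetwise `[P_k]^d` fields that vanish on `∂Ω`. -/
def Vhat0 (k : ℕ) : Set (FacetVector d) :=
  {w | (∀ e ∈ 𝒯.facets, ∀ i, ∃ q, IsPolyDeg k q ∧ EqOn (w e i) q (simplex e)) ∧
    ∀ e ∈ 𝒯.facets, simplex e ⊆ frontier Ω → ∀ i, ∀ x ∈ simplex e, w e i x = 0}

/-- `Q_h`. -/
def Q (k : ℕ) : Set (ElemScalar d) :=
  {q | (∀ t ∈ 𝒯.elements, IsPolyDeg k (q t)) ∧ ∑ t ∈ 𝒯.elements, elemInt t (q t) = 0}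

/-! ### The bilinear form and the consistency error -/

/-- The bilinear form `ℛ(L, u, û, p; G, v, v̂, q)`. -/
def R (ν : ℝ) (k : ℕ) (L : ElemTensor d) (u : ElemVector d) (uhat : FacetVector d)
    (p : ElemScalar d) (G : ElemTensor d) (v : ElemVector d) (vhat : FacetVector d)
    (q : ElemScalar d) : ℝ :=
  ν⁻¹ * 𝒯.innerT L G + 𝒯.innerV u (fun t => divT (G t))
    - 𝒯.innerB (facetwise uhat) (normalTrace G)
    - 𝒯.innerV (fun t => divT (L t)) v + 𝒯.innerB (normalTrace L) (facetwise vhat)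
    - 𝒯.innerS p (fun t => divV (v t))
    + ν * 𝒯.innerB (etaMul (projBdry k (elemTrace u) - facetwise uhat))
        (projBdry k (elemTrace v) - facetwise vhat)
    + 𝒯.innerS (fun t => divV (u t)) q

end Triangulation

/-- `(L_n, p_n)` is a sequence of fields of class `C^∞` up to the boundary that converges to
`(L, p)` in the space of pairs in `[H^ε(Ω)]^{d×d} × H^ε(Ω)` with `∇·(L - p I) ∈ [L²(Ω)]^d`,
normed by `‖L‖_{H^ε} + ‖p‖_{H^ε} + ‖∇·(L - p I)‖_{L²}`. -/
def IsSmoothApprox (Ω : Set (Pt d)) (ε : ℝ) (L : TensorField d) (p : ScalarField d)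
    (Ln : ℕ → TensorField d) (pn : ℕ → ScalarField d) : Prop :=
  MemHs Ω ε p ∧ (∀ n i j, ContDiff ℝ ∞ (Ln n i j)) ∧ (∀ n, ContDiff ℝ ∞ (pn n)) ∧
    (∀ i j, TendstoHs Ω ε (fun n => Ln n i j) (L i j)) ∧ TendstoHs Ω ε pn p ∧
    ∃ D : VectorField d, (∀ i, IsWeakDiv Ω (stress L p i) (D i)) ∧
      ∀ i, TendstoL2 Ω (fun n => divT (stress (Ln n) (pn n)) i) (D i)

namespace Triangulation

variable {Ω : Set (Pt d)} (𝒯 : Triangulation Ω)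

/-- `ℓ` is the value at `(L, W)` of the extension by continuity of the pairing `⟨L n, W⟩_{∂T_h}`.
For `0 < ε < 1/2` a tensor in `H^ε` has no trace in `L²(∂T)`, so that the pairing is not an
integral. It is understood as an extension by density: there is a pressure `p ∈ H^ε(Ω)` with
`∇·(L - p I) ∈ L²(Ω)` and a smooth approximation of `(L, p)`, and along every smooth approximation,
for every such `p`, the integrals `⟨L_n n, W⟩_{∂T_h}` converge to `ℓ`. In particular `ℓ` is
unique. -/
def HasNormalPairing (ε : ℝ) (L : TensorField d) (W : BdryVector d) (l : ℝ) : Prop :=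
  (∃ p Ln pn, IsSmoothApprox Ω ε L p Ln pn) ∧
    ∀ p Ln pn, IsSmoothApprox Ω ε L p Ln pn →
      Tendsto (fun n => 𝒯.innerB (normalTrace fun _ => Ln n) W) atTop (𝓝 l)

/-- The extended pairing `⟨L n, W⟩_{∂T_h}`. -/
def normalPairing (ε : ℝ) (L : TensorField d) (W : BdryVector d) : ℝ :=
  Classical.epsilon (𝒯.HasNormalPairing ε L W)

/-- The consistency error
`E(L, u; v, v̂) = ⟨(Π_k^o L - L) n, v̂ - v⟩_{∂T_h} + ν ⟨η (Π_k^{RT} u - u), Π_k^∂ v - v̂⟩_{∂T_h}`. -/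
def consistencyError (ε ν : ℝ) (k : ℕ) (L : TensorField d) (u : VectorField d)
    (v : ElemVector d) (vhat : FacetVector d) : ℝ :=
  (𝒯.innerB (normalTrace (projTensor k L)) (facetwise vhat - elemTrace v)
      - 𝒯.normalPairing ε L (facetwise vhat - elemTrace v))
    + ν * 𝒯.innerB (etaMul (elemTrace (projRT Ω k u) - facetwise (facetTrace Ω u)))
        (projBdry k (elemTrace v) - facetwise vhat)

end Triangulation

end StokesHDG

end

open StokesHDG

open scoped Manifold

namespace StokesHDG

variable {d : ℕ}

/-! ### Barycentric coordinates and outward normals of a simplex -/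

/-- `t` is the vertex set of a nondegenerate `d`-simplex. -/
structure IsElem (t : Finset (Pt d)) : Prop where
  indep : AffineIndependent ℝ ((↑) : t → Pt d)
  card : t.card = d + 1

/-- The vertices of a `d`-simplex as an affine basis. -/
noncomputable def IsElem.basis {t : Finset (Pt d)} (h : IsElem t) : AffineBasis t ℝ (Pt d) :=
  ⟨(↑), h.indep, by
    rw [h.indep.affineSpan_eq_top_iff_card_eq_finrank_add_one]
    simp [h.card]⟩

theorem IsElem.basis_apply {t : Finset (Pt d)} (h : IsElem t) (a : t) : h.basis a = a := rfl

open Classical in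
/-- The barycentric coordinate of the simplex `t` that belongs to the vertex `a`. -/
noncomputable def bary (t : Finset (Pt d)) (a : Pt d) : Pt d →ᵃ[ℝ] ℝ :=
  if h : IsElem t ∧ a ∈ t then h.1.basis.coord ⟨a, h.2⟩ else 0

namespace IsElem

variable {t : Finset (Pt d)} {a b : Pt d}

theorem bary_eq (h : IsElem t) (ha : a ∈ t) : bary t a = h.basis.coord ⟨a, ha⟩ := by
  simp [bary, h, ha]

theorem bary_self (h : IsElem t) (ha : a ∈ t) : bary t a a = 1 := by
  rw [h.bary_eq ha]; exact h.basis.coord_apply_eq ⟨a, ha⟩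

theorem bary_ne (h : IsElem t) (ha : a ∈ t) (hb : b ∈ t) (hab : b ≠ a) : bary t a b = 0 := by
  rw [h.bary_eq ha]
  exact h.basis.coord_apply_ne (i := ⟨a, ha⟩) (j := ⟨b, hb⟩) (by simpa using hab.symm)

theorem sum_bary (h : IsElem t) (x : Pt d) : ∑ a ∈ t, bary t a x = 1 := by
  rw [← h.basis.sum_coord_apply_eq_one x, ← Finset.sum_coe_sort t]
  exact Finset.sum_congr rfl fun a _ => by rw [h.bary_eq a.2]

theorem sum_bary_smul (h : IsElem t) (x : Pt d) : ∑ a ∈ t, bary t a x • a = x := by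
  conv_rhs => rw [← h.basis.linear_combination_coord_eq_self x]
  rw [← Finset.sum_coe_sort t]
  exact Finset.sum_congr rfl fun a _ => by rw [h.bary_eq a.2]; rfl

theorem mem_simplex_iff (h : IsElem t) {x : Pt d} : x ∈ simplex t ↔ ∀ a ∈ t, 0 ≤ bary t a x := by
  have := h.basis.convexHull_eq_nonneg_coord
  have hr : range h.basis = (t : Set (Pt d)) := by
    ext y; simp [h.basis_apply]
  rw [simplex, ← hr, this]
  simp only [mem_ofPred_eq, Subtype.forall]
  exact forall₂_congr fun a ha => by rw [h.bary_eq ha]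

theorem mem_interior_simplex_iff (h : IsElem t) {x : Pt d} :
    x ∈ interior (simplex t) ↔ ∀ a ∈ t, 0 < bary t a x := by
  have := h.basis.interior_convexHull
  have hr : range h.basis = (t : Set (Pt d)) := by
    ext y; simp [h.basis_apply]
  rw [simplex, ← hr, this]
  simp only [mem_ofPred_eq, Subtype.forall]
  exact forall₂_congr fun a ha => by rw [h.bary_eq ha]

theorem mem_facet_iff (h : IsElem t) (ha : a ∈ t) {x : Pt d} :
    x ∈ simplex (opp t a) ↔ bary t a x = 0 ∧ ∀ b ∈ t, 0 ≤ bary t b x := by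
  classical
  constructor
  · intro hx
    refine ⟨?_, h.mem_simplex_iff.1 (convexHull_mono (by simp [opp]) hx)⟩
    have hconv : Convex ℝ {y : Pt d | bary t a y = 0} :=
      (convex_singleton (0 : ℝ)).affine_preimage (bary t a)
    refine convexHull_min ?_ hconv hx
    intro b hb
    simp only [opp, Finset.coe_erase, Set.mem_sdiff, SetLike.mem_coe, mem_singleton_iff] at hb
    exact h.bary_ne ha hb.1 hb.2
  · rintro ⟨h0, hpos⟩
    have hs : ∑ b ∈ opp t a, bary t b x = 1 := by
      rw [← h.sum_bary x, ← Finset.add_sum_erase t _ ha, h0, zero_add]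
      simp [opp]
    have hx : ∑ b ∈ opp t a, bary t b x • b = x := by
      conv_rhs => rw [← h.sum_bary_smul x, ← Finset.add_sum_erase t _ ha, h0, zero_smul, zero_add]
      simp [opp]
    rw [← hx]
    refine (convex_convexHull ℝ _).sum_mem (fun b hb => hpos b ?_) hs
      fun b hb => subset_convexHull ℝ _ hb
    exact Finset.mem_of_mem_erase (by simpa [opp] using hb)

theorem facet_subset (h : IsElem t) (ha : a ∈ t) : simplex (opp t a) ⊆ simplex t := fun _ hx =>
  h.mem_simplex_iff.2 ((h.mem_facet_iff ha).1 hx).2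

theorem exists_ne (h : IsElem t) (hd : 0 < d) (a : Pt d) : ∃ b ∈ t, b ≠ a := by
  by_contra! hcon
  have : t ⊆ {a} := fun b hb => by simp [hcon b hb]
  have := Finset.card_le_card this
  rw [h.card] at this
  simp at this
  omega

theorem exists_isOutwardNormal (h : IsElem t) (hd : 0 < d) (ha : a ∈ t) :
    IsOutwardNormal t a (outwardNormal t a) := by
  refine Classical.epsilon_spec (p := IsOutwardNormal t a) ?_
  obtain ⟨g, hg⟩ : ∃ g : Pt d, ∀ x, inner ℝ g x = (bary t a).linear x :=
    ⟨(InnerProductSpace.toDual ℝ (Pt d)).symm (LinearMap.toContinuousLinearMap (bary t a).linear),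
      fun x => by simp⟩
  have hsub : ∀ x y, inner ℝ g (x - y) = bary t a x - bary t a y := fun x y => by
    rw [hg, ← vsub_eq_sub, AffineMap.linearMap_vsub, vsub_eq_sub]
  obtain ⟨b, hb, hba⟩ := h.exists_ne hd a
  have hg0 : g ≠ 0 := by
    rintro rfl
    have := hsub a b
    rw [h.bary_self ha, h.bary_ne ha hb hba] at this
    simp at this
  refine ⟨-(‖g‖⁻¹ • g), ?_, ?_, ?_⟩
  · rw [norm_neg, norm_smul, norm_inv, norm_norm, inv_mul_cancel₀ (norm_ne_zero_iff.2 hg0)]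
  · intro x hx y hy hxa hya
    rw [inner_neg_left, inner_smul_left, hsub, h.bary_ne ha hx hxa, h.bary_ne ha hy hya]
    simp
  · intro x hx hxa
    rw [inner_neg_left, inner_smul_left, hsub, h.bary_self ha, h.bary_ne ha hx hxa]
    simpa using hg0

theorem norm_outwardNormal (h : IsElem t) (hd : 0 < d) (ha : a ∈ t) : ‖outwardNormal t a‖ = 1 :=
  (h.exists_isOutwardNormal hd ha).1

/-- The outward normal is a negative multiple of the gradient of the barycentric coordinate. -/
theorem exists_bary_sub (h : IsElem t) (hd : 0 < d) (ha : a ∈ t) : ∃ c : ℝ, 0 < c ∧ ∀ x y,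
    bary t a x - bary t a y = - c * inner ℝ (outwardNormal t a) (x - y) := by
  obtain ⟨hn1, hn2, hn3⟩ := h.exists_isOutwardNormal hd ha
  set n := outwardNormal t a
  obtain ⟨b, hb, hba⟩ := h.exists_ne hd a
  have hneg := hn3 b hb hba
  set m : ℝ := inner ℝ n (a - b)
  have key : ∀ x, inner ℝ n (x - b) = bary t a x * m := by
    intro x
    have e : x - b = ∑ c ∈ t, bary t c x • (c - b) := by
      simp only [smul_sub, Finset.sum_sub_distrib, h.sum_bary_smul, ← Finset.sum_smul, h.sum_bary,
        one_smul]
    rw [e, inner_sum, Finset.sum_eq_single a]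
    · rw [inner_smul_right]
    · intro c hc hca
      rw [inner_smul_right, hn2 c hc b hb hca hba, mul_zero]
    · exact fun hh => absurd ha hh
  refine ⟨-m⁻¹, by simpa using hneg, fun x y => ?_⟩
  have : x - y = (x - b) - (y - b) := by abel
  rw [this, inner_sub_right, key, key, ← sub_mul, neg_neg, mul_comm, mul_assoc,
    mul_inv_cancel₀ hneg.ne, mul_one]

theorem bary_add_smul (t : Finset (Pt d)) (a x v : Pt d) (s : ℝ) :
    bary t a (x + s • v) = bary t a x + s * (bary t a).linear v := by
  rw [add_comm, ← vadd_eq_add, AffineMap.map_vadd, map_smul, vadd_eq_add, smul_eq_mul, add_comm]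

theorem linear_bary_sub (t : Finset (Pt d)) (a b c : Pt d) :
    (bary t c).linear (b - a) = bary t c b - bary t c a := by
  rw [← vsub_eq_sub, AffineMap.linearMap_vsub, vsub_eq_sub]

end IsElem

theorem continuous_bary (t : Finset (Pt d)) (a : Pt d) : Continuous (bary t a) :=
  (bary t a).continuous_of_finiteDimensional

theorem isCompact_simplex (t : Finset (Pt d)) : IsCompact (simplex t) :=
  t.finite_toSet.isCompact_convexHull ℝ

theorem convex_simplex (t : Finset (Pt d)) : Convex ℝ (simplex t) := convex_convexHull ℝ _

theorem measurableSet_simplex (t : Finset (Pt d)) : MeasurableSet (simplex t) :=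
  (isCompact_simplex t).isClosed.measurableSet


/-! ### Surface measure on hyperplanes -/

/-- The hyperplane through `p` with normal `n`. -/
def hyperplane (n p : Pt d) : Set (Pt d) := {x | inner ℝ n (x - p) = 0}

theorem surf_restrict_hyperplane {n : Pt d} (hn : ‖n‖ = 1) (p : Pt d) :
    (surf d).restrict (hyperplane n p) =
      Measure.map (fun w : (Submodule.span ℝ {n})ᗮ => (w : Pt d) + p) volume := by
  have hn0 : n ≠ 0 := by rintro rfl; simp at hn
  have hiso : Isometry (fun w : (Submodule.span ℝ {n})ᗮ => (w : Pt d) + p) :=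
    (isometry_add_right p).comp isometry_subtype_coe
  have hrank : Module.finrank ℝ (Submodule.span ℝ {n})ᗮ = d - 1 := by
    have := (Submodule.span ℝ {n}).finrank_add_finrank_orthogonal
    rw [finrank_span_singleton hn0, finrank_euclideanSpace_fin] at this
    omega
  have hvol : (volume : Measure (Submodule.span ℝ {n})ᗮ) =
      Measure.euclideanHausdorffMeasure (d - 1) := by
    rw [← InnerProductSpace.euclideanHausdorffMeasure_eq_volume, hrank]
  have hrange : range (fun w : (Submodule.span ℝ {n})ᗮ => (w : Pt d) + p) = hyperplane n p := by
    ext x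
    simp only [mem_range, hyperplane, mem_ofPred_eq]
    constructor
    · rintro ⟨w, rfl⟩
      rw [add_sub_cancel_right]
      exact (Submodule.mem_orthogonal_singleton_iff_inner_right).1 w.2
    · intro hx
      exact ⟨⟨x - p, (Submodule.mem_orthogonal_singleton_iff_inner_right).2 hx⟩, by simp⟩
  rw [hvol, hiso.map_euclideanHausdorffMeasure, hrange, surf]

theorem sFinite_surf_hyperplane {n : Pt d} (hn : ‖n‖ = 1) (p : Pt d) :
    SFinite ((surf d).restrict (hyperplane n p)) := by
  rw [surf_restrict_hyperplane hn]; infer_instance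

theorem measurePreserving_orthogonal {n : Pt d} (hn : ‖n‖ = 1) (p : Pt d) :
    MeasurePreserving (fun z : (Submodule.span ℝ {n})ᗮ × ℝ => (z.1 : Pt d) + z.2 • n + p) := by
  have h1 := ((Submodule.span ℝ {n}).measurePreserving_measurableEquivProd p).symm
  rw [InnerProductSpace.euclideanHausdorffMeasure_eq_volume] at h1
  have h2 : MeasurePreserving (LinearIsometryEquiv.toSpanUnitSingleton (𝕜 := ℝ) n hn) :=
    LinearIsometryEquiv.measurePreserving _
  have h3 := (MeasurePreserving.id (volume : Measure (Submodule.span ℝ {n})ᗮ)).prod h2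
  have h4 := h1.comp (Measure.measurePreserving_swap.comp h3)
  rw [Measure.volume_eq_prod]
  convert h4 using 1
  ext1 z
  simp only [Function.comp_apply, Submodule.measurableEquivProd_symm_apply, vadd_eq_add]
  rw [add_comm (z.1 : Pt d)]
  simp

theorem measurePreserving_shear {n : Pt d} (hn : ‖n‖ = 1) (p : Pt d) {v : Pt d}
    (hv : inner ℝ n v ≠ 0) :
    MeasurePreserving (fun z : Pt d × ℝ => z.1 + z.2 • v)
      ((ENNReal.ofReal |inner ℝ n v| • (surf d).restrict (hyperplane n p)).prod volume) volume := by
  set κ : ℝ := inner ℝ n v with hκ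
  have := sFinite_surf_hyperplane hn p
  let S := (Submodule.span ℝ {n})ᗮ
  let v' : S := ⟨v - κ • n, by
    rw [Submodule.mem_orthogonal_singleton_iff_inner_right, inner_sub_right, inner_smul_right,
      real_inner_self_eq_norm_sq, hn]
    simp [hκ]⟩
  have hmap : MeasurePreserving (fun w : S => (w : Pt d) + p) volume
      ((surf d).restrict (hyperplane n p)) :=
    ⟨by fun_prop, (surf_restrict_hyperplane hn p).symm⟩
  have hprod : MeasurePreserving (Prod.map (fun w : S => (w : Pt d) + p) (id : ℝ → ℝ))
      (volume.prod volume) (((surf d).restrict (hyperplane n p)).prod volume) :=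
    hmap.prod (MeasurePreserving.id volume)
  -- the composition from `S × ℝ`
  have hshear : MeasurePreserving (fun z : S × ℝ => (z.1 + z.2 • v', z.2))
      (volume.prod volume) (volume.prod volume) := by
    have h1 : MeasurePreserving (fun z : ℝ × S => (z.1, z.2 + z.1 • v'))
        (volume.prod volume) (volume.prod volume) := by
      refine (MeasurePreserving.id volume).skew_product (g := fun s w => w + s • v') ?_ ?_
      · fun_prop
      · filter_upwards with s
        exact (measurePreserving_add_right volume (s • v')).map_eq
    exact Measure.measurePreserving_swap.comp (h1.comp Measure.measurePreserving_swap)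
  have hscale : MeasurePreserving (fun s : ℝ => κ * s)
      (ENNReal.ofReal |κ| • volume) volume :=
    ⟨by fun_prop, by rw [Measure.map_smul, Real.smul_map_volume_mul_left hv]⟩
  have hcomp := (measurePreserving_orthogonal hn p).comp
    ((MeasurePreserving.id (volume : Measure S)).prod hscale)
  have hshear' : MeasurePreserving (fun z : S × ℝ => (z.1 + z.2 • v', z.2))
      (volume.prod (ENNReal.ofReal |κ| • volume)) (volume.prod (ENNReal.ofReal |κ| • volume)) := by
    rw [Measure.prod_smul_right]
    exact hshear.smul_measure _
  have htot := hcomp.comp hshear'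
  rw [Measure.prod_smul_left]
  refine ⟨by fun_prop, ?_⟩
  rw [Measure.map_smul, ← hprod.map_eq, Measure.map_map (by fun_prop) (by fun_prop),
    ← Measure.map_smul]
  rw [← htot.map_eq, Measure.prod_smul_right]
  congr 1
  ext1 z
  simp only [Function.comp_apply, Prod.map_apply, id_eq, v', Submodule.coe_add, Submodule.coe_smul]
  rw [smul_sub, smul_smul, mul_comm κ, Prod.map_fst, Prod.map_snd, id_eq]
  abel

/-! ### The divergence theorem on a simplex -/

namespace IsElem

variable {t : Finset (Pt d)} {a b : Pt d}

theorem hyperplane_eq (h : IsElem t) (hd : 0 < d) (ha : a ∈ t) (hb : b ∈ t) (hab : b ≠ a) :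
    hyperplane (outwardNormal t a) b = {x | bary t a x = 0} := by
  obtain ⟨c, hc, hcb⟩ := h.exists_bary_sub hd ha
  ext x
  have := hcb x b
  rw [h.bary_ne ha hb hab, sub_zero] at this
  simp only [hyperplane, mem_ofPred_eq, this, mul_eq_zero, neg_eq_zero, hc.ne', false_or]

/-- The surface measure on the hyperplane of the facet opposite to `a`, as seen in the direction of
the vector `v`. -/
noncomputable def slab (t : Finset (Pt d)) (a v : Pt d) : Measure (Pt d) :=
  ENNReal.ofReal |inner ℝ (outwardNormal t a) v| • (surf d).restrict {x | bary t a x = 0}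

theorem sFinite_slab (h : IsElem t) (hd : 0 < d) (ha : a ∈ t) (v : Pt d) :
    SFinite (slab t a v) := by
  obtain ⟨b, hb, hab⟩ := h.exists_ne hd a
  have := sFinite_surf_hyperplane (h.norm_outwardNormal hd ha) b
  rw [slab, ← h.hyperplane_eq hd ha hb hab]
  infer_instance

theorem measurePreserving_slab (h : IsElem t) (hd : 0 < d) (ha : a ∈ t) {v : Pt d}
    (hv : inner ℝ (outwardNormal t a) v ≠ 0) :
    MeasurePreserving (fun z : Pt d × ℝ => z.1 + z.2 • v) ((slab t a v).prod volume) volume := by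
  obtain ⟨b, hb, hab⟩ := h.exists_ne hd a
  have := measurePreserving_shear (h.norm_outwardNormal hd ha) b hv
  rwa [h.hyperplane_eq hd ha hb hab] at this

theorem inner_normal_eq (h : IsElem t) (hd : 0 < d) (ha : a ∈ t) : ∃ c : ℝ, 0 < c ∧
    ∀ v, inner ℝ (outwardNormal t a) v = - c * (bary t a).linear v := by
  obtain ⟨c, hc, hcb⟩ := h.exists_bary_sub hd ha
  refine ⟨c⁻¹, inv_pos.2 hc, fun v => ?_⟩
  have := hcb v 0
  rw [sub_zero] at this
  have h2 := AffineMap.linearMap_vsub (bary t a) v 0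
  rw [vsub_eq_sub, vsub_eq_sub, sub_zero] at h2
  rw [h2, this]
  field_simp

theorem slab_le (t : Finset (Pt d)) (a v : Pt d) : ∀ᵐ y ∂(slab t a v), bary t a y = 0 := by
  refine Measure.ae_smul_measure (ae_restrict_mem ?_) _
  exact (isClosed_eq (continuous_bary t a) continuous_const).measurableSet

/-- Sliding along the edge from `a` to `b` takes the hyperplane opposite to `a` to the hyperplane
opposite to `b`. -/
theorem measurePreserving_slide (h : IsElem t) (hd : 0 < d) (ha : a ∈ t) (hb : b ∈ t)
    (hab : b ≠ a) :
    MeasurePreserving (fun y => y - bary t b y • (b - a)) (slab t a (b - a))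
      (slab t b (b - a)) := by
  set v := b - a with hv
  have la : (bary t a).linear v = -1 := by
    rw [hv, linear_bary_sub, h.bary_self ha, h.bary_ne ha hb hab]; norm_num
  have lb : (bary t b).linear v = 1 := by
    rw [hv, linear_bary_sub, h.bary_self hb, h.bary_ne hb ha hab.symm]; norm_num
  have hva : inner ℝ (outwardNormal t a) v ≠ 0 := by
    obtain ⟨c, hc, e⟩ := h.inner_normal_eq hd ha
    rw [e, la]; simpa using hc.ne'
  have hvb : inner ℝ (outwardNormal t b) v ≠ 0 := by
    obtain ⟨c, hc, e⟩ := h.inner_normal_eq hd hb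
    rw [e, lb]; simpa using hc.ne'
  have mpa := h.measurePreserving_slab hd ha hva
  have mpb := h.measurePreserving_slab hd hb hvb
  have := h.sFinite_slab hd ha v
  have := h.sFinite_slab hd hb v
  have cb := continuous_bary t b
  have hπ : Measurable (fun y => y - bary t b y • v) := by
    have : Continuous (fun y => y - bary t b y • v) := by fun_prop
    exact this.measurable
  refine ⟨hπ, ?_⟩
  ext S hS
  rw [Measure.map_apply hπ hS]
  let A : Set (Pt d) := {x | x - bary t b x • v ∈ S ∧ bary t b x ∈ Icc (0 : ℝ) 1}
  have hA : MeasurableSet A := (hπ hS).inter (cb.measurable measurableSet_Icc)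
  have key : ∀ (y : Pt d) (s : ℝ), y + s • v ∈ A ↔
      (y - bary t b y • v ∈ S ∧ bary t b y + s ∈ Icc (0 : ℝ) 1) := by
    intro y s
    have e1 : bary t b (y + s • v) = bary t b y + s := by rw [bary_add_smul, lb, mul_one]
    have e2 : y + s • v - (bary t b y + s) • v = y - bary t b y • v := by
      rw [add_smul]; abel
    simp only [A, mem_ofPred_eq, e1, e2]
  have hlen : ∀ y : Pt d, volume {s : ℝ | bary t b y + s ∈ Icc (0 : ℝ) 1} = 1 := by
    intro y
    have : {s : ℝ | bary t b y + s ∈ Icc (0 : ℝ) 1} = Icc (- bary t b y) (1 - bary t b y) := by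
      ext s
      simp only [mem_ofPred_eq, mem_Icc]
      constructor <;> intro hh <;> constructor <;> linarith [hh.1, hh.2]
    rw [this, Real.volume_Icc]; simp
  have va : volume A = slab t a v ((fun y => y - bary t b y • v) ⁻¹' S) := by
    rw [← mpa.map_eq, Measure.map_apply mpa.measurable hA,
      Measure.prod_apply (mpa.measurable hA)]
    rw [← lintegral_indicator_one (hπ hS)]
    refine lintegral_congr fun y => ?_
    by_cases hy : y - bary t b y • v ∈ S
    · have : Prod.mk y ⁻¹' ((fun z : Pt d × ℝ => z.1 + z.2 • v) ⁻¹' A) =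
          {s : ℝ | bary t b y + s ∈ Icc (0 : ℝ) 1} := by
        ext s; simp only [mem_preimage, key, hy, true_and, mem_ofPred_eq]
      rw [this, hlen, indicator_of_mem (by exact hy)]; rfl
    · have : Prod.mk y ⁻¹' ((fun z : Pt d × ℝ => z.1 + z.2 • v) ⁻¹' A) = ∅ := by
        ext s; simp only [mem_preimage, key, hy, false_and, mem_empty_iff_false]
      rw [this, indicator_of_notMem (by exact hy)]; simp
  have vb : volume A = slab t b v S := by
    rw [← mpb.map_eq, Measure.map_apply mpb.measurable hA,
      Measure.prod_apply (mpb.measurable hA)]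
    rw [← lintegral_indicator_one hS]
    refine lintegral_congr_ae ?_
    filter_upwards [slab_le t b v] with y h0
    have e : y - bary t b y • v = y := by rw [h0]; simp
    by_cases hy : y ∈ S
    · have : Prod.mk y ⁻¹' ((fun z : Pt d × ℝ => z.1 + z.2 • v) ⁻¹' A) =
          {s : ℝ | bary t b y + s ∈ Icc (0 : ℝ) 1} := by
        ext s; simp only [mem_preimage, key, e, hy, true_and, mem_ofPred_eq]
      rw [this, hlen, indicator_of_mem hy]; rfl
    · have : Prod.mk y ⁻¹' ((fun z : Pt d × ℝ => z.1 + z.2 • v) ⁻¹' A) = ∅ := by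
        ext s; simp only [mem_preimage, key, e, hy, false_and, mem_empty_iff_false]
      rw [this, indicator_of_notMem hy]; simp
  rw [← va, vb]

end IsElem


namespace IsElem

variable {t : Finset (Pt d)} {a b : Pt d}

theorem slab_facet_lt_top (h : IsElem t) (hd : 0 < d) (ha : a ∈ t) {v : Pt d}
    (hv : inner ℝ (outwardNormal t a) v ≠ 0) : slab t a v (simplex (opp t a)) < ⊤ := by
  have mpa := h.measurePreserving_slab hd ha hv
  have := h.sFinite_slab hd ha v
  let A : Set (Pt d × ℝ) := simplex (opp t a) ×ˢ Icc 0 1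
  have hA : IsCompact ((fun z : Pt d × ℝ => z.1 + z.2 • v) '' A) :=
    ((isCompact_simplex _).prod isCompact_Icc).image (by fun_prop)
  have h1 : ((slab t a v).prod volume) A ≤
      volume ((fun z : Pt d × ℝ => z.1 + z.2 • v) '' A) := by
    rw [← mpa.measure_preimage hA.isClosed.measurableSet.nullMeasurableSet]
    exact measure_mono (subset_preimage_image _ _)
  have h2 : ((slab t a v).prod volume) A = slab t a v (simplex (opp t a)) := by
    rw [Measure.prod_prod, Real.volume_Icc]; simp
  rw [← h2]
  exact h1.trans_lt hA.measure_lt_top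

theorem facet_inter (h : IsElem t) (ha : a ∈ t) :
    simplex (opp t a) ∩ {x | bary t a x = 0} = simplex (opp t a) :=
  inter_eq_left.2 fun _ hx => ((h.mem_facet_iff ha).1 hx).1

theorem surf_facet_lt_top (h : IsElem t) (hd : 0 < d) (ha : a ∈ t) :
    surf d (simplex (opp t a)) < ⊤ := by
  have hn := h.norm_outwardNormal hd ha
  have hv : inner ℝ (outwardNormal t a) (outwardNormal t a) = (1 : ℝ) := by
    rw [real_inner_self_eq_norm_sq, hn]; norm_num
  have := h.slab_facet_lt_top hd ha (v := outwardNormal t a) (by rw [hv]; norm_num)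
  rw [slab, hv, abs_one, ENNReal.ofReal_one, one_smul, Measure.restrict_apply
    (measurableSet_simplex _), h.facet_inter ha] at this
  exact this

theorem slab_restrict_facet (h : IsElem t) (ha : a ∈ t) (v : Pt d) :
    (slab t a v).restrict (simplex (opp t a)) =
      ENNReal.ofReal |inner ℝ (outwardNormal t a) v| • (surf d).restrict (simplex (opp t a)) := by
  rw [slab, Measure.restrict_smul, Measure.restrict_restrict (measurableSet_simplex _),
    h.facet_inter ha]

theorem integral_slab_facet (h : IsElem t) (ha : a ∈ t) (v : Pt d) (f : ScalarField d) :
    ∫ x in simplex (opp t a), f x ∂(slab t a v) =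
      |inner ℝ (outwardNormal t a) v| * facetInt (opp t a) f := by
  rw [h.slab_restrict_facet ha, integral_smul_measure, facetInt, smul_eq_mul,
    ENNReal.toReal_ofReal (abs_nonneg _)]

theorem isFiniteMeasure_facet (h : IsElem t) (hd : 0 < d) (ha : a ∈ t) :
    IsFiniteMeasure ((surf d).restrict (simplex (opp t a))) :=
  ⟨by rw [Measure.restrict_apply_univ]; exact h.surf_facet_lt_top hd ha⟩

/-- The divergence theorem on a simplex, in the direction of an edge. -/
theorem integral_edge_derivative (h : IsElem t) (hd : 0 < d) (ha : a ∈ t) (hb : b ∈ t)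
    (hab : b ≠ a) {f : ScalarField d} (hf : ContDiff ℝ 1 f) :
    elemInt t (fun x => fderiv ℝ f x (b - a)) =
      inner ℝ (outwardNormal t a) (b - a) * facetInt (opp t a) f +
        inner ℝ (outwardNormal t b) (b - a) * facetInt (opp t b) f := by
  set v := b - a with hv
  have la : (bary t a).linear v = -1 := by
    rw [hv, linear_bary_sub, h.bary_self ha, h.bary_ne ha hb hab]; norm_num
  have lb : (bary t b).linear v = 1 := by
    rw [hv, linear_bary_sub, h.bary_self hb, h.bary_ne hb ha hab.symm]; norm_num
  have lc : ∀ c ∈ t, c ≠ a → c ≠ b → (bary t c).linear v = 0 := by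
    intro c hc hca hcb
    rw [hv, linear_bary_sub, h.bary_ne hc hb hcb.symm, h.bary_ne hc ha hca.symm, sub_self]
  have hva : 0 < inner ℝ (outwardNormal t a) v := by
    obtain ⟨c, hc, e⟩ := h.inner_normal_eq hd ha
    rw [e, la]; simpa using hc
  have hvb : inner ℝ (outwardNormal t b) v < 0 := by
    obtain ⟨c, hc, e⟩ := h.inner_normal_eq hd hb
    rw [e, lb]; simpa using hc
  have mpa := h.measurePreserving_slab hd ha hva.ne'
  have mps := h.measurePreserving_slide hd ha hb hab
  have := h.sFinite_slab hd ha v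
  have hft := h.slab_facet_lt_top hd ha hva.ne'
  have hfd : Continuous (fun x => fderiv ℝ f x v) :=
    (hf.continuous_fderiv (by norm_num)).clm_apply continuous_const
  let g : Pt d → ℝ := (simplex t).indicator fun x => fderiv ℝ f x v
  have hg : Integrable g volume :=
    (hfd.continuousOn.integrableOn_compact (isCompact_simplex t)).integrable_indicator
      (measurableSet_simplex t)
  have hgc : Integrable (fun z : Pt d × ℝ => g (z.1 + z.2 • v)) ((slab t a v).prod volume) :=
    mpa.integrable_comp_of_integrable hg
  have e1 : elemInt t (fun x => fderiv ℝ f x v) =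
      ∫ y, (∫ s : ℝ, g (y + s • v)) ∂(slab t a v) := by
    rw [elemInt, ← integral_indicator (measurableSet_simplex t),
      ← integral_prod (fun z : Pt d × ℝ => g (z.1 + z.2 • v)) hgc]
    rw [← mpa.map_eq, integral_map mpa.measurable.aemeasurable]
    rw [mpa.map_eq]; exact hg.aestronglyMeasurable
  let π : Pt d → Pt d := fun y => y - bary t b y • v
  have hline : ∀ y, bary t a y = 0 →
      ∫ s : ℝ, g (y + s • v) = (simplex (opp t a)).indicator (fun y => f y - f (π y)) y := by
    intro y hy
    have hmem : ∀ s : ℝ, y + s • v ∈ simplex t ↔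
        y ∈ simplex (opp t a) ∧ s ∈ Icc (- bary t b y) 0 := by
      intro s
      rw [h.mem_simplex_iff, h.mem_facet_iff ha, mem_Icc]
      constructor
      · intro hh
        have h1 := hh a ha
        have h2 := hh b hb
        rw [bary_add_smul, la, hy] at h1
        rw [bary_add_smul, lb] at h2
        refine ⟨⟨hy, fun c hc => ?_⟩, by linarith, by linarith⟩
        by_cases hca : c = a
        · rw [hca, hy]
        by_cases hcb : c = b
        · rw [hcb]; linarith
        have := hh c hc
        rwa [bary_add_smul, lc c hc hca hcb, mul_zero, add_zero] at this
      · rintro ⟨⟨-, hh⟩, h1, h2⟩ c hc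
        rw [bary_add_smul]
        by_cases hca : c = a
        · rw [hca, hy, la]; linarith
        by_cases hcb : c = b
        · rw [hcb, lb]; linarith
        rw [lc c hc hca hcb, mul_zero, add_zero]; exact hh c hc
    by_cases hyF : y ∈ simplex (opp t a)
    · have hb0 : 0 ≤ bary t b y := ((h.mem_facet_iff ha).1 hyF).2 b hb
      have e : (fun s : ℝ => g (y + s • v)) =
          (Icc (- bary t b y) 0).indicator (fun s => fderiv ℝ f (y + s • v) v) := by
        ext s
        by_cases hs : s ∈ Icc (- bary t b y) 0
        · rw [indicator_of_mem hs]
          exact indicator_of_mem ((hmem s).2 ⟨hyF, hs⟩) _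
        · rw [indicator_of_notMem hs]
          exact indicator_of_notMem (fun hh => hs ((hmem s).1 hh).2) _
      rw [indicator_of_mem hyF, e, integral_indicator measurableSet_Icc,
        integral_Icc_eq_integral_Ioc, ← intervalIntegral.integral_of_le (by linarith)]
      have hder : ∀ s : ℝ, HasDerivAt (fun s : ℝ => f (y + s • v)) (fderiv ℝ f (y + s • v) v) s := by
        intro s
        have h1 : HasDerivAt (fun s : ℝ => y + s • v) v s := by
          simpa using ((hasDerivAt_id s).smul_const v).const_add y
        exact ((hf.differentiable (by norm_num)) _).hasFDerivAt.comp_hasDerivAt s h1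
      rw [intervalIntegral.integral_eq_sub_of_hasDerivAt (fun s _ => hder s)]
      · simp only [zero_smul, add_zero, π, neg_smul, sub_eq_add_neg]
      · exact (hfd.comp (by fun_prop)).intervalIntegrable _ _
    · rw [indicator_of_notMem hyF]
      have e : (fun s : ℝ => g (y + s • v)) = fun _ => 0 := by
        ext s
        exact indicator_of_notMem (fun hh => hyF ((hmem s).1 hh).1) _
      rw [e, integral_zero]
  have e2 : ∫ y, (∫ s : ℝ, g (y + s • v)) ∂(slab t a v) =
      ∫ y in simplex (opp t a), (f y - f (π y)) ∂(slab t a v) := by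
    rw [← integral_indicator (measurableSet_simplex _)]
    refine integral_congr_ae ?_
    filter_upwards [slab_le t a v] with y hy using hline y hy
  have hint : ∀ φ : Pt d → ℝ, Continuous φ → IntegrableOn φ (simplex (opp t a)) (slab t a v) := by
    intro φ hφ
    exact hφ.continuousOn.integrableOn_of_subset_isCompact (isCompact_simplex _)
      (measurableSet_simplex _) subset_rfl hft.ne
  have cb := continuous_bary t b
  have hπc : Continuous π := by fun_prop
  have hpre : ∀ y, bary t a y = 0 → (π y ∈ simplex (opp t b) ↔ y ∈ simplex (opp t a)) := by
    intro y hy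
    have e : π y = y + (- bary t b y) • v := by simp [π, sub_eq_add_neg]
    rw [h.mem_facet_iff ha, h.mem_facet_iff hb, e]
    constructor
    · rintro ⟨-, hh⟩
      refine ⟨hy, fun c hc => ?_⟩
      by_cases hca : c = a
      · rw [hca, hy]
      by_cases hcb : c = b
      · have := hh a ha
        rw [bary_add_smul, la, hy] at this
        rw [hcb]; linarith
      have := hh c hc
      rwa [bary_add_smul, lc c hc hca hcb, mul_zero, add_zero] at this
    · rintro ⟨-, hh⟩
      refine ⟨by rw [bary_add_smul, lb]; ring, fun c hc => ?_⟩
      rw [bary_add_smul]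
      by_cases hca : c = a
      · rw [hca, hy, la]; linarith [hh b hb]
      by_cases hcb : c = b
      · rw [hcb, lb]; linarith
      rw [lc c hc hca hcb, mul_zero, add_zero]; exact hh c hc
  have e3 : ∫ y in simplex (opp t a), f (π y) ∂(slab t a v) =
      ∫ y in simplex (opp t b), f y ∂(slab t b v) := by
    rw [← integral_indicator (measurableSet_simplex _),
      ← integral_indicator (measurableSet_simplex _), ← mps.map_eq,
      integral_map mps.measurable.aemeasurable
        (hf.continuous.measurable.indicator (measurableSet_simplex _)).aestronglyMeasurable]
    refine integral_congr_ae ?_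
    filter_upwards [slab_le t a v] with y hy
    by_cases hyF : y ∈ simplex (opp t a)
    · rw [indicator_of_mem hyF, indicator_of_mem ((hpre y hy).2 hyF)]
    · rw [indicator_of_notMem hyF, indicator_of_notMem (fun hh => hyF ((hpre y hy).1 hh))]
  rw [e1, e2, integral_sub (hint f hf.continuous) (hint (fun y => f (π y)) (hf.continuous.comp hπc)), e3,
    h.integral_slab_facet ha, h.integral_slab_facet hb, abs_of_pos hva, abs_of_neg hvb]
  ring

/-- The divergence theorem on a simplex, in an arbitrary direction. -/
theorem integral_derivative (h : IsElem t) (hd : 0 < d) (v : Pt d) {f : ScalarField d}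
    (hf : ContDiff ℝ 1 f) :
    elemInt t (fun x => fderiv ℝ f x v) =
      ∑ a ∈ t, inner ℝ (outwardNormal t a) v * facetInt (opp t a) f := by
  classical
  have hcont : ∀ v, Continuous (fun x => fderiv ℝ f x v) := fun v =>
    (hf.continuous_fderiv (by norm_num)).clm_apply continuous_const
  have hint : ∀ v, IntegrableOn (fun x => fderiv ℝ f x v) (simplex t) := fun v =>
    (hcont v).continuousOn.integrableOn_compact (isCompact_simplex t)
  obtain ⟨a, ha⟩ : t.Nonempty := Finset.card_pos.1 (by rw [h.card]; omega)
  let P : Pt d → Prop := fun v => elemInt t (fun x => fderiv ℝ f x v) =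
      ∑ a ∈ t, inner ℝ (outwardNormal t a) v * facetInt (opp t a) f
  have hadd : ∀ v w, P v → P w → P (v + w) := by
    intro v w hv hw
    simp only [P, elemInt, map_add, inner_add_right, add_mul, Finset.sum_add_distrib] at *
    rw [integral_add (hint v) (hint w), hv, hw]
  have hsmul : ∀ (c : ℝ) v, P v → P (c • v) := by
    intro c v hv
    simp only [P, elemInt, map_smul, inner_smul_right, mul_assoc, ← Finset.mul_sum,
      smul_eq_mul] at *
    rw [integral_const_mul, hv]
  have hzero : P 0 := by simp [P, elemInt]
  have hedge : ∀ b ∈ t, P (b - a) := by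
    intro b hb
    by_cases hab : b = a
    · rw [hab, sub_self]; exact hzero
    simp only [P]
    rw [h.integral_edge_derivative hd ha hb hab hf, ← Finset.sum_pair (Ne.symm hab)
      (f := fun c => inner ℝ (outwardNormal t c) (b - a) * facetInt (opp t c) f)]
    refine Finset.sum_subset (by intro c hc; aesop) ?_
    intro c hc hc'
    obtain ⟨κ, -, e⟩ := h.inner_normal_eq hd hc
    simp only [Finset.mem_insert, Finset.mem_singleton, not_or] at hc'
    rw [e, linear_bary_sub, h.bary_ne hc hb (Ne.symm hc'.2), h.bary_ne hc ha (Ne.symm hc'.1)]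
    simp
  have hv : v = ∑ b ∈ t, bary t b (v + a) • (b - a) := by
    simp only [smul_sub, Finset.sum_sub_distrib, h.sum_bary_smul, ← Finset.sum_smul, h.sum_bary,
      one_smul]
    abel
  change P v
  rw [hv]
  exact Finset.sum_induction _ P hadd hzero fun b hb => hsmul _ _ (hedge b hb)

/-- The divergence theorem on a simplex for a partial derivative. -/
theorem integral_partialD (h : IsElem t) (hd : 0 < d) (i : Fin d) {f : ScalarField d}
    (hf : ContDiff ℝ 1 f) :
    elemInt t (partialD i f) =
      ∑ a ∈ t, outwardNormal t a i * facetInt (opp t a) f := by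
  have := h.integral_derivative hd (EuclideanSpace.single i 1) hf
  have e : partialD i f = fun x => fderiv ℝ f x (EuclideanSpace.single i 1) := rfl
  rw [e, this]
  simp [EuclideanSpace.inner_single_right]

end IsElem


/-! ### Polynomials -/

section PolynomialDerivatives

open MvPolynomial

theorem contDiff_eval (P : MvPolynomial (Fin d) ℝ) {n : WithTop ℕ∞} :
    ContDiff ℝ n (fun x : Pt d => eval (fun i => x i) P) := by
  induction P using MvPolynomial.induction_on with
  | C a => simpa using contDiff_const
  | add p q hp hq => simpa using hp.add hq
  | mul_X p i hp =>
    have : ContDiff ℝ n (fun x : Pt d => x i) := by fun_prop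
    simpa using hp.mul this

theorem partialD_add {i : Fin d} {f g : ScalarField d} {x : Pt d} (hf : DifferentiableAt ℝ f x)
    (hg : DifferentiableAt ℝ g x) :
    partialD i (fun y => f y + g y) x = partialD i f x + partialD i g x := by
  simp only [partialD]
  rw [fderiv_fun_add hf hg]; rfl

theorem partialD_sub {i : Fin d} {f g : ScalarField d} {x : Pt d} (hf : DifferentiableAt ℝ f x)
    (hg : DifferentiableAt ℝ g x) :
    partialD i (fun y => f y - g y) x = partialD i f x - partialD i g x := by
  simp only [partialD]
  rw [fderiv_fun_sub hf hg]; rfl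

theorem partialD_mul {i : Fin d} {f g : ScalarField d} {x : Pt d} (hf : DifferentiableAt ℝ f x)
    (hg : DifferentiableAt ℝ g x) :
    partialD i (fun y => f y * g y) x = partialD i f x * g x + f x * partialD i g x := by
  simp only [partialD]
  rw [fderiv_fun_mul hf hg]
  simp; ring

theorem partialD_sum {ι : Type*} {i : Fin d} (s : Finset ι) {f : ι → ScalarField d} {x : Pt d}
    (hf : ∀ j ∈ s, DifferentiableAt ℝ (f j) x) :
    partialD i (fun y => ∑ j ∈ s, f j y) x = ∑ j ∈ s, partialD i (f j) x := by
  simp only [partialD]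
  rw [fderiv_fun_sum hf]; simp

theorem partialD_const {i : Fin d} (c : ℝ) (x : Pt d) : partialD i (fun _ => c) x = 0 := by
  simp [partialD]

theorem partialD_coord (i j : Fin d) (x : Pt d) :
    partialD i (fun y => y j) x = if j = i then 1 else 0 := by
  have : (fun y : Pt d => y j) = EuclideanSpace.proj (𝕜 := ℝ) j := rfl
  rw [partialD, this, ContinuousLinearMap.fderiv]
  simp

theorem partialD_eval (P : MvPolynomial (Fin d) ℝ) (i : Fin d) (x : Pt d) :
    partialD i (fun x : Pt d => eval (fun i => x i) P) x = eval (fun i => x i) (pderiv i P) := by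
  have hdiff : ∀ P : MvPolynomial (Fin d) ℝ,
      DifferentiableAt ℝ (fun x : Pt d => eval (fun i => x i) P) x := fun P =>
    ((contDiff_eval P).differentiable one_ne_zero) x
  induction P using MvPolynomial.induction_on with
  | C a => simp [partialD_const]
  | add p q hp hq =>
    simp only [map_add, ← hp, ← hq]
    exact partialD_add (hdiff p) (hdiff q)
  | mul_X p j hp =>
    have := partialD_mul (i := i) (hdiff p) (g := fun y : Pt d => y j) (x := x) (by fun_prop)
    simp only [eval_mul, eval_X, this, hp, partialD_coord, pderiv_mul, map_add, pderiv_X]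
    by_cases h : j = i
    · subst h; simp
    · simp [h]

theorem totalDegree_pderiv_le (P : MvPolynomial (Fin d) ℝ) (i : Fin d) :
    (pderiv i P).totalDegree ≤ P.totalDegree - 1 := by
  refine Finset.sup_le fun m hm => ?_
  rw [mem_support_iff, coeff_pderiv] at hm
  have h1 : m + Finsupp.single i 1 ∈ P.support := by
    rw [mem_support_iff]; exact left_ne_zero_of_mul hm
  have h2 := le_totalDegree h1
  rw [Finsupp.sum_add_index' (fun _ => rfl) (fun _ _ _ => rfl), Finsupp.sum_single_index rfl] at h2
  omega

theorem coeff_sum_X_mul_pderiv (P : MvPolynomial (Fin d) ℝ) (m : Fin d →₀ ℕ) :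
    coeff m (∑ i, X i * pderiv i P) = (m.sum fun _ e => e : ℕ) * coeff m P := by
  induction P using MvPolynomial.induction_on' with
  | monomial s c =>
    simp_rw [X_mul_pderiv_monomial, ← Finset.sum_smul, coeff_smul, coeff_monomial]
    by_cases h : s = m
    · subst h; simp [Finsupp.sum_fintype]
    · simp [h]
  | add p q hp hq =>
    simp only [map_add, mul_add, Finset.sum_add_distrib, coeff_add, hp, hq]

end PolynomialDerivatives

namespace IsPolyDeg

variable {k l : ℕ} {p q : ScalarField d}

theorem mono (hp : IsPolyDeg k p) (hkl : k ≤ l) : IsPolyDeg l p := by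
  obtain ⟨P, hP, h⟩ := hp
  exact ⟨P, hP.trans hkl, h⟩

theorem const (k : ℕ) (c : ℝ) : IsPolyDeg (d := d) k (fun _ => c) :=
  ⟨MvPolynomial.C c, by simp, by simp⟩

theorem coord (i : Fin d) : IsPolyDeg 1 (fun x : Pt d => x i) :=
  ⟨MvPolynomial.X i, by simp, by simp⟩

theorem add (hp : IsPolyDeg k p) (hq : IsPolyDeg k q) : IsPolyDeg k (fun x => p x + q x) := by
  obtain ⟨P, hP, h⟩ := hp
  obtain ⟨R, hR, h'⟩ := hq
  exact ⟨P + R, (MvPolynomial.totalDegree_add _ _).trans (max_le hP hR), by simp [h, h']⟩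

theorem sub (hp : IsPolyDeg k p) (hq : IsPolyDeg k q) : IsPolyDeg k (fun x => p x - q x) := by
  obtain ⟨P, hP, h⟩ := hp
  obtain ⟨R, hR, h'⟩ := hq
  exact ⟨P - R, (MvPolynomial.totalDegree_sub _ _).trans (max_le hP hR), by simp [h, h']⟩

theorem mul (hp : IsPolyDeg k p) (hq : IsPolyDeg l q) :
    IsPolyDeg (k + l) (fun x => p x * q x) := by
  obtain ⟨P, hP, h⟩ := hp
  obtain ⟨R, hR, h'⟩ := hq
  exact ⟨P * R, (MvPolynomial.totalDegree_mul _ _).trans (add_le_add hP hR), by simp [h, h']⟩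

theorem const_mul (hp : IsPolyDeg k p) (c : ℝ) : IsPolyDeg k (fun x => c * p x) := by
  simpa using (const 0 c).mul hp

theorem mul_const (hp : IsPolyDeg k p) (c : ℝ) : IsPolyDeg k (fun x => p x * c) := by
  simpa using hp.mul (const 0 c)

theorem sum {ι : Type*} (s : Finset ι) {f : ι → ScalarField d}
    (hf : ∀ j ∈ s, IsPolyDeg k (f j)) : IsPolyDeg k (fun x => ∑ j ∈ s, f j x) := by
  classical
  induction s using Finset.induction_on with
  | empty => simpa using const k 0
  | insert a s ha ih =>
    simp only [Finset.sum_insert ha]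
    exact (hf a (by simp)).add (ih fun j hj => hf j (by simp [hj]))

theorem contDiff (hp : IsPolyDeg k p) {n : WithTop ℕ∞} : ContDiff ℝ n p := by
  obtain ⟨P, -, h⟩ := hp
  rw [funext h]
  exact contDiff_eval P

theorem continuous (hp : IsPolyDeg k p) : Continuous p :=
  (hp.contDiff (n := 0)).continuous

theorem partialD (hp : IsPolyDeg k p) (i : Fin d) : IsPolyDeg (k - 1) (partialD i p) := by
  obtain ⟨P, hP, h⟩ := hp
  refine ⟨MvPolynomial.pderiv i P, (totalDegree_pderiv_le P i).trans (by omega), fun x => ?_⟩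
  rw [← partialD_eval, funext h]

theorem affine (g : Pt d →ᵃ[ℝ] ℝ) : IsPolyDeg 1 (fun x => g x) := by
  have : ∀ x : Pt d, g x = ∑ i, g.linear (EuclideanSpace.single i 1) * x i + g 0 := by
    intro x
    have h1 : g x = g.linear x + g 0 := by
      have := AffineMap.map_vadd g 0 x
      simpa using this
    have h2 : x = ∑ i, x i • EuclideanSpace.single i (1 : ℝ) := by
      ext j; simp [Finset.sum_apply, Pi.single_apply]
    rw [h1]
    conv_lhs => rw [h2]
    rw [map_sum]
    simp [mul_comm]
  rw [funext this]
  exact (IsPolyDeg.sum _ fun i _ => (coord i).const_mul _).add (const 1 _)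

/-- A polynomial that vanishes on a segment starting at `x` in the direction of `y` vanishes
at `y`. -/
theorem eq_zero_of_segment (hp : IsPolyDeg k p) {x y : Pt d} {δ : ℝ} (hδ : 0 < δ)
    (h : ∀ s ∈ Ioo 0 δ, p (x + s • (y - x)) = 0) : p y = 0 := by
  obtain ⟨P, -, hP⟩ := hp
  let Q : Polynomial ℝ := MvPolynomial.aeval
    (fun i => Polynomial.C (x i) + Polynomial.X * Polynomial.C (y i - x i)) P
  have hQ : ∀ s : ℝ, Q.eval s = p (x + s • (y - x)) := by
    intro s
    have h1 : Q.eval s = Polynomial.aeval s Q := by simp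
    rw [h1, hP]
    simp only [Q]
    rw [MvPolynomial.comp_aeval_apply, MvPolynomial.aeval_eq_eval]
    simp
  have hQ0 : Q = 0 := by
    refine Polynomial.eq_zero_of_infinite_isRoot Q ((Ioo_infinite hδ).mono fun s hs => ?_)
    simp only [mem_ofPred_eq, Polynomial.IsRoot, hQ]
    exact h s hs
  have := hQ 1
  rw [hQ0] at this
  simpa using this.symm

theorem eq_zero_of_isOpen (hp : IsPolyDeg k p) {U : Set (Pt d)} (hU : IsOpen U)
    (hne : U.Nonempty) (h : ∀ x ∈ U, p x = 0) (y : Pt d) : p y = 0 := by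
  obtain ⟨x, hx⟩ := hne
  have hc : Continuous (fun s : ℝ => x + s • (y - x)) := by fun_prop
  have hmem : (fun s : ℝ => x + s • (y - x)) ⁻¹' U ∈ 𝓝 (0 : ℝ) :=
    hc.continuousAt.preimage_mem_nhds (hU.mem_nhds (by simpa using hx))
  obtain ⟨δ, hδ, hb⟩ := Metric.mem_nhds_iff.1 hmem
  refine hp.eq_zero_of_segment hδ fun s hs => h _ (hb ?_)
  rw [Metric.mem_ball, Real.dist_eq, sub_zero, abs_of_pos hs.1]; exact hs.2

end IsPolyDeg

/-- The polynomials of degree at most `k`. -/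
def polySubmodule (d k : ℕ) : Submodule ℝ (ScalarField d) where
  carrier := {q | IsPolyDeg k q}
  add_mem' hp hq := hp.add hq
  zero_mem' := IsPolyDeg.const k 0
  smul_mem' c _ hp := hp.const_mul c

theorem mem_polySubmodule {k : ℕ} {q : ScalarField d} : q ∈ polySubmodule d k ↔ IsPolyDeg k q :=
  Iff.rfl

instance (k : ℕ) : FiniteDimensional ℝ (polySubmodule d k) := by
  let ev : MvPolynomial (Fin d) ℝ →ₗ[ℝ] ScalarField d :=
    { toFun := fun P x => MvPolynomial.eval (fun i => x i) P
      map_add' := fun P Q => by ext x; simp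
      map_smul' := fun c P => by ext x; simp }
  have : polySubmodule d k = (MvPolynomial.restrictTotalDegree (Fin d) ℝ k).map ev := by
    ext q
    simp only [mem_polySubmodule, Submodule.mem_map, MvPolynomial.mem_restrictTotalDegree]
    exact exists_congr fun P => and_congr_right fun _ =>
      ⟨fun hq => (funext hq).symm, fun hq x => by rw [← hq]; rfl⟩
  rw [this]
  infer_instance

/-! ### Raviart–Thomas fields -/

theorem IsRT.isPolyDeg_succ {k : ℕ} {v : VectorField d} (hv : IsRT k v) (i : Fin d) :
    IsPolyDeg (k + 1) (v i) := by
  obtain ⟨w, q, hw, hq, e⟩ := hv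
  rw [funext (e i)]
  have := (IsPolyDeg.coord i).mul hq
  exact ((hw i).mono (by omega)).add (this.mono (by omega))

theorem IsRT.partialD {k : ℕ} {v : VectorField d} (hv : IsRT k v) (i j : Fin d) :
    IsPolyDeg k (partialD j (v i)) := by
  simpa using (hv.isPolyDeg_succ i).partialD j

theorem IsRT.divV {k : ℕ} {v : VectorField d} (hv : IsRT k v) : IsPolyDeg k (divV v) :=
  IsPolyDeg.sum _ fun i _ => hv.partialD i i

/-- A divergence-free field in `RT_k` is a polynomial field of degree `k`. -/
theorem IsRT.isPolyDeg_of_divV_eq_zero {k : ℕ} (hk : 1 ≤ k) {v : VectorField d} (hv : IsRT k v)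
    (h0 : ∀ x, StokesHDG.divV v x = 0) (i : Fin d) : IsPolyDeg k (v i) := by
  obtain ⟨w, q, hw, ⟨Q, hQ, hq⟩, e⟩ := hv
  choose W hW hw' using hw
  have hv' : ∀ i, v i = fun x : Pt d =>
      MvPolynomial.eval (fun i => x i) (W i + MvPolynomial.X i * Q) := by
    intro i; ext x; simp [e, hw', hq]
  have hdiv : ∑ i, MvPolynomial.pderiv i (W i + MvPolynomial.X i * Q) = 0 := by
    refine MvPolynomial.funext fun x => ?_
    have := h0 (WithLp.toLp 2 x)
    simp only [StokesHDG.divV, hv', partialD_eval] at this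
    simpa [map_sum] using this
  have hdiv' : ∑ i, MvPolynomial.pderiv i (W i) + (d : ℝ) • Q +
      ∑ i, MvPolynomial.X i * MvPolynomial.pderiv i Q = 0 := by
    rw [← hdiv]
    simp only [map_add, MvPolynomial.pderiv_mul, MvPolynomial.pderiv_X_self, one_mul,
      Finset.sum_add_distrib, Finset.sum_const, Finset.card_univ, Fintype.card_fin]
    rw [add_assoc, Nat.cast_smul_eq_nsmul]
  have hdeg : Q.totalDegree ≤ k - 1 := by
    refine Finset.sup_le fun m hm => ?_
    have hle := (MvPolynomial.le_totalDegree hm).trans hQ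
    by_contra hcon
    have hmk : (m.sum fun _ e => e) = k := by omega
    have hWm : MvPolynomial.coeff m (∑ i, MvPolynomial.pderiv i (W i)) = 0 := by
      by_contra hne
      have h1 := MvPolynomial.le_totalDegree (MvPolynomial.mem_support_iff.2 hne)
      have h2 : (∑ i, MvPolynomial.pderiv i (W i)).totalDegree ≤ k - 1 :=
        MvPolynomial.totalDegree_finsetSum_le fun i _ =>
          (totalDegree_pderiv_le _ _).trans (by have := hW i; omega)
      omega
    have := congrArg (MvPolynomial.coeff m) hdiv'
    rw [MvPolynomial.coeff_add, MvPolynomial.coeff_add, hWm, coeff_sum_X_mul_pderiv,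
      MvPolynomial.coeff_smul, hmk, MvPolynomial.coeff_zero, smul_eq_mul, zero_add,
      ← add_mul] at this
    rcases mul_eq_zero.1 this with h1 | h1
    · have : (0 : ℝ) < k := by exact_mod_cast hk
      have : (0 : ℝ) ≤ d := by positivity
      linarith
    · exact MvPolynomial.mem_support_iff.1 hm h1
  refine ⟨W i + MvPolynomial.X i * Q, ?_, fun x => by rw [hv']⟩
  refine (MvPolynomial.totalDegree_add _ _).trans (max_le (hW i) ?_)
  refine (MvPolynomial.totalDegree_mul _ _).trans ?_
  rw [MvPolynomial.totalDegree_X]; omega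


/-! ### Projections -/

theorem exists_l2_projection (μ : Measure (Pt d)) (V : Submodule ℝ (ScalarField d))
    [FiniteDimensional ℝ V] (hV : ∀ q ∈ V, MemLp q 2 μ) {g : ScalarField d} (hg : MemLp g 2 μ) :
    ∃ w ∈ V, ∀ q ∈ V, ∫ x, w x * q x ∂μ = ∫ x, g x * q x ∂μ := by
  let T : V →ₗ[ℝ] Lp ℝ 2 μ :=
    { toFun := fun q => (hV q q.2).toLp
      map_add' := fun p q => rfl
      map_smul' := fun c q => rfl }
  let K := LinearMap.range T
  obtain ⟨w, hw⟩ : K.starProjection hg.toLp ∈ K := Submodule.starProjection_apply_mem K _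
  have hin : ∀ {f q : ScalarField d} (hf : MemLp f 2 μ) (hq : MemLp q 2 μ),
      inner ℝ hq.toLp hf.toLp = ∫ x, f x * q x ∂μ := by
    intro f q hf hq
    rw [L2.inner_def]
    refine integral_congr_ae ?_
    filter_upwards [hf.coeFn_toLp, hq.coeFn_toLp] with x h1 h2
    rw [h1, h2]; simp
  refine ⟨w, w.2, fun q hq => ?_⟩
  have h0 := Submodule.sub_starProjection_mem_orthogonal (K := K) hg.toLp
  rw [Submodule.mem_orthogonal] at h0
  have h1 := h0 (T ⟨q, hq⟩) ⟨_, rfl⟩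
  rw [inner_sub_right, ← hw, sub_eq_zero] at h1
  rw [← hin hg (hV q hq), ← hin (hV w w.2) (hV q hq)]
  exact h1.symm

theorem memLp_of_continuous_of_isCompact {μ : Measure (Pt d)} {K : Set (Pt d)} (hK : IsCompact K)
    (hμ : μ K < ⊤) {f : ScalarField d} (hf : Continuous f) (p : ℝ≥0∞) :
    MemLp f p (μ.restrict K) := by
  have : IsFiniteMeasure (μ.restrict K) := ⟨by rwa [Measure.restrict_apply_univ]⟩
  obtain ⟨C, hC⟩ := hK.exists_bound_of_continuousOn hf.continuousOn
  refine MemLp.of_bound hf.aestronglyMeasurable C ?_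
  exact (ae_restrict_mem hK.isClosed.measurableSet).mono fun x hx => hC x hx

theorem memLp_simplex (t : Finset (Pt d)) {f : ScalarField d} (hf : Continuous f) :
    MemLp f 2 (volume.restrict (simplex t)) :=
  memLp_of_continuous_of_isCompact (isCompact_simplex t) (isCompact_simplex t).measure_lt_top hf 2

theorem IsElem.memLp_facet {t : Finset (Pt d)} {a : Pt d} (h : IsElem t) (hd : 0 < d) (ha : a ∈ t)
    {f : ScalarField d} (hf : Continuous f) :
    MemLp f 2 ((surf d).restrict (simplex (opp t a))) :=
  memLp_of_continuous_of_isCompact (isCompact_simplex _) (h.surf_facet_lt_top hd ha) hf 2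

theorem elemProj_spec (k : ℕ) (t : Finset (Pt d)) {g : ScalarField d}
    (hg : MemLp g 2 (volume.restrict (simplex t))) :
    IsPolyDeg k (elemProj k t g) ∧ ∀ q, IsPolyDeg k q →
      elemInt t (fun x => elemProj k t g x * q x) = elemInt t (fun x => g x * q x) := by
  obtain ⟨w, hw, hwq⟩ := exists_l2_projection _ (polySubmodule d k)
    (fun q hq => memLp_simplex t (IsPolyDeg.continuous hq)) hg
  exact Classical.epsilon_spec (p := fun w => IsPolyDeg k w ∧
    ∀ q, IsPolyDeg k q → elemInt t (fun x => w x * q x) = elemInt t (fun x => g x * q x))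
    ⟨w, hw, hwq⟩

theorem IsElem.facetProj_spec (k : ℕ) {t : Finset (Pt d)} {a : Pt d} (h : IsElem t) (hd : 0 < d)
    (ha : a ∈ t) {g : ScalarField d} (hg : MemLp g 2 ((surf d).restrict (simplex (opp t a)))) :
    IsPolyDeg k (facetProj k (opp t a) g) ∧ ∀ q, IsPolyDeg k q →
      facetInt (opp t a) (fun x => facetProj k (opp t a) g x * q x) =
        facetInt (opp t a) (fun x => g x * q x) := by
  obtain ⟨w, hw, hwq⟩ := exists_l2_projection _ (polySubmodule d k)
    (fun q hq => h.memLp_facet hd ha (IsPolyDeg.continuous hq)) hg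
  exact Classical.epsilon_spec (p := fun w => IsPolyDeg k w ∧ ∀ q, IsPolyDeg k q →
    facetInt (opp t a) (fun x => w x * q x) = facetInt (opp t a) (fun x => g x * q x))
    ⟨w, hw, hwq⟩

theorem IsElem.interior_nonempty {t : Finset (Pt d)} (h : IsElem t) :
    (interior (simplex t)).Nonempty := by
  refine ⟨∑ a ∈ t, (t.card : ℝ)⁻¹ • a, h.mem_interior_simplex_iff.2 fun b hb => ?_⟩
  have hc : (0 : ℝ) < t.card := by rw [h.card]; positivity
  have e := AffineBasis.coord_apply_combination_of_mem h.basis (s := Finset.univ)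
    (Finset.mem_univ ⟨b, hb⟩) (w := fun _ => (t.card : ℝ)⁻¹) (by simp [hc.ne'])
  rw [Finset.affineCombination_eq_linear_combination _ _ _ (by simp [hc.ne'])] at e
  rw [h.bary_eq hb, ← Finset.sum_coe_sort t]
  have e' : h.basis.coord ⟨b, hb⟩ (∑ i : t, (t.card : ℝ)⁻¹ • (i : Pt d)) = (t.card : ℝ)⁻¹ := e
  rw [e']; exact inv_pos.2 hc

/-- A continuous function on a simplex that is nonnegative and has integral zero vanishes in the
interior. -/
theorem eq_zero_of_elemInt_eq_zero {t : Finset (Pt d)} {f : ScalarField d} (hf : Continuous f)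
    (h0 : ∀ x ∈ simplex t, 0 ≤ f x) (hint : elemInt t f = 0) :
    ∀ x ∈ interior (simplex t), f x = 0 := by
  have hi : IntegrableOn f (simplex t) := hf.continuousOn.integrableOn_compact (isCompact_simplex t)
  have h1 : f =ᵐ[volume.restrict (simplex t)] 0 :=
    (integral_eq_zero_iff_of_nonneg_ae
      ((ae_restrict_mem (measurableSet_simplex t)).mono fun x hx => h0 x hx) hi).1 hint
  have h2 : f =ᵐ[volume.restrict (interior (simplex t))] 0 :=
    ae_restrict_of_ae_restrict_of_subset interior_subset h1
  exact Measure.eqOn_open_of_ae_eq (μ := volume) h2 isOpen_interior hf.continuousOn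
    continuousOn_const

theorem IsElem.poly_eq_zero {t : Finset (Pt d)} (h : IsElem t) {k : ℕ} {p : ScalarField d}
    (hp : IsPolyDeg k p) (h0 : elemInt t (fun x => p x * p x) = 0) (x : Pt d) : p x = 0 := by
  refine hp.eq_zero_of_isOpen isOpen_interior h.interior_nonempty (fun y hy => ?_) x
  have := eq_zero_of_elemInt_eq_zero (f := fun x => p x * p x) (hp.continuous.mul hp.continuous)
    (fun x _ => mul_self_nonneg _) h0 y hy
  exact mul_self_eq_zero.1 this

/-- The polynomial vector fields of degree at most `k`. -/
def polyVecSubmodule (d k : ℕ) : Submodule ℝ (VectorField d) :=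
  Submodule.pi univ fun _ => polySubmodule d k

theorem mem_polyVecSubmodule {k : ℕ} {q : VectorField d} :
    q ∈ polyVecSubmodule d k ↔ ∀ i, IsPolyDeg k (q i) := by
  simp [polyVecSubmodule, mem_polySubmodule]

instance (k : ℕ) : FiniteDimensional ℝ (polyVecSubmodule d k) := by
  let T : (Fin d → polySubmodule d k) →ₗ[ℝ] VectorField d :=
    { toFun := fun q i => q i
      map_add' := fun _ _ => rfl
      map_smul' := fun _ _ => rfl }
  have : polyVecSubmodule d k = LinearMap.range T := by
    ext q
    rw [mem_polyVecSubmodule, LinearMap.mem_range]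
    exact ⟨fun hq => ⟨fun i => ⟨q i, hq i⟩, rfl⟩, by rintro ⟨w, rfl⟩ i; exact (w i).2⟩
  rw [this]
  infer_instance

/-- A Raviart–Thomas field with vanishing normal component on the boundary of `t`, depending
linearly on `r`. -/
noncomputable def bubble (t : Finset (Pt d)) (r : VectorField d) : VectorField d :=
  fun i x => ∑ a ∈ t, bary t a x * (x i - a i) * (-∑ j, a j * r j x)

theorem continuous_bubble (t : Finset (Pt d)) {r : VectorField d} (hr : ∀ i, Continuous (r i))
    (i : Fin d) : Continuous (bubble t r i) := by
  have hx : Continuous (fun x : Pt d => x i) := by fun_prop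
  exact continuous_finsetSum _ fun a _ =>
    ((continuous_bary t a).mul (hx.sub continuous_const)).mul
      (continuous_finsetSum _ fun j _ => continuous_const.mul (hr j)).neg

theorem isRT_bubble {k : ℕ} (hk : 1 ≤ k) (t : Finset (Pt d)) {r : VectorField d}
    (hr : ∀ i, IsPolyDeg (k - 1) (r i)) : IsRT k (bubble t r) := by
  have hs : ∀ a : Pt d, IsPolyDeg k (fun x => bary t a x * (-∑ j, a j * r j x)) := by
    intro a
    have h1 : IsPolyDeg (k - 1) (fun x => (-1) * ∑ j, a j * r j x) :=
      (IsPolyDeg.sum _ fun j _ => (hr j).const_mul (a j)).const_mul (-1)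
    simp only [neg_one_mul] at h1
    exact ((IsPolyDeg.affine (bary t a)).mul h1).mono (by omega)
  refine ⟨fun i x => ∑ a ∈ t, (- a i) * (bary t a x * (-∑ j, a j * r j x)),
    fun x => ∑ a ∈ t, bary t a x * (-∑ j, a j * r j x),
    fun i => IsPolyDeg.sum _ fun a _ => (hs a).const_mul _, IsPolyDeg.sum _ fun a _ => hs a, ?_⟩
  intro i x
  simp only [bubble]
  rw [Finset.mul_sum, ← Finset.sum_add_distrib]
  exact Finset.sum_congr rfl fun a _ => by ring

theorem inner_eq_sum (x y : Pt d) : inner ℝ x y = ∑ i, y i * x i := by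
  simp [PiLp.inner_apply]

theorem IsElem.exists_height {t : Finset (Pt d)} {b : Pt d} (h : IsElem t) (hd : 0 < d)
    (hb : b ∈ t) : ∃ H : ℝ, 0 < H ∧ ∀ x, bary t b x = 0 →
      ∑ i, (x i - b i) * outwardNormal t b i = H ∧
        ∀ c ∈ t, c ≠ b → ∑ i, (x i - c i) * outwardNormal t b i = 0 := by
  obtain ⟨κ, hκ, e⟩ := h.exists_bary_sub hd hb
  have e' : ∀ x y, bary t b x - bary t b y =
      - κ * ∑ i, (x i - y i) * outwardNormal t b i := by
    intro x y; rw [e, inner_eq_sum]; simp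
  refine ⟨κ⁻¹, inv_pos.2 hκ, fun x hx => ⟨?_, fun c hc hcb => ?_⟩⟩
  · have := e' x b
    rw [hx, h.bary_self hb] at this
    have h2 : κ * ∑ i, (x i - b i) * outwardNormal t b i = 1 := by linarith
    exact eq_inv_of_mul_eq_one_right h2
  · have := e' x c
    rw [hx, h.bary_ne hb hc hcb] at this
    have h2 : κ * ∑ i, (x i - c i) * outwardNormal t b i = 0 := by linarith
    exact (mul_eq_zero.1 h2).resolve_left hκ.ne'

theorem IsElem.bubble_normal {t : Finset (Pt d)} {b : Pt d} (h : IsElem t) (hd : 0 < d)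
    (hb : b ∈ t) (r : VectorField d) {x : Pt d} (hx : x ∈ simplex (opp t b)) :
    ∑ i, bubble t r i x * outwardNormal t b i = 0 := by
  obtain ⟨H, -, hH⟩ := h.exists_height hd hb
  have h0 := ((h.mem_facet_iff hb).1 hx).1
  simp only [bubble, Finset.sum_mul]
  rw [Finset.sum_comm]
  refine Finset.sum_eq_zero fun a ha => ?_
  by_cases hab : a = b
  · subst hab; simp [h0]
  · have := (hH x h0).2 a ha hab
    calc ∑ i, bary t a x * (x i - a i) * (-∑ j, a j * r j x) * outwardNormal t b i
        = bary t a x * (-∑ j, a j * r j x) * ∑ i, (x i - a i) * outwardNormal t b i := by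
          rw [Finset.mul_sum]; exact Finset.sum_congr rfl fun i _ => by ring
      _ = 0 := by rw [this, mul_zero]

theorem IsElem.bubble_inner {t : Finset (Pt d)} (h : IsElem t) (r : VectorField d) (x : Pt d) :
    ∑ i, bubble t r i x * r i x =
      ∑ a ∈ t, bary t a x * (∑ j, (a j - x j) * r j x) ^ 2 := by
  have hx : ∀ j, x j = ∑ a ∈ t, bary t a x * a j := by
    intro j
    conv_lhs => rw [← h.sum_bary_smul x]
    simp
  set ξ : ℝ := ∑ j, x j * r j x with hξ
  let α : Pt d → ℝ := fun a => ∑ j, a j * r j x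
  have h1 : ∑ a ∈ t, bary t a x * α a = ξ := by
    simp only [α, hξ, Finset.mul_sum]
    rw [Finset.sum_comm]
    refine Finset.sum_congr rfl fun j _ => ?_
    rw [hx j, Finset.sum_mul]
    exact Finset.sum_congr rfl fun a _ => by ring
  have h2 : ∀ a, ∑ j, (a j - x j) * r j x = α a - ξ := by
    intro a; simp only [α, hξ, sub_mul, Finset.sum_sub_distrib]
  have h3 : ∑ i, bubble t r i x * r i x = ∑ a ∈ t, bary t a x * (ξ - α a) * (- α a) := by
    simp only [bubble, Finset.sum_mul]
    rw [Finset.sum_comm]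
    refine Finset.sum_congr rfl fun a _ => ?_
    rw [← neg_sub (α a), ← h2 a]
    simp only [α, Finset.sum_mul, Finset.mul_sum, ← Finset.sum_neg_distrib]
    rw [Finset.sum_comm]
    refine Finset.sum_congr rfl fun i _ => Finset.sum_congr rfl fun j _ => by ring
  rw [h3]
  have h4 : ∑ a ∈ t, bary t a x * (ξ - α a) * (- α a) =
      ∑ a ∈ t, (bary t a x * (α a - ξ) ^ 2 + ξ * (bary t a x * α a) - ξ ^ 2 * bary t a x) :=
    Finset.sum_congr rfl fun a _ => by ring
  rw [h4, Finset.sum_sub_distrib, Finset.sum_add_distrib, ← Finset.mul_sum, ← Finset.mul_sum, h1,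
    h.sum_bary]
  simp only [h2]
  ring

theorem IsElem.eq_zero_of_bubble {t : Finset (Pt d)} (h : IsElem t) {k : ℕ} {r : VectorField d}
    (hr : ∀ i, IsPolyDeg k (r i))
    (h0 : elemInt t (fun x => ∑ i, bubble t r i x * r i x) = 0) : r = 0 := by
  have hc : Continuous (fun x => ∑ i, bubble t r i x * r i x) :=
    continuous_finsetSum _ fun i _ =>
      (continuous_bubble t (fun i => (hr i).continuous) i).mul (hr i).continuous
  have hz := eq_zero_of_elemInt_eq_zero hc (fun x hx => by
    rw [h.bubble_inner]
    exact Finset.sum_nonneg fun a ha => mul_nonneg (h.mem_simplex_iff.1 hx a ha) (sq_nonneg _)) h0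
  ext i y
  refine (hr i).eq_zero_of_isOpen isOpen_interior h.interior_nonempty (fun x hx => ?_) y
  have h1 := hz x hx
  have hpos := h.mem_interior_simplex_iff.1 hx
  rw [h.bubble_inner, Finset.sum_eq_zero_iff_of_nonneg
    (fun a ha => mul_nonneg (hpos a ha).le (sq_nonneg _))] at h1
  have h2 : ∀ a ∈ t, ∑ j, (a j - x j) * r j x = 0 := fun a ha => by
    rcases mul_eq_zero.1 (h1 a ha) with h3 | h3
    · exact absurd h3 (hpos a ha).ne'
    · exact pow_eq_zero_iff (two_ne_zero) |>.1 h3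
  -- every vector is a combination of the vectors `a - x`
  have h3 : ∀ w : Pt d, ∑ j, w j * r j x = 0 := by
    intro w
    have hw : w = ∑ a ∈ t, bary t a (w + x) • (a - x) := by
      simp only [smul_sub, Finset.sum_sub_distrib, h.sum_bary_smul, ← Finset.sum_smul, h.sum_bary,
        one_smul]
      abel
    have hwj : ∀ j, w j = ∑ a ∈ t, bary t a (w + x) * (a j - x j) := by
      intro j; conv_lhs => rw [hw]
      simp
    calc ∑ j, w j * r j x = ∑ j, ∑ a ∈ t, bary t a (w + x) * ((a j - x j) * r j x) := by
          refine Finset.sum_congr rfl fun j _ => ?_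
          rw [hwj j, Finset.sum_mul]
          exact Finset.sum_congr rfl fun a _ => by ring
      _ = 0 := by
          rw [Finset.sum_comm]
          refine Finset.sum_eq_zero fun a ha => ?_
          rw [← Finset.mul_sum, h2 a ha, mul_zero]
  simpa [Pi.single_apply] using h3 (EuclideanSpace.single i 1)

/-- The interior moments of a bubble field can be prescribed. -/
theorem IsElem.exists_bubble {t : Finset (Pt d)} (h : IsElem t) (k : ℕ) {u : VectorField d}
    (hu : ∀ i, MemLp (u i) 2 (volume.restrict (simplex t))) :
    ∃ r : VectorField d, (∀ i, IsPolyDeg k (r i)) ∧ ∀ q : VectorField d,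
      (∀ i, IsPolyDeg k (q i)) →
        elemInt t (fun x => ∑ i, bubble t r i x * q i x) =
          elemInt t (fun x => ∑ i, u i x * q i x) := by
  let V := polyVecSubmodule d k
  have hcb : ∀ (r : V) i, Continuous (bubble t (r : VectorField d) i) := fun r i =>
    continuous_bubble t (fun i => (mem_polyVecSubmodule.1 r.2 i).continuous) i
  have hcq : ∀ (r : V) i, MemLp ((r : VectorField d) i) 2 (volume.restrict (simplex t)) :=
    fun r i => memLp_simplex t (mem_polyVecSubmodule.1 r.2 i).continuous
  have hint : ∀ (w : VectorField d), (∀ i, MemLp (w i) 2 (volume.restrict (simplex t))) →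
      ∀ q : V, Integrable (fun x => ∑ i, w i x * (q : VectorField d) i x)
        (volume.restrict (simplex t)) := fun w hw q =>
    integrable_finsetSum _ fun i _ => (hw i).integrable_mul (hcq q i)
  let ℓ : (w : VectorField d) → (∀ i, MemLp (w i) 2 (volume.restrict (simplex t))) →
      Module.Dual ℝ V := fun w hw =>
    { toFun := fun q => elemInt t (fun x => ∑ i, w i x * (q : VectorField d) i x)
      map_add' := fun p q => by
        simp only [elemInt]
        rw [← integral_add (hint w hw p) (hint w hw q)]
        congr 1; ext x
        simp [mul_add, Finset.sum_add_distrib]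
      map_smul' := fun c q => by
        simp only [elemInt, RingHom.id_apply, smul_eq_mul]
        rw [← integral_const_mul]
        congr 1; ext x
        simp only [Submodule.coe_smul, Pi.smul_apply, smul_eq_mul, Finset.mul_sum]
        exact Finset.sum_congr rfl fun i _ => by ring }
  have hbm : ∀ (r : V) i, MemLp (bubble t (r : VectorField d) i) 2
      (volume.restrict (simplex t)) := fun r i => memLp_simplex t (hcb r i)
  let B : V →ₗ[ℝ] Module.Dual ℝ V :=
    { toFun := fun r => ℓ (bubble t r) (hbm r)
      map_add' := fun r s => by
        ext q
        simp only [ℓ, LinearMap.coe_mk, AddHom.coe_mk, LinearMap.add_apply, elemInt]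
        rw [← integral_add (hint _ (hbm r) q) (hint _ (hbm s) q)]
        congr 1; ext x
        rw [← Finset.sum_add_distrib]
        refine Finset.sum_congr rfl fun i _ => ?_
        rw [← add_mul]
        congr 1
        simp only [bubble, ← Finset.sum_add_distrib]
        refine Finset.sum_congr rfl fun a _ => ?_
        simp only [Submodule.coe_add, Pi.add_apply, mul_add, Finset.sum_add_distrib]
        ring
      map_smul' := fun c r => by
        ext q
        simp only [ℓ, LinearMap.coe_mk, AddHom.coe_mk, LinearMap.smul_apply, elemInt,
          RingHom.id_apply, smul_eq_mul]
        rw [← integral_const_mul]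
        congr 1; ext x
        rw [Finset.mul_sum]
        refine Finset.sum_congr rfl fun i _ => ?_
        rw [← mul_assoc]
        congr 1
        simp only [bubble, Finset.mul_sum]
        refine Finset.sum_congr rfl fun a _ => ?_
        simp only [Submodule.coe_smul, Pi.smul_apply, smul_eq_mul]
        have : ∑ j, a j * (c * (r : VectorField d) j x) =
            c * ∑ j, a j * (r : VectorField d) j x := by
          rw [Finset.mul_sum]; exact Finset.sum_congr rfl fun j _ => by ring
        rw [this]; ring }
  have hinj : Function.Injective B := by
    rw [← LinearMap.ker_eq_bot, LinearMap.ker_eq_bot']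
    intro r hr
    have h0 : B r r = 0 := by rw [hr]; rfl
    exact Subtype.ext (h.eq_zero_of_bubble (mem_polyVecSubmodule.1 r.2) h0)
  have hsurj := (LinearMap.injective_iff_surjective_of_finrank_eq_finrank
    (Subspace.dual_finrank_eq (K := ℝ) (V := V)).symm).1 hinj
  obtain ⟨r, hr⟩ := hsurj (ℓ u hu)
  refine ⟨r, mem_polyVecSubmodule.1 r.2, fun q hq => ?_⟩
  exact congrArg (fun φ : Module.Dual ℝ V => φ ⟨q, mem_polyVecSubmodule.2 hq⟩) hr

/-- The Raviart–Thomas degrees of freedom can be prescribed. -/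
theorem IsElem.exists_RT {t : Finset (Pt d)} (h : IsElem t) (hd : 0 < d) {k : ℕ} (hk : 1 ≤ k)
    {g : Pt d → ScalarField d} {u : VectorField d}
    (hg : ∀ a ∈ t, MemLp (g a) 2 ((surf d).restrict (simplex (opp t a))))
    (hu : ∀ i, MemLp (u i) 2 (volume.restrict (simplex t))) :
    ∃ w : VectorField d, IsRT k w ∧
      (∀ a ∈ t, ∀ q, IsPolyDeg k q →
        facetInt (opp t a) (fun x => (∑ i, w i x * outwardNormal t a i) * q x) =
          facetInt (opp t a) (fun x => g a x * q x)) ∧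
      ∀ q : VectorField d, (∀ i, IsPolyDeg (k - 1) (q i)) →
        elemInt t (fun x => ∑ i, w i x * q i x) = elemInt t (fun x => ∑ i, u i x * q i x) := by
  classical
  have hH : ∀ a : Pt d, ∃ H : ℝ, a ∈ t → 0 < H ∧ ∀ x, bary t a x = 0 →
      ∑ i, (x i - a i) * outwardNormal t a i = H ∧
        ∀ c ∈ t, c ≠ a → ∑ i, (x i - c i) * outwardNormal t a i = 0 := by
    intro a
    by_cases ha : a ∈ t
    · obtain ⟨H, hH⟩ := h.exists_height hd ha; exact ⟨H, fun _ => hH⟩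
    · exact ⟨0, fun hh => absurd hh ha⟩
  choose H hH using hH
  let Q : Pt d → ScalarField d := fun a => facetProj k (opp t a) (g a)
  have hQ := fun a ha => h.facetProj_spec k hd ha (hg a ha)
  let w₁ : VectorField d := fun i x => ∑ a ∈ t, (x i - a i) * ((H a)⁻¹ * Q a x)
  have hw₁ : IsRT k w₁ := by
    refine ⟨fun i x => ∑ a ∈ t, (- a i) * ((H a)⁻¹ * Q a x), fun x => ∑ a ∈ t, (H a)⁻¹ * Q a x,
      fun i => IsPolyDeg.sum _ fun a ha => ((hQ a ha).1.const_mul _).const_mul _,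
      IsPolyDeg.sum _ fun a ha => (hQ a ha).1.const_mul _, fun i x => ?_⟩
    simp only [w₁]
    rw [Finset.mul_sum, ← Finset.sum_add_distrib]
    exact Finset.sum_congr rfl fun a _ => by ring
  have hn₁ : ∀ b ∈ t, ∀ x ∈ simplex (opp t b), ∑ i, w₁ i x * outwardNormal t b i = Q b x := by
    intro b hb x hx
    have h0 := ((h.mem_facet_iff hb).1 hx).1
    have e := (hH b hb).2 x h0
    simp only [w₁, Finset.sum_mul]
    rw [Finset.sum_comm, Finset.sum_eq_single b]
    · calc ∑ i, (x i - b i) * ((H b)⁻¹ * Q b x) * outwardNormal t b i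
          = (H b)⁻¹ * Q b x * ∑ i, (x i - b i) * outwardNormal t b i := by
            rw [Finset.mul_sum]; exact Finset.sum_congr rfl fun i _ => by ring
        _ = Q b x := by rw [e.1]; field_simp [(hH b hb).1.ne']
    · intro a ha hab
      calc ∑ i, (x i - a i) * ((H a)⁻¹ * Q a x) * outwardNormal t b i
          = (H a)⁻¹ * Q a x * ∑ i, (x i - a i) * outwardNormal t b i := by
            rw [Finset.mul_sum]; exact Finset.sum_congr rfl fun i _ => by ring
        _ = 0 := by rw [e.2 a ha hab, mul_zero]
    · exact fun hh => absurd hb hh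
  have hm₁ : ∀ i, MemLp (w₁ i) 2 (volume.restrict (simplex t)) := fun i =>
    memLp_simplex t (hw₁.isPolyDeg_succ i).continuous
  obtain ⟨r, hr, hrq⟩ := h.exists_bubble (k - 1) (u := fun i x => u i x - w₁ i x)
    (fun i => (hu i).sub (hm₁ i))
  have hb := isRT_bubble hk t hr
  refine ⟨fun i x => w₁ i x + bubble t r i x, ?_, ?_, ?_⟩
  · obtain ⟨p₁, q₁, hp₁, hq₁, e₁⟩ := hw₁
    obtain ⟨p₂, q₂, hp₂, hq₂, e₂⟩ := hb
    exact ⟨fun i x => p₁ i x + p₂ i x, fun x => q₁ x + q₂ x, fun i => (hp₁ i).add (hp₂ i),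
      hq₁.add hq₂, fun i x => by simp only [e₁, e₂]; ring⟩
  · intro a ha q hq
    rw [← (hQ a ha).2 q hq]
    refine setIntegral_congr_fun (measurableSet_simplex _) fun x hx => ?_
    simp only [add_mul, Finset.sum_add_distrib]
    rw [hn₁ a ha x hx, h.bubble_normal hd ha r hx, zero_mul, add_zero]
  · intro q hq
    have hqm : ∀ i, MemLp (q i) 2 (volume.restrict (simplex t)) := fun i =>
      memLp_simplex t (hq i).continuous
    have hi : ∀ v : VectorField d, (∀ i, MemLp (v i) 2 (volume.restrict (simplex t))) →
        Integrable (fun x => ∑ i, v i x * q i x) (volume.restrict (simplex t)) := fun v hv =>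
      integrable_finsetSum _ fun i _ => (hv i).integrable_mul (hqm i)
    have e := hrq q hq
    simp only [elemInt, add_mul, sub_mul, Finset.sum_add_distrib, Finset.sum_sub_distrib] at e ⊢
    rw [integral_add (hi w₁ hm₁)
      (hi _ fun i => memLp_simplex t (hb.isPolyDeg_succ i).continuous), e,
      integral_sub (hi u hu) (hi w₁ hm₁)]
    ring


/-! ### Averages of translations converge in `L²` -/

theorem eLpNorm_two_sq {X : Type*} [MeasurableSpace X] (μ : Measure X) (f : X → ℝ) :
    eLpNorm f 2 μ ^ 2 = ∫⁻ x, ‖f x‖ₑ ^ 2 ∂μ := by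
  have := eLpNorm_nnreal_pow_eq_lintegral (f := f) (μ := μ) (p := 2) two_ne_zero
  simpa using this

theorem tendsto_eLpNorm_two_iff {α X : Type*} [MeasurableSpace X] (μ : Measure X) (l : Filter α)
    (f : α → X → ℝ) :
    Tendsto (fun n => eLpNorm (f n) 2 μ) l (𝓝 0) ↔
      Tendsto (fun n => ∫⁻ x, ‖f n x‖ₑ ^ 2 ∂μ) l (𝓝 0) := by
  simp only [← eLpNorm_two_sq]
  constructor
  · intro h
    simpa [Function.comp_def] using ((ENNReal.continuous_pow 2).tendsto 0).comp h
  · intro h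
    have h1 := ((ENNReal.continuous_rpow_const (y := (1 / 2 : ℝ))).tendsto 0).comp h
    rw [ENNReal.zero_rpow_of_pos (by norm_num)] at h1
    refine h1.congr fun n => ?_
    simp only [Function.comp_apply]
    rw [← ENNReal.rpow_natCast, ← ENNReal.rpow_mul]
    norm_num

/-- `k` is a smooth probability density that vanishes outside the ball of radius `δ`. -/
structure IsKernel (k : Pt d → ℝ) (δ : ℝ) : Prop where
  nonneg : ∀ z, 0 ≤ k z
  contDiff : ContDiff ℝ ∞ k
  compact : HasCompactSupport k
  integral : ∫ z, k z = 1
  small : ∀ z, k z ≠ 0 → ‖z‖ < δ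

theorem IsKernel.continuous {k : Pt d → ℝ} {δ : ℝ} (hk : IsKernel k δ) : Continuous k :=
  hk.contDiff.continuous

theorem IsKernel.integrable {k : Pt d → ℝ} {δ : ℝ} (hk : IsKernel k δ) : Integrable k :=
  hk.continuous.integrable_of_hasCompactSupport hk.compact

theorem IsKernel.lintegral {k : Pt d → ℝ} {δ : ℝ} (hk : IsKernel k δ) :
    ∫⁻ z, ‖k z‖ₑ = 1 := by
  rw [← ofReal_integral_norm_eq_lintegral_enorm hk.integrable]
  simp only [Real.norm_of_nonneg (hk.nonneg _), hk.integral, ENNReal.ofReal_one]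

theorem IsKernel.enorm_integral_sq_le {k : Pt d → ℝ} {δ : ℝ} (hk : IsKernel k δ)
    {g : Pt d → ℝ} (hg : Measurable g) :
    ‖∫ z, k z * g z‖ₑ ^ 2 ≤ ∫⁻ z, ‖k z‖ₑ * ‖g z‖ₑ ^ 2 := by
  have hkm : Measurable k := hk.continuous.measurable
  have h1 : ‖∫ z, k z * g z‖ₑ ≤ ∫⁻ z, ‖k z‖ₑ ^ (1 / 2 : ℝ) * (‖k z‖ₑ ^ (1 / 2 : ℝ) * ‖g z‖ₑ) := by
    refine (enorm_integral_le_lintegral_enorm _).trans (le_of_eq (lintegral_congr fun z => ?_))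
    rw [← mul_assoc, ← ENNReal.rpow_add_of_nonneg _ _ (by norm_num) (by norm_num), enorm_mul]
    norm_num
  have h2 := ENNReal.lintegral_mul_le_Lp_mul_Lq volume (Real.HolderConjugate.two_two)
    (f := fun z => ‖k z‖ₑ ^ (1 / 2 : ℝ)) (g := fun z => ‖k z‖ₑ ^ (1 / 2 : ℝ) * ‖g z‖ₑ)
    (by fun_prop) (by fun_prop)
  have e1 : ∀ z, (‖k z‖ₑ ^ (1 / 2 : ℝ)) ^ (2 : ℝ) = ‖k z‖ₑ := fun z => by
    rw [← ENNReal.rpow_mul]; norm_num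
  have e2 : ∀ z, (‖k z‖ₑ ^ (1 / 2 : ℝ) * ‖g z‖ₑ) ^ (2 : ℝ) = ‖k z‖ₑ * ‖g z‖ₑ ^ 2 := fun z => by
    rw [ENNReal.mul_rpow_of_nonneg _ _ (by norm_num), e1]; norm_num
  have h3 := h1.trans h2
  simp only [e1, e2, hk.lintegral, ENNReal.one_rpow, one_mul] at h3
  calc ‖∫ z, k z * g z‖ₑ ^ 2 ≤ ((∫⁻ z, ‖k z‖ₑ * ‖g z‖ₑ ^ 2) ^ (1 / 2 : ℝ)) ^ 2 :=
        pow_le_pow_left' h3 2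
    _ = ∫⁻ z, ‖k z‖ₑ * ‖g z‖ₑ ^ 2 := by
        rw [← ENNReal.rpow_natCast, ← ENNReal.rpow_mul]; norm_num

section Average

variable {X : Type*} [NormedAddCommGroup X] [MeasurableSpace X] [BorelSpace X]
  (μ : Measure X) [μ.IsAddLeftInvariant] [IsLocallyFiniteMeasure μ] [μ.InnerRegularCompactLTTop]

theorem tendsto_translation {ι : Pt d → X} (hι : Continuous ι) (hι0 : ι 0 = 0) {G : X → ℝ}
    (hG : MemLp G 2 μ) :
    Tendsto (fun z => ∫⁻ x, ‖G (x - ι z) - G x‖ₑ ^ 2 ∂μ) (𝓝 0) (𝓝 0) := by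
  let g : Pt d → C(X, X) := fun z => ⟨fun x => x - ι z, by fun_prop⟩
  have hg : Continuous g :=
    (ContinuousMap.curry ⟨fun q : Pt d × X => q.2 - ι q.1, by fun_prop⟩).continuous
  have hmp : ∀ z, MeasurePreserving (g z) μ μ := fun z => measurePreserving_sub_right μ (ι z)
  have h1 := Tendsto.compMeasurePreservingLp (f := fun _ : Pt d => hG.toLp) (f₀ := hG.toLp)
    tendsto_const_nhds (hg.tendsto 0) hmp (hmp 0) ENNReal.ofNat_ne_top
  have h0 : Lp.compMeasurePreserving (g 0) (hmp 0) hG.toLp = hG.toLp := by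
    have hg0 : ⇑(g 0) = id := by ext x; simp [g, hι0]
    rw [Lp.toLp_compMeasurePreserving]
    simp [hg0]
  rw [h0] at h1
  have h2 : Tendsto (fun z => eLpNorm (fun x => G (x - ι z) - G x) 2 μ) (𝓝 0) (𝓝 0) := by
    rw [Lp.tendsto_Lp_iff_tendsto_eLpNorm'] at h1
    refine h1.congr fun z => eLpNorm_congr_ae ?_
    filter_upwards [Lp.coeFn_compMeasurePreserving hG.toLp (hmp z), hG.coeFn_toLp,
      (hmp z).quasiMeasurePreserving.ae_eq_comp hG.coeFn_toLp] with x e1 e2 e3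
    simp only [Function.comp_apply] at e1 e3
    rw [Pi.sub_apply, e1, e2, e3]; rfl
  have h3 := ((ENNReal.continuous_pow 2).tendsto 0).comp h2
  simp only [Function.comp_def, eLpNorm_two_sq] at h3
  simpa using h3

theorem tendsto_average [SecondCountableTopology X] [SFinite μ] {ι : Pt d → X}
    (hι : Continuous ι) (hι0 : ι 0 = 0) {G : X → ℝ}
    (hGm : Measurable G) (hG : MemLp G 2 μ) {k : ℕ → Pt d → ℝ} {δ : ℕ → ℝ}
    (hk : ∀ n, IsKernel (k n) (δ n)) (hδ : Tendsto δ atTop (𝓝 0)) :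
    Tendsto (fun n => ∫⁻ x, ‖∫ z, k n z * (G (x - ι z) - G x)‖ₑ ^ 2 ∂μ) atTop (𝓝 0) := by
  rw [ENNReal.tendsto_nhds_zero]
  intro η hη
  have h1 := (ENNReal.tendsto_nhds_zero.1 (tendsto_translation μ hι hι0 hG)) η hη
  obtain ⟨r, hr, hb⟩ := Metric.eventually_nhds_iff.1 h1
  filter_upwards [hδ.eventually_lt_const hr] with n hn
  have hιm : Measurable ι := hι.measurable
  have hkm : Measurable (k n) := (hk n).continuous.measurable
  calc ∫⁻ x, ‖∫ z, k n z * (G (x - ι z) - G x)‖ₑ ^ 2 ∂μ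
      ≤ ∫⁻ x, (∫⁻ z, ‖k n z‖ₑ * ‖G (x - ι z) - G x‖ₑ ^ 2) ∂μ :=
        lintegral_mono fun x => (hk n).enorm_integral_sq_le (by fun_prop)
    _ = ∫⁻ z, ∫⁻ x, ‖k n z‖ₑ * ‖G (x - ι z) - G x‖ₑ ^ 2 ∂μ := by
        refine lintegral_lintegral_swap (Measurable.aemeasurable ?_)
        fun_prop
    _ ≤ ∫⁻ z, ‖k n z‖ₑ * η := by
        refine lintegral_mono fun z => ?_
        dsimp only
        rw [lintegral_const_mul _ (by fun_prop)]
        by_cases hz : k n z = 0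
        · simp [hz]
        · gcongr
          exact hb (by rw [dist_zero_right]; exact ((hk n).small z hz).trans hn)
    _ = η := by rw [lintegral_mul_const _ (by fun_prop), (hk n).lintegral, one_mul]

end Average


/-! ### Kernels adapted to a Lipschitz boundary -/

/-- The kernels `k n` concentrate at the origin, and averaging with them at points of `Ω` close to
`x₀` only uses values in `Ω`. -/
structure IsChart (Ω : Set (Pt d)) (x₀ : Pt d) (r : ℝ) (k : ℕ → Pt d → ℝ) (δ : ℕ → ℝ) : Prop where
  pos : 0 < r
  kernel : ∀ n, IsKernel (k n) (δ n)
  tendsto : Tendsto δ atTop (𝓝 0)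
  small : ∀ n, ∀ z ∈ tsupport (k n), ‖z‖ < r / 8
  shift : ∀ n, ∀ z ∈ tsupport (k n), ∀ y ∈ Ω, y ∈ Metric.ball x₀ (3 * r / 4) → y - z ∈ Ω

theorem exists_isChart_of_shift {Ω : Set (Pt d)} {x₀ e : Pt d} {r κ : ℝ} (hr : 0 < r)
    (he : ‖e‖ ≤ 1) (hκ : 0 < κ) (hκ1 : κ ≤ 1)
    (h : ∀ τ > 0, ∀ z : Pt d, ‖z - τ • e‖ ≤ κ * τ → ∀ y ∈ Ω, y ∈ Metric.ball x₀ r →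
      y + z ∈ Metric.ball x₀ r → y + z ∈ Ω) :
    ∃ k δ, IsChart Ω x₀ r k δ := by
  let τ : ℕ → ℝ := fun n => r / 32 * (1 / ((n : ℝ) + 1))
  have hτ : ∀ n, 0 < τ n := fun n => by positivity
  have hτr : ∀ n, τ n ≤ r / 32 := fun n => by
    have : 1 / ((n : ℝ) + 1) ≤ 1 := by
      rw [div_le_one (by positivity)]
      have : (0 : ℝ) ≤ n := by positivity
      linarith
    calc τ n ≤ r / 32 * 1 := mul_le_mul_of_nonneg_left this (by positivity)
      _ = r / 32 := mul_one _
  let b : ∀ n, ContDiffBump (-(τ n • e)) := fun n =>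
    ⟨κ * τ n / 2, κ * τ n, by have := mul_pos hκ (hτ n); positivity,
      by have := mul_pos hκ (hτ n); linarith⟩
  have hts : ∀ n, ∀ z ∈ tsupport ((b n).normed volume), ‖z + τ n • e‖ ≤ κ * τ n := by
    intro n z hz
    rw [ContDiffBump.tsupport_normed_eq, Metric.mem_closedBall, dist_eq_norm, sub_neg_eq_add] at hz
    exact hz
  have hnorm : ∀ n, ∀ z ∈ tsupport ((b n).normed volume), ‖z‖ ≤ 2 * τ n := by
    intro n z hz
    have h1 := hts n z hz
    have h2 : ‖τ n • e‖ ≤ τ n := by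
      rw [norm_smul, Real.norm_of_nonneg (hτ n).le]
      exact mul_le_of_le_one_right (hτ n).le he
    have h3 : ‖z‖ ≤ ‖z + τ n • e‖ + ‖τ n • e‖ := by
      calc ‖z‖ = ‖(z + τ n • e) - τ n • e‖ := by rw [add_sub_cancel_right]
        _ ≤ _ := norm_sub_le _ _
    have h4 : κ * τ n ≤ τ n := mul_le_of_le_one_left (hτ n).le hκ1
    linarith
  refine ⟨fun n => (b n).normed volume, fun n => 3 * τ n, hr, fun n => ?_, ?_, ?_, ?_⟩
  · exact ⟨(b n).nonneg_normed, (b n).contDiff_normed, (b n).hasCompactSupport_normed,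
      (b n).integral_normed, fun z hz => by
        have := hnorm n z (subset_tsupport _ hz)
        linarith [hτ n]⟩
  · have : Tendsto (fun n : ℕ => 3 * (r / 32 * (1 / ((n : ℝ) + 1)))) atTop (𝓝 (3 * (r / 32 * 0))) :=
      (tendsto_one_div_add_atTop_nhds_zero_nat.const_mul _).const_mul _
    simpa only [mul_zero] using this
  · intro n z hz
    have := hnorm n z hz
    linarith [hτr n]
  · intro n z hz y hy hyb
    have h1 := hnorm n z hz
    have hyr : ‖y - x₀‖ < 3 * r / 4 := by rwa [Metric.mem_ball, dist_eq_norm] at hyb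
    rw [sub_eq_add_neg]
    refine h (τ n) (hτ n) (-z) ?_ y hy (Metric.ball_subset_ball (by linarith) hyb) ?_
    · rw [← norm_neg, neg_sub, sub_neg_eq_add, add_comm]; exact hts n z hz
    · rw [Metric.mem_ball, dist_eq_norm]
      have : ‖y + -z - x₀‖ ≤ ‖y - x₀‖ + ‖z‖ := by
        calc ‖y + -z - x₀‖ = ‖(y - x₀) - z‖ := by congr 1; abel
          _ ≤ _ := norm_sub_le _ _
      linarith [hτr n]

theorem exists_isChart {Ω : Set (Pt d)} (hΩ : IsOpen Ω) (hLip : HasLipschitzBoundary Ω) {x₀ : Pt d}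
    (hx : x₀ ∈ closure Ω) : ∃ r k δ, IsChart Ω x₀ r k δ := by
  by_cases hxΩ : x₀ ∈ Ω
  · obtain ⟨r, hr, hb⟩ := Metric.isOpen_iff.1 hΩ x₀ hxΩ
    exact ⟨r, exists_isChart_of_shift (e := 0) (κ := 1) hr (by simp) one_pos le_rfl
      fun τ _ z _ y _ _ hyz => hb hyz⟩
  · have hxf : x₀ ∈ frontier Ω := by rw [hΩ.frontier_eq]; exact ⟨hx, hxΩ⟩
    obtain ⟨e, γ, C, r, he, hγ, hr, hb⟩ := hLip x₀ hxf
    refine ⟨r, exists_isChart_of_shift (e := e) (κ := ((C : ℝ) + 2)⁻¹) hr he.le (by positivity) ?_ ?_⟩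
    · rw [inv_le_one_iff₀]; right; linarith [C.2]
    · intro τ hτ z hz y hy hyb hyzb
      rw [hb _ hyzb]
      rw [hb y hyb] at hy
      set κ : ℝ := ((C : ℝ) + 2)⁻¹ with hκ
      have hC0 : (0 : ℝ) ≤ C := C.2
      have hκ0 : 0 < κ := by positivity
      have hκC : κ * (C + 2) = 1 := by rw [hκ]; field_simp
      have hee : inner ℝ e e = (1 : ℝ) := by rw [real_inner_self_eq_norm_sq, he]; norm_num
      let Q : Pt d → Pt d := fun v => v - (inner ℝ e v) • e
      have hQ : ‖Q z‖ ≤ κ * τ := by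
        have e1 : Q z = (z - τ • e) - (inner ℝ e (z - τ • e)) • e := by
          simp only [Q, inner_sub_right, inner_smul_right, hee, sub_smul, mul_one]; abel
        have e2 : ‖Q z‖ ^ 2 ≤ ‖z - τ • e‖ ^ 2 := by
          rw [e1, norm_sub_sq_real, inner_smul_right, norm_smul, he, mul_one,
            real_inner_comm e, Real.norm_eq_abs, sq_abs]
          nlinarith [sq_nonneg (inner ℝ e (z - τ • e) : ℝ)]
        exact (abs_le_of_sq_le_sq' e2 (norm_nonneg _)).2.trans hz
      have hin : τ - κ * τ ≤ inner ℝ e z := by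
        have h1 : |inner ℝ e (z - τ • e)| ≤ κ * τ := by
          refine (abs_real_inner_le_norm _ _).trans ?_
          rw [he, one_mul]; exact hz
        rw [inner_sub_right, inner_smul_right, hee, mul_one] at h1
        linarith [(abs_le.1 h1).1]
      have hlip : γ (Q (y + z)) ≤ γ (Q y) + C * ‖Q z‖ := by
        have h1 := hγ.dist_le_mul (Q (y + z)) (Q y)
        have h2 : Q (y + z) - Q y = Q z := by
          simp only [Q, inner_add_right, add_smul]; abel
        rw [Real.dist_eq, dist_eq_norm, h2] at h1
        linarith [(abs_le.1 h1).2]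
      change γ (Q (y + z)) < _
      change γ (Q y) < _ at hy
      rw [inner_add_right]
      have h3 : (C : ℝ) * ‖Q z‖ ≤ C * (κ * τ) := by gcongr
      have h4 : (C : ℝ) * (κ * τ) = τ - 2 * (κ * τ) := by
        have : τ = κ * (C + 2) * τ := by rw [hκC, one_mul]
        nlinarith
      have h5 : 0 < κ * τ := mul_pos hκ0 hτ
      linarith

/-! ### Mollification of functions on `Ω` -/

/-- The average of `f`, extended by zero outside `Ω`, with respect to the kernel `k`. -/
noncomputable def mollify (Ω : Set (Pt d)) (k : Pt d → ℝ) (f : Pt d → ℝ) : Pt d → ℝ :=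
  convolution k (Ω.indicator f) (ContinuousLinearMap.lsmul ℝ ℝ) volume

theorem mollify_apply (Ω : Set (Pt d)) (k f : Pt d → ℝ) (x : Pt d) :
    mollify Ω k f x = ∫ z, k z * Ω.indicator f (x - z) := by
  simp [mollify, convolution]

theorem memLp_indicator {Ω : Set (Pt d)} (hΩ : MeasurableSet Ω) {f : Pt d → ℝ} (hf : MemL2 Ω f) :
    MemLp (Ω.indicator f) 2 volume :=
  (memLp_indicator_iff_restrict hΩ).2 hf

theorem locallyIntegrable_indicator {Ω : Set (Pt d)} (hΩ : MeasurableSet Ω) {f : Pt d → ℝ}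
    (hf : MemL2 Ω f) : LocallyIntegrable (Ω.indicator f) volume :=
  (memLp_indicator hΩ hf).locallyIntegrable (by norm_num)

theorem mollify_congr {Ω : Set (Pt d)} (hΩ : MeasurableSet Ω) (k : Pt d → ℝ) {f g : Pt d → ℝ}
    (h : f =ᵐ[volume.restrict Ω] g) : mollify Ω k f = mollify Ω k g := by
  ext x
  rw [mollify_apply, mollify_apply]
  have h1 : Ω.indicator f =ᵐ[volume] Ω.indicator g := (ae_eq_restrict_iff_indicator_ae_eq hΩ).1 h
  refine integral_congr_ae ?_
  have h2 := (Measure.measurePreserving_sub_left volume x).quasiMeasurePreserving.ae_eq_comp h1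
  filter_upwards [h2] with z hz
  simp only [Function.comp_apply] at hz
  rw [hz]

theorem contDiff_mollify {Ω : Set (Pt d)} (hΩ : MeasurableSet Ω) {k : Pt d → ℝ} {δ : ℝ}
    (hk : IsKernel k δ) {f : Pt d → ℝ} (hf : MemL2 Ω f) : ContDiff ℝ ∞ (mollify Ω k f) :=
  hk.compact.contDiff_convolution_left _ hk.contDiff (locallyIntegrable_indicator hΩ hf)

theorem integrable_kernel_mul {Ω : Set (Pt d)} (hΩ : MeasurableSet Ω) {k : Pt d → ℝ}
    (hk : HasCompactSupport k) (hk' : Continuous k) {f : Pt d → ℝ} (hf : MemL2 Ω f) (x : Pt d) :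
    Integrable (fun z => k z * Ω.indicator f (x - z)) := by
  have := hk.convolutionExists_left (ContinuousLinearMap.lsmul ℝ ℝ) hk'
    (locallyIntegrable_indicator hΩ hf) x
  simpa [ConvolutionExistsAt] using this

theorem mollify_sub {Ω : Set (Pt d)} (hΩ : MeasurableSet Ω) {k : Pt d → ℝ} {δ : ℝ}
    (hk : IsKernel k δ) {f g : Pt d → ℝ} (hf : MemL2 Ω f) (hg : MemL2 Ω g) (x : Pt d) :
    mollify Ω k (fun y => f y - g y) x = mollify Ω k f x - mollify Ω k g x := by
  rw [mollify_apply, mollify_apply, mollify_apply,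
    ← integral_sub (integrable_kernel_mul hΩ hk.compact hk.continuous hf x)
      (integrable_kernel_mul hΩ hk.compact hk.continuous hg x)]
  congr 1; ext z
  rw [← mul_sub]
  congr 1
  by_cases h : x - z ∈ Ω <;> simp [h]

theorem mollify_sub_self {Ω : Set (Pt d)} (hΩ : MeasurableSet Ω) {k : Pt d → ℝ} {δ : ℝ}
    (hk : IsKernel k δ) {f : Pt d → ℝ} (hf : MemL2 Ω f) (x : Pt d) :
    mollify Ω k f x - Ω.indicator f x =
      ∫ z, k z * (Ω.indicator f (x - z) - Ω.indicator f x) := by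
  simp only [mul_sub]
  rw [integral_sub (integrable_kernel_mul hΩ hk.compact hk.continuous hf x)
    (hk.integrable.mul_const _), integral_mul_const, hk.integral, one_mul, mollify_apply]

theorem tendstoL2_mollify {Ω : Set (Pt d)} (hΩ : MeasurableSet Ω) {k : ℕ → Pt d → ℝ} {δ : ℕ → ℝ}
    (hk : ∀ n, IsKernel (k n) (δ n)) (hδ : Tendsto δ atTop (𝓝 0)) {f : Pt d → ℝ}
    (hf : MemL2 Ω f) : TendstoL2 Ω (fun n => mollify Ω (k n) f) f := by
  obtain ⟨g, hgm, hfg⟩ := hf.1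
  have hg : MemL2 Ω g := (memLp_congr_ae hfg).1 hf
  have h1 := tendsto_average volume (ι := fun z : Pt d => z) continuous_id rfl
    (hgm.measurable.indicator hΩ) (memLp_indicator hΩ hg) hk hδ
  rw [TendstoL2, tendsto_eLpNorm_two_iff]
  refine tendsto_of_tendsto_of_tendsto_of_le_of_le tendsto_const_nhds h1 (fun _ => zero_le) ?_
  intro n
  dsimp only
  refine le_trans (le_of_eq ?_) (setLIntegral_le_lintegral Ω _)
  refine lintegral_congr_ae ?_
  filter_upwards [hfg, ae_restrict_mem hΩ] with x hx hxΩ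
  rw [← mollify_sub_self hΩ (hk n) hg, indicator_of_mem hxΩ, ← hx, mollify_congr hΩ (k n) hfg]
  rfl


/-! ### The Sobolev–Slobodeckij seminorm -/

/-- The difference quotient whose `L²` norm is the Sobolev–Slobodeckij seminorm. -/
noncomputable def diffQuot (s : ℝ) (u : Pt d → ℝ) (q : Pt d × Pt d) : ℝ :=
  (u q.1 - u q.2) / ‖q.1 - q.2‖ ^ (((d : ℝ) + 2 * s) / 2)

theorem ofReal_eq_diffQuot (s : ℝ) (u : Pt d → ℝ) (x y : Pt d) :
    ENNReal.ofReal ((u x - u y) ^ 2 / ‖x - y‖ ^ ((d : ℝ) + 2 * s)) =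
      ‖diffQuot s u (x, y)‖ₑ ^ 2 := by
  rw [Real.enorm_eq_ofReal_abs, ← ENNReal.ofReal_pow (abs_nonneg _), sq_abs, diffQuot, div_pow]
  congr 2
  rw [← Real.rpow_natCast (_ ^ _), ← Real.rpow_mul (norm_nonneg _)]
  congr 1
  push_cast; ring

theorem slobodeckij_eq (Ω : Set (Pt d)) (s : ℝ) (u : Pt d → ℝ) :
    slobodeckij Ω s u = ∫⁻ x in Ω, ∫⁻ y in Ω, ‖diffQuot s u (x, y)‖ₑ ^ 2 := by
  simp only [slobodeckij, ofReal_eq_diffQuot]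

theorem slobodeckij_congr {Ω : Set (Pt d)} (s : ℝ) {u v : Pt d → ℝ}
    (h : u =ᵐ[volume.restrict Ω] v) : slobodeckij Ω s u = slobodeckij Ω s v := by
  refine lintegral_congr_ae ?_
  filter_upwards [h] with x hx
  refine lintegral_congr_ae ?_
  filter_upwards [h] with y hy
  rw [hx, hy]

theorem measurable_diffQuot (s : ℝ) {u : Pt d → ℝ} (hu : Measurable u) :
    Measurable (diffQuot s u) := by
  unfold diffQuot
  fun_prop

theorem slobodeckij_eq_eLpNorm (Ω : Set (Pt d)) (s : ℝ) {u : Pt d → ℝ} (hu : Measurable u) :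
    slobodeckij Ω s u =
      eLpNorm (diffQuot s u) 2 ((volume.restrict Ω).prod (volume.restrict Ω)) ^ 2 := by
  rw [slobodeckij_eq, eLpNorm_two_sq, lintegral_prod _ (by
    have := measurable_diffQuot s hu; fun_prop)]

theorem tendsto_slobodeckij_iff (Ω : Set (Pt d)) (s : ℝ) {u : ℕ → Pt d → ℝ}
    (hu : ∀ n, Measurable (u n)) :
    Tendsto (fun n => slobodeckij Ω s (u n)) atTop (𝓝 0) ↔
      Tendsto (fun n => eLpNorm (diffQuot s (u n)) 2
        ((volume.restrict Ω).prod (volume.restrict Ω))) atTop (𝓝 0) := by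
  rw [tendsto_eLpNorm_two_iff]
  simp only [slobodeckij_eq_eLpNorm Ω s (hu _), eLpNorm_two_sq]

theorem exists_bound_diffQuot {Ω : Set (Pt d)} (hΩ : MeasurableSet Ω) (hd : 0 < d)
    (hb : Bornology.IsBounded Ω) {s : ℝ}
    (hs1 : s < 1) {φ : Pt d → ℝ} (hφ : ContDiff ℝ ∞ φ) (hφc : HasCompactSupport φ) :
    ∃ C : ℝ≥0∞, C < ⊤ ∧ ∀ y ∈ Ω, ∫⁻ x in Ω, ‖diffQuot s φ (x, y)‖ₑ ^ 2 ≤ C := by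
  obtain ⟨K, hK⟩ := (hφ.of_le (m := 1) (by simp)).lipschitzWith_of_hasCompactSupport hφc one_ne_zero
  obtain ⟨R, hR⟩ := hb.subset_ball 0
  let α : ℝ := d + 2 * s - 2
  let h : Pt d → ℝ := fun z => (K : ℝ) ^ 2 * ‖z‖ ^ (-α)
  have hint : IntegrableOn h (Metric.ball 0 (2 * R)) volume := by
    refine integrableOn_ball_of_norm_le_rpow (α := α) (C := (K : ℝ) ^ 2) ?_ ?_ ?_ ?_
    · rw [finrank_euclideanSpace_fin]; exact hd
    · simp only [finrank_euclideanSpace_fin, α]; linarith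
    · filter_upwards with z
      rw [Real.norm_of_nonneg (by positivity)]
    · exact Measurable.aestronglyMeasurable (by fun_prop)
  refine ⟨∫⁻ z in Metric.ball 0 (2 * R), ‖h z‖ₑ, hint.2, fun y hy => ?_⟩
  have hpt : ∀ x ∈ Ω, ‖diffQuot s φ (x, y)‖ₑ ^ 2 ≤
      (Metric.ball (0 : Pt d) (2 * R)).indicator (fun z => ‖h z‖ₑ) (x - y) := by
    intro x hx
    have hx' := hR hx
    have hy' := hR hy
    rw [Metric.mem_ball, dist_zero_right] at hx' hy'
    rw [indicator_of_mem (by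
      rw [Metric.mem_ball, dist_zero_right]; linarith [norm_sub_le x y])]
    rw [← ofReal_eq_diffQuot, Real.enorm_of_nonneg (by positivity)]
    refine ENNReal.ofReal_le_ofReal ?_
    by_cases hxy : x = y
    · subst hxy; simp only [sub_self, ne_eq, OfNat.ofNat_ne_zero, not_false_eq_true, zero_pow,
        zero_div]; positivity
    have hpos : 0 < ‖x - y‖ := norm_pos_iff.2 (sub_ne_zero.2 hxy)
    have h1 : (φ x - φ y) ^ 2 ≤ (K : ℝ) ^ 2 * ‖x - y‖ ^ 2 := by
      have := hK.dist_le_mul x y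
      rw [Real.dist_eq, dist_eq_norm] at this
      rw [← mul_pow, ← sq_abs]
      exact pow_le_pow_left₀ (abs_nonneg _) this 2
    rw [div_le_iff₀ (by positivity), mul_assoc, ← Real.rpow_add hpos]
    have : -α + ((d : ℝ) + 2 * s) = (2 : ℕ) := by simp only [α]; push_cast; ring
    rw [this, Real.rpow_natCast]
    exact h1
  calc ∫⁻ x in Ω, ‖diffQuot s φ (x, y)‖ₑ ^ 2
      ≤ ∫⁻ x in Ω, (Metric.ball (0 : Pt d) (2 * R)).indicator (fun z => ‖h z‖ₑ) (x - y) :=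
        setLIntegral_mono' hΩ hpt
    _ ≤ ∫⁻ x, (Metric.ball (0 : Pt d) (2 * R)).indicator (fun z => ‖h z‖ₑ) (x - y) :=
        setLIntegral_le_lintegral _ _
    _ = ∫⁻ z, (Metric.ball (0 : Pt d) (2 * R)).indicator (fun z => ‖h z‖ₑ) z :=
        lintegral_sub_right_eq_self _ y
    _ = ∫⁻ z in Metric.ball 0 (2 * R), ‖h z‖ₑ := lintegral_indicator Metric.isOpen_ball.measurableSet _

theorem memLp_diffQuot_iff (Ω : Set (Pt d)) (s : ℝ) {u : Pt d → ℝ} (hu : Measurable u) :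
    MemLp (diffQuot s u) 2 ((volume.restrict Ω).prod (volume.restrict Ω)) ↔
      slobodeckij Ω s u < ⊤ := by
  rw [slobodeckij_eq_eLpNorm Ω s hu, MemLp, and_iff_right
    (measurable_diffQuot s hu).aestronglyMeasurable, lt_top_iff_ne_top, lt_top_iff_ne_top, Ne, Ne,
    ENNReal.pow_eq_top_iff]
  simp

theorem slobodeckij_mul_lt_top {Ω : Set (Pt d)} (hΩ : MeasurableSet Ω) (hd : 0 < d)
    (hb : Bornology.IsBounded Ω) {s : ℝ} (hs1 : s < 1) {φ : Pt d → ℝ} (hφ : ContDiff ℝ ∞ φ)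
    (hφc : HasCompactSupport φ) {f : Pt d → ℝ} (hfm : Measurable f) (hf : MemHs Ω s f) :
    slobodeckij Ω s (fun x => φ x * f x) < ⊤ := by
  have hφm : Measurable φ := hφ.continuous.measurable
  set μ := (volume.restrict Ω : Measure (Pt d))
  rw [← memLp_diffQuot_iff Ω s (u := fun x => φ x * f x) (hφm.mul hfm)]
  have h1 : MemLp (fun q : Pt d × Pt d => φ q.1 * diffQuot s f q) 2 (μ.prod μ) := by
    obtain ⟨M, hM⟩ := hφ.continuous.bounded_above_of_compact_support hφc
    have hbd : MemLp (fun q : Pt d × Pt d => φ q.1) ⊤ (μ.prod μ) :=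
      memLp_top_of_bound (hφm.comp measurable_fst).aestronglyMeasurable M
        (Eventually.of_forall fun q => hM q.1)
    exact ((memLp_diffQuot_iff Ω s hfm).2 hf.2).mul hbd
  have h2 : MemLp (fun q : Pt d × Pt d => f q.2 * diffQuot s φ q) 2 (μ.prod μ) := by
    have hdm := measurable_diffQuot s hφm
    refine ⟨Measurable.aestronglyMeasurable (by fun_prop), ?_⟩
    suffices h : eLpNorm (fun q : Pt d × Pt d => f q.2 * diffQuot s φ q) 2 (μ.prod μ) ^ 2 < ⊤ by
      rw [lt_top_iff_ne_top] at h ⊢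
      exact fun hh => h (by rw [hh]; simp)
    obtain ⟨C, hC, hCy⟩ := exists_bound_diffQuot hΩ hd hb hs1 hφ hφc
    rw [eLpNorm_two_sq, lintegral_prod_symm _ (Measurable.aemeasurable (by fun_prop))]
    calc ∫⁻ y in Ω, ∫⁻ x in Ω, ‖f y * diffQuot s φ (x, y)‖ₑ ^ 2
        ≤ ∫⁻ y in Ω, ‖f y‖ₑ ^ 2 * C := by
          refine setLIntegral_mono' hΩ fun y hy => ?_
          simp only [enorm_mul, mul_pow]
          rw [lintegral_const_mul _ (by fun_prop)]
          gcongr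
          exact hCy y hy
      _ = (∫⁻ y in Ω, ‖f y‖ₑ ^ 2) * C := lintegral_mul_const _ (by fun_prop)
      _ < ⊤ := by
          refine ENNReal.mul_lt_top ?_ hC
          rw [← eLpNorm_two_sq]
          exact ENNReal.pow_lt_top hf.1.2
  refine (h1.add h2).ae_eq (Eventually.of_forall fun q => ?_)
  simp only [Pi.add_apply, diffQuot]
  ring

/-- For a function that vanishes far from `x₀`, the seminorm on `Ω` is controlled by the seminorm
near `x₀` and the `L²` norm. -/
theorem slobodeckij_le_local {Ω : Set (Pt d)} (hΩ : MeasurableSet Ω) {s : ℝ} (hs : 0 < s)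
    {x₀ : Pt d} {r : ℝ} (hr : 0 < r) {g : Pt d → ℝ} (hg : Measurable g)
    (h0 : ∀ x, x ∉ Metric.ball x₀ (5 * r / 8) → g x = 0) :
    slobodeckij Ω s g ≤
      (∫⁻ q in (Ω ∩ Metric.ball x₀ (3 * r / 4)) ×ˢ (Ω ∩ Metric.ball x₀ (3 * r / 4)),
        ‖diffQuot s g q‖ₑ ^ 2) +
      2 * (ENNReal.ofReal ((r / 8) ^ ((d : ℝ) + 2 * s))⁻¹ * volume Ω * ∫⁻ x in Ω, ‖g x‖ₑ ^ 2) := by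
  set D := Ω ∩ Metric.ball x₀ (3 * r / 4)
  have hD : MeasurableSet D := hΩ.inter Metric.isOpen_ball.measurableSet
  set q : ℝ := (d : ℝ) + 2 * s with hq
  have hq0 : 0 < q := by positivity
  set c : ℝ≥0∞ := ENNReal.ofReal ((r / 8) ^ q)⁻¹ with hc
  have hdm := measurable_diffQuot s hg
  have hfar : ∀ x y, x ∈ Metric.ball x₀ (5 * r / 8) → y ∉ Metric.ball x₀ (3 * r / 4) →
      ‖diffQuot s g (x, y)‖ₑ ^ 2 ≤ c * ‖g x‖ₑ ^ 2 := by
    intro x y hx hy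
    have hgy : g y = 0 := h0 y fun hh => hy (Metric.ball_subset_ball (by linarith) hh)
    rw [Metric.mem_ball, dist_eq_norm] at hx hy
    have hxy : r / 8 ≤ ‖x - y‖ := by
      have : ‖y - x₀‖ ≤ ‖x - x₀‖ + ‖x - y‖ := by
        calc ‖y - x₀‖ = ‖(x - x₀) - (x - y)‖ := by congr 1; abel
          _ ≤ _ := norm_sub_le _ _
      linarith
    rw [← ofReal_eq_diffQuot, hgy, sub_zero, ← hq, hc, Real.enorm_eq_ofReal_abs,
      ← ENNReal.ofReal_pow (abs_nonneg _), sq_abs, ← ENNReal.ofReal_mul (by positivity)]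
    refine ENNReal.ofReal_le_ofReal ?_
    rw [div_eq_inv_mul]
    have h1 : (r / 8) ^ q ≤ ‖x - y‖ ^ q := Real.rpow_le_rpow (by positivity) hxy hq0.le
    have h2 : 0 < (r / 8) ^ q := by positivity
    gcongr
  have hsymm : ∀ x y, ‖diffQuot s g (x, y)‖ₑ ^ 2 = ‖diffQuot s g (y, x)‖ₑ ^ 2 := by
    intro x y
    rw [← ofReal_eq_diffQuot, ← ofReal_eq_diffQuot, norm_sub_rev, ← neg_sub (g x), neg_sq]
  have hpt : ∀ p ∈ Ω ×ˢ Ω, ‖diffQuot s g p‖ₑ ^ 2 ≤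
      (D ×ˢ D).indicator (fun p => ‖diffQuot s g p‖ₑ ^ 2) p +
        (c * ‖g p.1‖ₑ ^ 2 + c * ‖g p.2‖ₑ ^ 2) := by
    rintro ⟨x, y⟩ ⟨hx, hy⟩
    by_cases hxy : (x, y) ∈ D ×ˢ D
    · rw [indicator_of_mem hxy]; exact le_self_add
    · rw [indicator_of_notMem hxy, zero_add]
      have hor : x ∉ Metric.ball x₀ (3 * r / 4) ∨ y ∉ Metric.ball x₀ (3 * r / 4) := by
        by_contra! hcon
        exact hxy ⟨⟨hx, hcon.1⟩, ⟨hy, hcon.2⟩⟩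
      rcases hor with hx' | hy'
      · by_cases hyb : y ∈ Metric.ball x₀ (5 * r / 8)
        · rw [hsymm]; exact (hfar y x hyb hx').trans le_add_self
        · have h1 := h0 y hyb
          have h2 := h0 x fun hh => hx' (Metric.ball_subset_ball (by linarith) hh)
          simp [diffQuot, h1, h2]
      · by_cases hxb : x ∈ Metric.ball x₀ (5 * r / 8)
        · exact (hfar x y hxb hy').trans le_self_add
        · have h1 := h0 x hxb
          have h2 := h0 y fun hh => hy' (Metric.ball_subset_ball (by linarith) hh)
          simp [diffQuot, h1, h2]
  rw [slobodeckij_eq_eLpNorm Ω s hg, eLpNorm_two_sq, Measure.prod_restrict]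
  calc ∫⁻ p in Ω ×ˢ Ω, ‖diffQuot s g p‖ₑ ^ 2 ∂(volume.prod volume)
      ≤ ∫⁻ p in Ω ×ˢ Ω, ((D ×ˢ D).indicator (fun p => ‖diffQuot s g p‖ₑ ^ 2) p +
        (c * ‖g p.1‖ₑ ^ 2 + c * ‖g p.2‖ₑ ^ 2)) ∂(volume.prod volume) :=
        setLIntegral_mono' (hΩ.prod hΩ) hpt
    _ = (∫⁻ p in Ω ×ˢ Ω, (D ×ˢ D).indicator (fun p => ‖diffQuot s g p‖ₑ ^ 2) p
          ∂(volume.prod volume)) +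
        ((∫⁻ p in Ω ×ˢ Ω, c * ‖g p.1‖ₑ ^ 2 ∂(volume.prod volume)) +
          ∫⁻ p in Ω ×ˢ Ω, c * ‖g p.2‖ₑ ^ 2 ∂(volume.prod volume)) := by
        rw [lintegral_add_right _ (by fun_prop), lintegral_add_right _ (by fun_prop)]
    _ ≤ _ := by
        refine add_le_add ?_ (le_of_eq ?_)
        · refine (setLIntegral_le_lintegral _ _).trans ?_
          rw [lintegral_indicator (hD.prod hD)]
          rfl
        · rw [← Measure.prod_restrict, lintegral_prod _ (by fun_prop),
            lintegral_prod _ (by fun_prop)]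
          simp only [lintegral_const, Measure.restrict_apply_univ]
          rw [lintegral_mul_const _ (by fun_prop), lintegral_const_mul _ (by fun_prop)]
          ring

theorem IsChart.tendsto_slobodeckij {Ω : Set (Pt d)} {x₀ : Pt d} {r : ℝ} {k : ℕ → Pt d → ℝ}
    {δ : ℕ → ℝ} (c : IsChart Ω x₀ r k δ) (hΩ : MeasurableSet Ω) (hd : 0 < d)
    (hb : Bornology.IsBounded Ω) {s : ℝ} (hs0 : 0 < s) (hs1 : s < 1) {φ : Pt d → ℝ}
    (hφ : ContDiff ℝ ∞ φ) (hφc : tsupport φ ⊆ Metric.ball x₀ (r / 2)) {f : Pt d → ℝ}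
    (hfm : Measurable f) (hf : MemHs Ω s f) (hφf : MemL2 Ω (fun x => φ x * f x)) :
    Tendsto (fun n => slobodeckij Ω s
      (fun x => mollify Ω (k n) (fun x => φ x * f x) x - φ x * f x)) atTop (𝓝 0) := by
  have hφcs : HasCompactSupport φ :=
    Metric.isCompact_of_isClosed_isBounded (isClosed_tsupport _)
      (Metric.isBounded_ball.subset hφc)
  have hφm : Measurable φ := hφ.continuous.measurable
  set w : Pt d → ℝ := Ω.indicator (fun x => φ x * f x) with hw
  have hwm : Measurable w := (hφm.mul hfm).indicator hΩ
  have hslw : slobodeckij Ω s w < ⊤ := by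
    rw [slobodeckij_congr s (v := fun x => φ x * f x)
      ((ae_restrict_mem hΩ).mono fun x hx => indicator_of_mem hx _)]
    exact slobodeckij_mul_lt_top hΩ hd hb hs1 hφ hφcs hfm hf
  let g : ℕ → Pt d → ℝ := fun n x => mollify Ω (k n) (fun x => φ x * f x) x - w x
  have hgm : ∀ n, Measurable (g n) := fun n =>
    (contDiff_mollify hΩ (c.kernel n) hφf).continuous.measurable.sub hwm
  have hgeq : ∀ n, slobodeckij Ω s
      (fun x => mollify Ω (k n) (fun x => φ x * f x) x - φ x * f x) = slobodeckij Ω s (g n) := by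
    intro n
    refine slobodeckij_congr s ((ae_restrict_mem hΩ).mono fun x hx => ?_)
    simp only [g, hw, indicator_of_mem hx]
  simp only [hgeq]
  have hw0 : ∀ x, x ∉ Metric.ball x₀ (r / 2) → w x = 0 := by
    intro x hx
    have : φ x = 0 := image_eq_zero_of_notMem_tsupport fun hh => hx (hφc hh)
    simp [hw, this]
  have hgint : ∀ n x, g n x = ∫ z, k n z * (w (x - z) - w x) := fun n x =>
    mollify_sub_self hΩ (c.kernel n) hφf x
  have hg0 : ∀ n x, x ∉ Metric.ball x₀ (5 * r / 8) → g n x = 0 := by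
    intro n x hx
    rw [hgint, hw0 x fun hh => hx (Metric.ball_subset_ball (by linarith [c.pos]) hh)]
    refine (integral_congr_ae (Eventually.of_forall fun z => ?_)).trans (integral_zero _ _)
    by_cases hz : k n z = 0
    · simp [hz]
    · have hzs := c.small n z (subset_tsupport _ hz)
      have : x - z ∉ Metric.ball x₀ (r / 2) := by
        rw [Metric.mem_ball, dist_eq_norm] at hx ⊢
        intro hh
        apply hx
        calc ‖x - x₀‖ = ‖(x - z - x₀) + z‖ := by congr 1; abel
          _ ≤ ‖x - z - x₀‖ + ‖z‖ := norm_add_le _ _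
          _ < 5 * r / 8 := by linarith
      simp [hw0 _ this]
  set D := Ω ∩ Metric.ball x₀ (3 * r / 4)
  let W : Pt d × Pt d → ℝ := (Ω ×ˢ Ω).indicator (diffQuot s w)
  have hWm : Measurable W := (measurable_diffQuot s hwm).indicator (hΩ.prod hΩ)
  have hW : MemLp W 2 ((volume : Measure (Pt d)).prod (volume : Measure (Pt d))) := by
    refine (memLp_indicator_iff_restrict (hΩ.prod hΩ)).2 ?_
    rw [← Measure.prod_restrict]
    exact (memLp_diffQuot_iff Ω s hwm).2 hslw
  have hT := tendsto_average ((volume : Measure (Pt d)).prod (volume : Measure (Pt d)))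
    (ι := fun z : Pt d => (z, z))
    (by fun_prop) rfl hWm hW c.kernel c.tendsto
  have hDq : ∀ n, ∀ p ∈ D ×ˢ D, diffQuot s (g n) p =
      ∫ z, k n z * (W (p - (z, z)) - W p) := by
    rintro n ⟨x, y⟩ ⟨hx, hy⟩
    have hi : ∀ x, Integrable (fun z => k n z * (w (x - z) - w x)) := by
      intro x
      simp only [mul_sub]
      exact (integrable_kernel_mul hΩ (c.kernel n).compact (c.kernel n).continuous hφf x).sub
        ((c.kernel n).integrable.mul_const _)
    simp only [diffQuot, hgint]
    rw [← integral_sub (hi x) (hi y), ← integral_div]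
    refine integral_congr_ae (Eventually.of_forall fun z => ?_)
    by_cases hz : k n z = 0
    · simp [hz]
    · have hzs := subset_tsupport _ hz
      have hxz := c.shift n z hzs x hx.1 hx.2
      have hyz := c.shift n z hzs y hy.1 hy.2
      have h1 : W ((x, y) - (z, z)) = diffQuot s w (x - z, y - z) :=
        indicator_of_mem (show (x - z, y - z) ∈ Ω ×ˢ Ω from ⟨hxz, hyz⟩) _
      have h2 : W (x, y) = diffQuot s w (x, y) :=
        indicator_of_mem (show (x, y) ∈ Ω ×ˢ Ω from ⟨hx.1, hy.1⟩) _
      dsimp only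
      rw [h1, h2]
      simp only [diffQuot, sub_sub_sub_cancel_right]
      ring
  have hD : MeasurableSet D := hΩ.inter Metric.isOpen_ball.measurableSet
  have hT' : Tendsto (fun n => ∫⁻ p in D ×ˢ D, ‖diffQuot s (g n) p‖ₑ ^ 2) atTop (𝓝 0) := by
    refine tendsto_of_tendsto_of_tendsto_of_le_of_le tendsto_const_nhds hT (fun _ => zero_le) ?_
    intro n
    refine le_trans (le_of_eq ?_) (setLIntegral_le_lintegral (D ×ˢ D) _)
    exact setLIntegral_congr_fun (hD.prod hD) fun p hp => by rw [hDq n p hp]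
  have hL2 : Tendsto (fun n => ∫⁻ x in Ω, ‖g n x‖ₑ ^ 2) atTop (𝓝 0) := by
    have h1 := tendstoL2_mollify hΩ c.kernel c.tendsto hφf
    rw [TendstoL2, tendsto_eLpNorm_two_iff] at h1
    refine h1.congr fun n => setLIntegral_congr_fun hΩ fun x hx => ?_
    simp only [g, hw, indicator_of_mem hx, Pi.sub_apply]
  refine tendsto_of_tendsto_of_tendsto_of_le_of_le tendsto_const_nhds ?_ (fun _ => zero_le)
    fun n => slobodeckij_le_local hΩ hs0 c.pos (hgm n) (hg0 n)
  have hfin : ENNReal.ofReal ((r / 8) ^ ((d : ℝ) + 2 * s))⁻¹ * volume Ω ≠ ⊤ :=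
    ENNReal.mul_ne_top ENNReal.ofReal_ne_top hb.measure_lt_top.ne
  have h2 := ENNReal.Tendsto.const_mul (a := 2)
    (ENNReal.Tendsto.const_mul hL2 (Or.inr hfin)) (Or.inr (by norm_num))
  simpa using hT'.add h2


/-! ### Smooth approximation up to the boundary -/

theorem partialD_mollify {Ω : Set (Pt d)} (hΩ : MeasurableSet Ω) {k : Pt d → ℝ} {δ : ℝ}
    (hk : IsKernel k δ) {f : Pt d → ℝ} (hf : MemL2 Ω f) (j : Fin d) (x : Pt d) :
    partialD j (mollify Ω k f) x = ∫ y in Ω, partialD j k (x - y) * f y := by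
  have hk1 : ContDiff ℝ 1 k := hk.contDiff.of_le (by simp)
  have hloc := locallyIntegrable_indicator hΩ hf
  have h1 := hk.compact.hasFDerivAt_convolution_left (ContinuousLinearMap.lsmul ℝ ℝ) hk1 hloc x
  have hex := (hk.compact.fderiv (𝕜 := ℝ)).convolutionExists_left
    ((ContinuousLinearMap.lsmul ℝ ℝ).precompL (Pt d)) (hk1.continuous_fderiv one_ne_zero) hloc x
  have h2 : partialD j (mollify Ω k f) x = ∫ z, partialD j k z * Ω.indicator f (x - z) := by
    rw [partialD, mollify, h1.fderiv, convolution, ContinuousLinearMap.integral_apply hex]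
    refine integral_congr_ae (Eventually.of_forall fun z => ?_)
    simp [partialD, ContinuousLinearMap.precompL_apply]
  rw [h2, ← integral_sub_left_eq_self _ volume x, ← integral_indicator hΩ]
  congr 1; ext y
  rw [sub_sub_cancel]
  by_cases hy : y ∈ Ω <;> simp [hy]

theorem mollify_eq_setIntegral {Ω : Set (Pt d)} (hΩ : MeasurableSet Ω) (k f : Pt d → ℝ)
    (x : Pt d) : mollify Ω k f x = ∫ y in Ω, k (x - y) * f y := by
  rw [mollify_apply, ← integral_sub_left_eq_self _ volume x, ← integral_indicator hΩ]
  congr 1; ext y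
  rw [sub_sub_cancel]
  by_cases hy : y ∈ Ω <;> simp [hy]

theorem continuous_partialD {f : Pt d → ℝ} (hf : ContDiff ℝ 1 f) (j : Fin d) :
    Continuous (partialD j f) :=
  (hf.continuous_fderiv one_ne_zero).clm_apply continuous_const

theorem hasCompactSupport_partialD {f : Pt d → ℝ} (hf : HasCompactSupport f) (j : Fin d) :
    HasCompactSupport (partialD j f) :=
  hf.fderiv_apply (𝕜 := ℝ) _

theorem partialD_eq_zero_of_notMem_tsupport {f : Pt d → ℝ} {x : Pt d} (hx : x ∉ tsupport f)
    (j : Fin d) : partialD j f x = 0 := by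
  have : fderiv ℝ f x = 0 := fderiv_of_notMem_tsupport ℝ hx
  simp [partialD, this]

theorem MemL2.mul_bounded {Ω : Set (Pt d)} {f φ : Pt d → ℝ} (hf : MemL2 Ω f) (hφ : Continuous φ)
    (hφc : HasCompactSupport φ) : MemL2 Ω (fun x => φ x * f x) := by
  obtain ⟨M, hM⟩ := hφ.bounded_above_of_compact_support hφc
  have hbd : MemLp φ ⊤ (volume.restrict Ω) :=
    memLp_top_of_bound hφ.aestronglyMeasurable M (Eventually.of_forall hM)
  exact MemLp.mul hf hbd

theorem MemL2.integrable_mul_compact {Ω : Set (Pt d)} {f c : Pt d → ℝ} (hf : MemL2 Ω f)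
    (hc : Continuous c) (hcs : HasCompactSupport c) :
    Integrable (fun x => c x * f x) (volume.restrict Ω) :=
  MemLp.integrable_mul (p := 2) (q := 2) (hc.memLp_of_hasCompactSupport hcs) hf

theorem IsChart.divV_mollify {Ω : Set (Pt d)} {x₀ : Pt d} {r : ℝ} {k : ℕ → Pt d → ℝ}
    {δ : ℕ → ℝ} (c : IsChart Ω x₀ r k δ) (hΩ : IsOpen Ω) {φ : Pt d → ℝ}
    (hφ : ContDiff ℝ ∞ φ) (hφc : tsupport φ ⊆ Metric.ball x₀ (r / 2)) {F : VectorField d}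
    {D : Pt d → ℝ} (hF : ∀ j, MemL2 Ω (F j)) (hD : IsWeakDiv Ω F D) (n : ℕ) {x : Pt d}
    (hx : x ∈ Ω) :
    divV (fun j => mollify Ω (k n) (fun y => φ y * F j y)) x =
      mollify Ω (k n) (fun y => φ y * D y + ∑ j, partialD j φ y * F j y) x := by
  have hΩm := hΩ.measurableSet
  have hφcs : HasCompactSupport φ :=
    Metric.isCompact_of_isClosed_isBounded (isClosed_tsupport _)
      (Metric.isBounded_ball.subset hφc)
  have hφ1 : ContDiff ℝ 1 φ := hφ.of_le (by simp)
  have hk := c.kernel n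
  have hk1 : ContDiff ℝ 1 (k n) := hk.contDiff.of_le (by simp)
  have hφF : ∀ j, MemL2 Ω (fun y => φ y * F j y) := fun j =>
    (hF j).mul_bounded hφ.continuous hφcs
  simp only [divV, partialD_mollify hΩm hk (hφF _)]
  rw [mollify_eq_setIntegral hΩm]
  by_cases hxb : x ∈ Metric.ball x₀ (3 * r / 4)
  · let ψ : Pt d → ℝ := fun y => φ y * k n (x - y)
    have hkx : ContDiff ℝ ∞ (fun y => k n (x - y)) := hk.contDiff.comp (by fun_prop)
    have hsub : tsupport ψ ⊆ {y | x - y ∈ tsupport (k n)} := by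
      refine closure_minimal (fun y hy => subset_tsupport _ ?_)
        ((isClosed_tsupport _).preimage (by fun_prop))
      exact right_ne_zero_of_mul hy
    have hψ : IsTest Ω ψ := by
      refine ⟨hφ.mul hkx, hφcs.mul_right, fun y hy => ?_⟩
      have := c.shift n (x - y) (hsub hy) x hx hxb
      rwa [sub_sub_cancel] at this
    have hdk : ∀ j y, partialD j (fun y => k n (x - y)) y = - partialD j (k n) (x - y) := by
      intro j y
      have h1 : HasFDerivAt (fun y : Pt d => x - y) (-(ContinuousLinearMap.id ℝ (Pt d))) y := by
        simpa using (hasFDerivAt_id y).const_sub x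
      have h2 := ((hk1.differentiable one_ne_zero) (x - y)).hasFDerivAt.comp y h1
      have h3 : fderiv ℝ (fun y => k n (x - y)) y = _ := h2.fderiv
      simp [partialD, h3]
    have hdψ : ∀ j y, partialD j ψ y =
        partialD j φ y * k n (x - y) - φ y * partialD j (k n) (x - y) := by
      intro j y
      have := partialD_mul (i := j) (f := φ) (g := fun y => k n (x - y)) (x := y)
        ((hφ1.differentiable one_ne_zero) y) ((hkx.differentiable (by simp)) y)
      simp only [ψ, this, hdk]
      ring
    have hw := hD.2 ψ hψ
    have i1 : ∀ j, Integrable (fun y => φ y * partialD j (k n) (x - y) * F j y)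
        (volume.restrict Ω) := fun j =>
      (hF j).integrable_mul_compact (hφ.continuous.mul ((continuous_partialD hk1 j).comp
        (by fun_prop))) hφcs.mul_right
    have i2 : ∀ j, Integrable (fun y => partialD j φ y * k n (x - y) * F j y)
        (volume.restrict Ω) := fun j =>
      (hF j).integrable_mul_compact ((continuous_partialD hφ1 j).mul hkx.continuous)
        (hasCompactSupport_partialD hφcs j).mul_right
    have i3 : Integrable (fun y => ψ y * D y) (volume.restrict Ω) :=
      hD.1.integrable_mul_compact hψ.1.continuous hψ.2.1
    have e1 : ∫ y in Ω, ∑ j, F j y * partialD j ψ y =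
        (∫ y in Ω, ∑ j, partialD j φ y * k n (x - y) * F j y) -
          ∑ j, ∫ y in Ω, φ y * partialD j (k n) (x - y) * F j y := by
      rw [← integral_finsetSum _ fun j _ => i1 j,
        ← integral_sub (integrable_finsetSum _ fun j _ => i2 j)
          (integrable_finsetSum _ fun j _ => i1 j)]
      congr 1; ext y
      rw [← Finset.sum_sub_distrib]
      exact Finset.sum_congr rfl fun j _ => by rw [hdψ]; ring
    have e2 : ∫ y in Ω, k n (x - y) * (φ y * D y + ∑ j, partialD j φ y * F j y) =
        (∫ y in Ω, ψ y * D y) + ∫ y in Ω, ∑ j, partialD j φ y * k n (x - y) * F j y := by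
      rw [← integral_add i3 (integrable_finsetSum _ fun j _ => i2 j)]
      congr 1; ext y
      rw [mul_add, Finset.mul_sum]
      congr 1
      · simp only [ψ]; ring
      · exact Finset.sum_congr rfl fun j _ => by ring
    have e3 : ∀ j, ∫ y in Ω, partialD j (k n) (x - y) * (φ y * F j y) =
        ∫ y in Ω, φ y * partialD j (k n) (x - y) * F j y := fun j => by
      congr 1; ext y; ring
    have e4 : ∫ y in Ω, D y * ψ y = ∫ y in Ω, ψ y * D y := by
      congr 1; ext y; ring
    rw [e2]
    simp only [e3]
    rw [e1, e4] at hw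
    linarith
  · have hout : ∀ y, x - y ∈ tsupport (k n) → y ∉ tsupport φ := by
      intro y hy hyφ
      have h1 := c.small n _ hy
      have h2 := hφc hyφ
      rw [Metric.mem_ball, dist_eq_norm] at h2 hxb
      have : ‖x - x₀‖ ≤ ‖x - y‖ + ‖y - x₀‖ := by
        calc ‖x - x₀‖ = ‖(x - y) + (y - x₀)‖ := by congr 1; abel
          _ ≤ _ := norm_add_le _ _
      linarith [c.pos]
    have z1 : ∀ j y, partialD j (k n) (x - y) * (φ y * F j y) = 0 := by
      intro j y
      by_cases hy : x - y ∈ tsupport (k n)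
      · rw [image_eq_zero_of_notMem_tsupport (hout y hy)]; ring
      · rw [partialD_eq_zero_of_notMem_tsupport hy, zero_mul]
    have z2 : ∀ y, k n (x - y) * (φ y * D y + ∑ j, partialD j φ y * F j y) = 0 := by
      intro y
      by_cases hy : x - y ∈ tsupport (k n)
      · simp [image_eq_zero_of_notMem_tsupport (hout y hy),
          partialD_eq_zero_of_notMem_tsupport (hout y hy)]
      · rw [image_eq_zero_of_notMem_tsupport hy, zero_mul]
    simp [z1, z2]

theorem TendstoL2.congr {Ω : Set (Pt d)} {un vn : ℕ → Pt d → ℝ} {u v : Pt d → ℝ}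
    (h : TendstoL2 Ω un u) (hn : ∀ n, un n =ᵐ[volume.restrict Ω] vn n)
    (hu : u =ᵐ[volume.restrict Ω] v) : TendstoL2 Ω vn v :=
  Tendsto.congr (fun n => eLpNorm_congr_ae ((hn n).sub hu)) h

theorem TendstoL2.sum {Ω : Set (Pt d)} {I : Type*} [Fintype I] {un : I → ℕ → Pt d → ℝ}
    {u : I → Pt d → ℝ} (h : ∀ i, TendstoL2 Ω (un i) (u i))
    (hm : ∀ i n, AEStronglyMeasurable (un i n - u i) (volume.restrict Ω)) :
    TendstoL2 Ω (fun n x => ∑ i, un i n x) (fun x => ∑ i, u i x) := by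
  have h1 : Tendsto (fun n => ∑ i, eLpNorm (un i n - u i) 2 (volume.restrict Ω)) atTop (𝓝 0) := by
    simpa using tendsto_finsetSum Finset.univ fun i _ => h i
  refine tendsto_of_tendsto_of_tendsto_of_le_of_le tendsto_const_nhds h1 (fun _ => zero_le) ?_
  intro n
  have e : (fun x => ∑ i, un i n x) - (fun x => ∑ i, u i x) = ∑ i, (un i n - u i) := by
    ext x; simp
  dsimp only
  rw [e]
  exact eLpNorm_sum_le (fun i _ => hm i n) (by norm_num)

theorem exists_partition {Ω : Set (Pt d)} (hΩ : IsOpen Ω) (hb : Bornology.IsBounded Ω)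
    (hLip : HasLipschitzBoundary Ω) :
    ∃ (I : Finset (Pt d)) (φ : I → Pt d → ℝ) (r : I → ℝ) (k : I → ℕ → Pt d → ℝ)
      (δ : I → ℕ → ℝ), (∀ i : I, IsChart Ω (i : Pt d) (r i) (k i) (δ i)) ∧
        (∀ i, ContDiff ℝ ∞ (φ i)) ∧
        (∀ i : I, tsupport (φ i) ⊆ Metric.ball (i : Pt d) (r i / 2)) ∧
        ∀ x ∈ Ω, ∑ i, φ i x = 1 := by
  have hcomp : IsCompact (closure Ω) := hb.isCompact_closure
  choose! r k δ hc using fun (x : Pt d) (hx : x ∈ closure Ω) => exists_isChart hΩ hLip hx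
  obtain ⟨I, hI, hcov⟩ := hcomp.elim_nhds_subcover (fun x => Metric.ball x (r x / 2))
    fun x hx => Metric.ball_mem_nhds x (half_pos (hc x hx).pos)
  obtain ⟨f, hf⟩ := SmoothPartitionOfUnity.exists_isSubordinate (ι := I) 𝓘(ℝ, Pt d)
    (isClosed_closure (s := Ω)) (fun i => Metric.ball (i : Pt d) (r i / 2))
    (fun i => Metric.isOpen_ball) (hcov.trans (by
      intro x hx
      simp only [mem_iUnion] at hx ⊢
      obtain ⟨y, hy, hxy⟩ := hx
      exact ⟨⟨y, hy⟩, hxy⟩))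
  refine ⟨I, fun i => f i, fun i => r i, fun i => k i, fun i => δ i, fun i => hc _ (hI i i.2),
    fun i => (f i).contMDiff.contDiff, hf, fun x hx => ?_⟩
  have := f.sum_eq_one (subset_closure hx)
  rwa [finsum_eq_sum_of_fintype] at this

/-- On a bounded Lipschitz domain there are linear operators that approximate functions by
functions of class `C^∞` up to the boundary, simultaneously in `L²`, in `H^s` and with respect to
the divergence. -/
theorem exists_smoothing {Ω : Set (Pt d)} (hd : 0 < d) (hΩ : IsOpen Ω)
    (hb : Bornology.IsBounded Ω) (hLip : HasLipschitzBoundary Ω) :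
    ∃ A : ℕ → (Pt d → ℝ) → (Pt d → ℝ),
      (∀ n f, MemL2 Ω f → ContDiff ℝ ∞ (A n f)) ∧
      (∀ n f g, MemL2 Ω f → MemL2 Ω g →
        A n (fun y => f y - g y) = fun x => A n f x - A n g x) ∧
      (∀ f, MemL2 Ω f → TendstoL2 Ω (fun n => A n f) f) ∧
      (∀ s f, 0 < s → s < 1 → MemHs Ω s f → TendstoHs Ω s (fun n => A n f) f) ∧
      ∀ (F : VectorField d) D, (∀ j, MemL2 Ω (F j)) → IsWeakDiv Ω F D →
        TendstoL2 Ω (fun n => divV (fun j => A n (F j))) D := by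
  obtain ⟨I, φ, r, k, δ, hc, hφ, hφs, hsum⟩ := exists_partition hΩ hb hLip
  have hΩm := hΩ.measurableSet
  have hφc : ∀ i, HasCompactSupport (φ i) := fun i =>
    Metric.isCompact_of_isClosed_isBounded (isClosed_tsupport _)
      (Metric.isBounded_ball.subset (hφs i))
  have hmul : ∀ i f, MemL2 Ω f → MemL2 Ω (fun x => φ i x * f x) := fun i f hf =>
    hf.mul_bounded (hφ i).continuous (hφc i)
  have hsm : ∀ i n f, MemL2 Ω f → ContDiff ℝ ∞ (mollify Ω (k i n) (fun x => φ i x * f x)) :=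
    fun i n f hf => contDiff_mollify hΩm ((hc i).kernel n) (hmul i f hf)
  let A : ℕ → (Pt d → ℝ) → (Pt d → ℝ) := fun n f x =>
    ∑ i, mollify Ω (k i n) (fun x => φ i x * f x) x
  have hsumf : ∀ f : Pt d → ℝ, (fun x => ∑ i, φ i x * f x) =ᵐ[volume.restrict Ω] f := fun f =>
    (ae_restrict_mem hΩm).mono fun x hx => by
      dsimp only
      rw [← Finset.sum_mul, hsum x hx, one_mul]
  have hL2 : ∀ f, MemL2 Ω f → TendstoL2 Ω (fun n => A n f) f := by
    intro f hf
    have h1 := TendstoL2.sum (fun i => tendstoL2_mollify hΩm (hc i).kernel (hc i).tendsto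
      (hmul i f hf)) (fun i n => (hsm i n f hf).continuous.aestronglyMeasurable.sub
        (hmul i f hf).1)
    exact h1.congr (fun n => ae_eq_rfl) (hsumf f)
  refine ⟨A, fun n f hf => ?_, fun n f g hf hg => ?_, hL2, fun s f hs0 hs1 hf => ?_,
    fun F D hF hD => ?_⟩
  · exact ContDiff.sum fun i _ => hsm i n f hf
  · ext x
    simp only [A]
    rw [← Finset.sum_sub_distrib]
    refine Finset.sum_congr rfl fun i _ => ?_
    rw [← mollify_sub hΩm ((hc i).kernel n) (hmul i f hf) (hmul i g hg)]
    simp only [mul_sub]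
  · refine ⟨hL2 f hf.1, ?_⟩
    obtain ⟨g, hgm, hfg⟩ := hf.1.1
    have hg : MemHs Ω s g := ⟨(memLp_congr_ae hfg).1 hf.1, by
      rw [← slobodeckij_congr s hfg]; exact hf.2⟩
    let v : I → ℕ → Pt d → ℝ := fun i n x =>
      mollify Ω (k i n) (fun x => φ i x * g x) x - φ i x * g x
    have hvm : ∀ i n, Measurable (v i n) := fun i n =>
      (hsm i n g hg.1).continuous.measurable.sub
        ((hφ i).continuous.measurable.mul hgm.measurable)
    have hv : ∀ i, Tendsto (fun n => eLpNorm (diffQuot s (v i n)) 2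
        ((volume.restrict Ω).prod (volume.restrict Ω))) atTop (𝓝 0) := fun i => by
      rw [← tendsto_slobodeckij_iff Ω s (hvm i)]
      exact (hc i).tendsto_slobodeckij hΩm hd hb hs0 hs1 (hφ i) (hφs i) hgm.measurable hg
        (hmul i g hg.1)
    have heq : ∀ n, slobodeckij Ω s (A n f - f) = slobodeckij Ω s (fun x => ∑ i, v i n x) := by
      intro n
      refine slobodeckij_congr s ?_
      filter_upwards [hsumf g, hfg] with x h1 h2
      have h3 : ∀ i, mollify Ω (k i n) (fun x => φ i x * f x) =
          mollify Ω (k i n) (fun x => φ i x * g x) := fun i =>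
        mollify_congr hΩm _ (hfg.mono fun y hy => by simp only [hy])
      simp only [v, Finset.sum_sub_distrib, h1, Pi.sub_apply, A, h2, h3]
    simp only [heq]
    rw [tendsto_slobodeckij_iff Ω s fun n => Finset.measurable_fun_sum _ fun i _ => hvm i n]
    have h1 : Tendsto (fun n => ∑ i, eLpNorm (diffQuot s (v i n)) 2
        ((volume.restrict Ω).prod (volume.restrict Ω))) atTop (𝓝 0) := by
      simpa using tendsto_finsetSum Finset.univ fun i _ => hv i
    refine tendsto_of_tendsto_of_tendsto_of_le_of_le tendsto_const_nhds h1 (fun _ => zero_le) ?_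
    intro n
    have e : diffQuot s (fun x => ∑ i, v i n x) = ∑ i, diffQuot s (v i n) := by
      ext q
      simp only [diffQuot, Finset.sum_apply, ← Finset.sum_div, Finset.sum_sub_distrib]
    dsimp only
    rw [e]
    exact eLpNorm_sum_le (fun i _ => (measurable_diffQuot s (hvm i n)).aestronglyMeasurable)
      (by norm_num)
  · let H : I → Pt d → ℝ := fun i y => φ i y * D y + ∑ j, partialD j (φ i) y * F j y
    have hφ1 : ∀ i, ContDiff ℝ 1 (φ i) := fun i => (hφ i).of_le (by simp)
    have hH : ∀ i, MemL2 Ω (H i) := fun i =>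
      (hmul i D hD.1).add (memLp_finsetSum _ fun j _ =>
        (hF j).mul_bounded (continuous_partialD (hφ1 i) j) (hasCompactSupport_partialD (hφc i) j))
    have h1 := TendstoL2.sum (fun i => tendstoL2_mollify hΩm (hc i).kernel (hc i).tendsto (hH i))
      (fun i n => (contDiff_mollify hΩm ((hc i).kernel n)
        (hH i)).continuous.aestronglyMeasurable.sub (hH i).1)
    refine h1.congr (fun n => ?_) ?_
    · filter_upwards [ae_restrict_mem hΩm] with x hx
      have h2 : ∀ i, mollify Ω (k i n) (H i) x =
          divV (fun j => mollify Ω (k i n) (fun y => φ i y * F j y)) x := fun i =>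
        ((hc i).divV_mollify hΩ (hφ i) (hφs i) hF hD n hx).symm
      simp only [h2, divV]
      rw [Finset.sum_comm]
      refine Finset.sum_congr rfl fun j _ => ?_
      exact (partialD_sum _ fun i _ => ((hsm i n _ (hF j)).differentiable (by simp)) x).symm
    · filter_upwards [ae_restrict_mem hΩm] with x hx
      have h3 : ∀ j, ∑ i, partialD j (φ i) x = 0 := by
        intro j
        rw [← partialD_sum _ fun i _ => ((hφ1 i).differentiable one_ne_zero) x]
        have : (fun y => ∑ i, φ i y) =ᶠ[𝓝 x] fun _ => (1 : ℝ) := by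
          filter_upwards [hΩ.mem_nhds hx] with y hy using hsum y hy
        rw [partialD, this.fderiv_eq]
        simp
      simp only [H, Finset.sum_add_distrib, ← Finset.sum_mul]
      rw [hsum x hx, Finset.sum_comm]
      simp only [← Finset.sum_mul, h3]
      simp


/-! ### Traces on facets -/

theorem tendsto_integral_mul {X : Type*} [MeasurableSpace X] {μ : Measure X} {fn : ℕ → X → ℝ}
    {f h : X → ℝ} (hfn : ∀ n, MemLp (fn n) 2 μ) (hf : MemLp f 2 μ) (hh : MemLp h 2 μ)
    (hlim : Tendsto (fun n => eLpNorm (fn n - f) 2 μ) atTop (𝓝 0)) :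
    Tendsto (fun n => ∫ x, fn n x * h x ∂μ) atTop (𝓝 (∫ x, f x * h x ∂μ)) := by
  have hi : ∀ n, Integrable (fun x => fn n x * h x) μ := fun n => (hfn n).integrable_mul hh
  have h1 : Tendsto (fun n => eLpNorm (fn n - f) 2 μ * eLpNorm h 2 μ) atTop (𝓝 0) := by
    have := ENNReal.Tendsto.mul_const (b := eLpNorm h 2 μ) hlim (Or.inr hh.2.ne)
    rwa [zero_mul] at this
  refine tendsto_integral_of_L1' (fun x => f x * h x) (hf.1.mul hh.1)
    (Eventually.of_forall hi) ?_
  refine tendsto_of_tendsto_of_tendsto_of_le_of_le tendsto_const_nhds h1 (fun _ => zero_le)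
    fun n => ?_
  have e : ((fun x => fn n x * h x) - fun x => f x * h x) = (fn n - f) • h := by
    ext x
    simp only [Pi.sub_apply, Pi.smul_apply', smul_eq_mul, sub_mul]
  dsimp only
  rw [e]
  exact eLpNorm_smul_le_mul_eLpNorm (p := 2) (q := 2) (r := 1) hh.1 ((hfn n).1.sub hf.1)

theorem HasLipschitzBoundary.interior_closure_subset {Ω : Set (Pt d)} (hΩ : IsOpen Ω)
    (hLip : HasLipschitzBoundary Ω) : interior (closure Ω) ⊆ Ω := by
  intro x hx
  by_contra hxΩ
  have hxf : x ∈ frontier Ω := by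
    rw [frontier, hΩ.interior_eq]
    exact ⟨interior_subset hx, hxΩ⟩
  obtain ⟨e, γ, C, r, he, hγ, hr, hy⟩ := hLip x hxf
  have hee : inner ℝ e e = (1 : ℝ) := by rw [real_inner_self_eq_norm_sq, he]; norm_num
  have hx0 : inner ℝ e x ≤ γ (x - (inner ℝ e x) • e) := by
    have := mt (hy x (Metric.mem_ball_self hr)).2 hxΩ
    exact not_lt.1 this
  obtain ⟨ρ, hρ, hball⟩ := Metric.isOpen_iff.1 isOpen_interior x hx
  set s := min ρ r / 2 with hs
  have hs0 : 0 < s := by positivity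
  have hsρ : s < ρ := by
    have := min_le_left ρ r
    have h2 : 0 < min ρ r := lt_min hρ hr
    linarith
  have hsr : s < r := by
    have := min_le_right ρ r
    have h2 : 0 < min ρ r := lt_min hρ hr
    linarith
  set y := x - s • e with hydef
  have hyx : dist y x = s := by
    rw [hydef, dist_eq_norm]
    simp [norm_smul, he, abs_of_pos hs0]
  have hyc : y ∈ closure Ω := interior_subset (hball (by rw [Metric.mem_ball, hyx]; exact hsρ))
  have hyr : y ∈ Metric.ball x r := by rw [Metric.mem_ball, hyx]; exact hsr
  have hcont : Continuous fun z : Pt d => γ (z - (inner ℝ e z) • e) - inner ℝ e z := by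
    have := hγ.continuous
    fun_prop
  have hpos : 0 < γ (y - (inner ℝ e y) • e) - inner ℝ e y := by
    have h1 : inner ℝ e y = inner ℝ e x - s := by
      rw [hydef, inner_sub_right, inner_smul_right, hee, mul_one]
    have h2 : y - (inner ℝ e y) • e = x - (inner ℝ e x) • e := by
      rw [h1, hydef]; module
    rw [h2, h1]; linarith
  obtain ⟨z, ⟨hz1, hz2⟩, hzΩ⟩ := mem_closure_iff.1 hyc
    ({z | 0 < γ (z - (inner ℝ e z) • e) - inner ℝ e z} ∩ Metric.ball x r)
    ((isOpen_lt continuous_const hcont).inter Metric.isOpen_ball) ⟨hpos, hyr⟩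
  have := (hy z hz2).1 hzΩ
  have hz1' : 0 < γ (z - (inner ℝ e z) • e) - inner ℝ e z := hz1
  linarith

theorem volume_frontier_simplex (t : Finset (Pt d)) : volume (frontier (simplex t)) = 0 :=
  (convex_simplex t).addHaar_frontier volume

theorem interior_simplex_subset {Ω : Set (Pt d)} (hΩ : IsOpen Ω) (hLip : HasLipschitzBoundary Ω)
    {t : Finset (Pt d)} (ht : simplex t ⊆ closure Ω) : interior (simplex t) ⊆ Ω :=
  (interior_mono ht).trans (hLip.interior_closure_subset hΩ)

theorem interior_simplex_ae_eq (t : Finset (Pt d)) :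
    (interior (simplex t) : Set (Pt d)) =ᵐ[volume] simplex t :=
  interior_ae_eq_of_null_frontier (volume_frontier_simplex t)

theorem restrict_simplex_le {Ω : Set (Pt d)} (hΩ : IsOpen Ω) (hLip : HasLipschitzBoundary Ω)
    {t : Finset (Pt d)} (ht : simplex t ⊆ closure Ω) :
    volume.restrict (simplex t) ≤ volume.restrict Ω := by
  rw [← Measure.restrict_congr_set (interior_simplex_ae_eq t)]
  exact Measure.restrict_mono (interior_simplex_subset hΩ hLip ht) le_rfl

theorem MemL2.simplex {Ω : Set (Pt d)} (hΩ : IsOpen Ω) (hLip : HasLipschitzBoundary Ω)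
    {t : Finset (Pt d)} (ht : simplex t ⊆ closure Ω) {u : ScalarField d} (hu : MemL2 Ω u) :
    MemLp u 2 (volume.restrict (simplex t)) :=
  hu.mono_measure (restrict_simplex_le hΩ hLip ht)

theorem TendstoL2.simplex {Ω : Set (Pt d)} (hΩ : IsOpen Ω) (hLip : HasLipschitzBoundary Ω)
    {t : Finset (Pt d)} (ht : simplex t ⊆ closure Ω) {un : ℕ → ScalarField d} {u : ScalarField d}
    (hu : TendstoL2 Ω un u) : TendstoL2 (simplex t) un u :=
  tendsto_of_tendsto_of_tendsto_of_le_of_le tendsto_const_nhds hu (fun _ => zero_le)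
    fun _ => eLpNorm_mono_measure _ (restrict_simplex_le hΩ hLip ht)

theorem MemL2.locallyIntegrableOn {Ω : Set (Pt d)} (hΩ : IsOpen Ω) {u : ScalarField d}
    (hu : MemL2 Ω u) : LocallyIntegrableOn u Ω := by
  intro x hx
  obtain ⟨r, hr, hb⟩ := Metric.isOpen_iff.1 hΩ x hx
  refine ⟨Metric.ball x r, mem_nhdsWithin_of_mem_nhds (Metric.ball_mem_nhds x hr), ?_⟩
  have : IsFiniteMeasure (volume.restrict (Metric.ball x r)) :=
    ⟨by simpa using measure_ball_lt_top⟩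
  exact (hu.mono_measure (Measure.restrict_mono hb le_rfl)).integrable (by norm_num)

theorem ae_eq_of_forall_isTest {Ω : Set (Pt d)} (hΩ : IsOpen Ω) {f g : ScalarField d}
    (hf : MemL2 Ω f) (hg : MemL2 Ω g)
    (h : ∀ φ, IsTest Ω φ → ∫ x in Ω, f x * φ x = ∫ x in Ω, g x * φ x) :
    f =ᵐ[volume.restrict Ω] g := by
  have h1 := hΩ.ae_eq_zero_of_integral_contDiff_smul_eq_zero (μ := volume) (f := f - g)
    (MemL2.locallyIntegrableOn hΩ (hf.sub hg)) (fun φ hφ hc hs => by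
      have e : (fun x => φ x • (f - g) x) = Ω.indicator fun x => φ x • (f - g) x := by
        ext x
        by_cases hx : x ∈ Ω
        · simp [hx]
        · have : φ x = 0 := image_eq_zero_of_notMem_tsupport fun h => hx (hs h)
          simp [hx, this]
      rw [e, integral_indicator hΩ.measurableSet]
      have h2 := h φ ⟨hφ, hc, hs⟩
      have i1 := hf.integrable_mul_compact hφ.continuous hc
      have i2 := hg.integrable_mul_compact hφ.continuous hc
      simp only [mul_comm _ (φ _)] at h2
      simp only [Pi.sub_apply, smul_eq_mul, mul_sub]
      rw [integral_sub i1 i2, h2, sub_self])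
  rw [EventuallyEq, ae_restrict_iff' hΩ.measurableSet]
  filter_upwards [h1] with x hx hxΩ
  exact sub_eq_zero.1 (hx hxΩ)

theorem IsWeakDeriv.ae_eq {Ω : Set (Pt d)} (hΩ : IsOpen Ω) {i : Fin d} {u g g' : ScalarField d}
    (h : IsWeakDeriv Ω i u g) (h' : IsWeakDeriv Ω i u g') : g =ᵐ[volume.restrict Ω] g' :=
  ae_eq_of_forall_isTest hΩ h.1 h'.1 fun φ hφ => by
    rw [← neg_inj, ← h.2 φ hφ, ← h'.2 φ hφ]

theorem IsWeakDiv.ae_eq {Ω : Set (Pt d)} (hΩ : IsOpen Ω) {F : VectorField d} {D D' : ScalarField d}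
    (h : IsWeakDiv Ω F D) (h' : IsWeakDiv Ω F D') : D =ᵐ[volume.restrict Ω] D' :=
  ae_eq_of_forall_isTest hΩ h.1 h'.1 fun φ hφ => by
    rw [← neg_inj, ← h.2 φ hφ, ← h'.2 φ hφ]

/-- The trace inequality on a facet. -/
theorem IsElem.integral_facet_sq_le {t : Finset (Pt d)} (h : IsElem t) (hd : 0 < d) {a : Pt d}
    (ha : a ∈ t) : ∃ C : ℝ, 0 ≤ C ∧ ∀ v : Pt d → ℝ, ContDiff ℝ 1 v →
      ∫ x in StokesHDG.simplex (opp t a), v x ^ 2 ∂(surf d) ≤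
        C * ((∫ x in StokesHDG.simplex t, v x ^ 2) +
          ∑ i, ∫ x in StokesHDG.simplex t, partialD i v x ^ 2) := by
  obtain ⟨H, hH, hh⟩ := h.exists_height hd ha
  obtain ⟨M, hM⟩ := (isCompact_simplex t).isBounded.exists_norm_le
  set K : ℝ := M + ‖a‖ with hK
  have hM0 : 0 ≤ M := (norm_nonneg _).trans (hM a (subset_convexHull ℝ _ ha))
  have hK0 : 0 ≤ K := by positivity
  refine ⟨H⁻¹ * (d + d * K + K), by positivity, fun v hv => ?_⟩
  have hvd : Differentiable ℝ v := hv.differentiable one_ne_zero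
  have hvc := hv.continuous
  have hci : ∀ i : Fin d, ContDiff ℝ 1 fun x : Pt d => x i := fun i =>
    (EuclideanSpace.proj i : Pt d →L[ℝ] ℝ).contDiff
  let f : Fin d → Pt d → ℝ := fun i x => v x * v x * (x i - a i)
  have hf : ∀ i, ContDiff ℝ 1 (f i) := fun i => (hv.mul hv).mul ((hci i).sub contDiff_const)
  have hint : ∀ g : Pt d → ℝ, Continuous g → IntegrableOn g (StokesHDG.simplex t) := fun g hg =>
    hg.continuousOn.integrableOn_compact (isCompact_simplex t)
  have hcp : ∀ i, Continuous (partialD i v) := fun i => continuous_partialD hv i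
  have hpd : ∀ i x, partialD i (f i) x = 2 * (v x * partialD i v x) * (x i - a i) + v x ^ 2 := by
    intro i x
    have e1 := partialD_mul (i := i) (f := fun y => v y * v y) (g := fun y => y i - a i)
      ((hvd.mul hvd) x) ((((hci i).sub contDiff_const).differentiable one_ne_zero) x)
    have e2 := partialD_mul (i := i) (hvd x) (hvd x)
    have e3 : partialD i (fun y : Pt d => y i - a i) x = 1 := by
      rw [partialD_sub (((hci i).differentiable one_ne_zero) x) (differentiableAt_const _),
        partialD_coord, partialD_const]
      simp
    simp only [f]
    rw [e1, e2, e3]; ring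
  have hsum : ∑ i, elemInt t (partialD i (f i)) =
      H * ∫ x in StokesHDG.simplex (opp t a), v x ^ 2 ∂(surf d) := by
    have hfin := fun b (hb : b ∈ t) => h.isFiniteMeasure_facet hd hb
    have hint2 : ∀ b ∈ t, ∀ i, Integrable (f i) ((surf d).restrict (StokesHDG.simplex (opp t b))) :=
      fun b hb i => by
        have := hfin b hb
        exact (h.memLp_facet hd hb (hf i).continuous).integrable (by norm_num)
    have e : ∀ b ∈ t, ∑ i, outwardNormal t b i * facetInt (opp t b) (f i) =
        facetInt (opp t b) fun x => v x ^ 2 * ∑ i, (x i - a i) * outwardNormal t b i := by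
      intro b hb
      simp only [facetInt, ← integral_const_mul]
      rw [← integral_finsetSum _ fun i _ => (hint2 b hb i).const_mul _]
      congr 1; ext x
      rw [Finset.mul_sum]
      refine Finset.sum_congr rfl fun i _ => ?_
      simp only [f]; ring
    calc ∑ i, elemInt t (partialD i (f i))
        = ∑ i, ∑ b ∈ t, outwardNormal t b i * facetInt (opp t b) (f i) :=
          Finset.sum_congr rfl fun i _ => h.integral_partialD hd i (hf i)
      _ = ∑ b ∈ t, ∑ i, outwardNormal t b i * facetInt (opp t b) (f i) := Finset.sum_comm
      _ = ∑ b ∈ t, facetInt (opp t b) fun x =>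
            v x ^ 2 * ∑ i, (x i - a i) * outwardNormal t b i := Finset.sum_congr rfl e
      _ = facetInt (opp t a) fun x => v x ^ 2 * ∑ i, (x i - a i) * outwardNormal t a i := by
          refine Finset.sum_eq_single_of_mem a ha fun b hb hba => ?_
          obtain ⟨H', -, hh'⟩ := h.exists_height hd hb
          rw [facetInt, setIntegral_congr_fun (g := fun _ => 0) (measurableSet_simplex _)]
          · simp
          · intro x hx
            have := ((hh' x ((h.mem_facet_iff hb).1 hx).1).2 a ha hba.symm)
            simp [this]
      _ = H * ∫ x in StokesHDG.simplex (opp t a), v x ^ 2 ∂(surf d) := by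
          rw [← integral_const_mul, facetInt]
          refine setIntegral_congr_fun (measurableSet_simplex _) fun x hx => ?_
          dsimp only
          rw [(hh x ((h.mem_facet_iff ha).1 hx).1).1]; ring
  have hbound : ∀ i, elemInt t (partialD i (f i)) ≤
      (K + 1) * (∫ x in StokesHDG.simplex t, v x ^ 2) +
        K * ∫ x in StokesHDG.simplex t, partialD i v x ^ 2 := by
    intro i
    have c1 : Continuous fun x => (K + 1) * v x ^ 2 := continuous_const.mul (hvc.pow 2)
    have c2 : Continuous fun x => K * partialD i v x ^ 2 := continuous_const.mul ((hcp i).pow 2)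
    rw [← integral_const_mul, ← integral_const_mul, ← integral_add (hint _ c1) (hint _ c2)]
    refine setIntegral_mono_on (hint _ (continuous_partialD (hf i) i))
      (hint _ (c1.add c2)) (measurableSet_simplex _) fun x hx => ?_
    rw [hpd]
    have hxi : |x i - a i| ≤ K := by
      have e1 := PiLp.norm_apply_le x i
      have e2 := PiLp.norm_apply_le a i
      have e3 := hM x hx
      rw [Real.norm_eq_abs] at e1 e2
      exact (abs_sub _ _).trans (by linarith)
    have h2 : |2 * (v x * partialD i v x)| ≤ v x ^ 2 + partialD i v x ^ 2 := by
      rw [abs_le]; constructor <;> nlinarith [sq_nonneg (v x + partialD i v x),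
        sq_nonneg (v x - partialD i v x)]
    have h3 : 2 * (v x * partialD i v x) * (x i - a i) ≤ (v x ^ 2 + partialD i v x ^ 2) * K := by
      refine (le_abs_self _).trans ?_
      rw [abs_mul]
      exact mul_le_mul h2 hxi (abs_nonneg _) (by positivity)
    nlinarith
  have hsb : ∑ i, elemInt t (partialD i (f i)) ≤ d * ((K + 1) * ∫ x in StokesHDG.simplex t, v x ^ 2)
      + K * ∑ i, ∫ x in StokesHDG.simplex t, partialD i v x ^ 2 := by
    refine (Finset.sum_le_sum fun i _ => hbound i).trans (le_of_eq ?_)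
    rw [Finset.sum_add_distrib, Finset.sum_const, Finset.mul_sum]
    simp
  rw [hsum] at hsb
  have hA : 0 ≤ ∫ x in StokesHDG.simplex t, v x ^ 2 := integral_nonneg fun x => by positivity
  have hB : 0 ≤ ∑ i, ∫ x in StokesHDG.simplex t, partialD i v x ^ 2 :=
    Finset.sum_nonneg fun i _ => integral_nonneg fun x => by positivity
  rw [mul_assoc, ← div_eq_inv_mul, le_div_iff₀ hH]
  nlinarith [mul_nonneg hK0 hA, mul_nonneg (Nat.cast_nonneg (α := ℝ) d) hB,
    mul_nonneg (mul_nonneg (Nat.cast_nonneg (α := ℝ) d) hK0) hB]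


theorem eLpNorm_two_sq_eq_ofReal {X : Type*} [MeasurableSpace X] {μ : Measure X} {f : X → ℝ}
    (hf : MemLp f 2 μ) : eLpNorm f 2 μ ^ 2 = ENNReal.ofReal (∫ x, f x ^ 2 ∂μ) := by
  rw [eLpNorm_two_sq, ofReal_integral_eq_lintegral_ofReal hf.integrable_sq
    (Eventually.of_forall fun x => sq_nonneg _)]
  refine lintegral_congr fun x => ?_
  rw [Real.enorm_eq_ofReal_abs, ← ENNReal.ofReal_pow (abs_nonneg _), sq_abs]

theorem tendsto_eLpNorm_sq_iff {α X : Type*} [MeasurableSpace X] {μ : Measure X} {l : Filter α}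
    {f : α → X → ℝ} : Tendsto (fun n => eLpNorm (f n) 2 μ) l (𝓝 0) ↔
      Tendsto (fun n => eLpNorm (f n) 2 μ ^ 2) l (𝓝 0) := by
  rw [tendsto_eLpNorm_two_iff]
  simp only [eLpNorm_two_sq]

theorem IsElem.tendsto_facet {t : Finset (Pt d)} (h : IsElem t) (hd : 0 < d) {a : Pt d}
    (ha : a ∈ t) {α : Type*} {l : Filter α} {v : α → Pt d → ℝ} (hv : ∀ n, ContDiff ℝ 1 (v n))
    (h0 : Tendsto (fun n => eLpNorm (v n) 2 (volume.restrict (simplex t))) l (𝓝 0))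
    (h1 : ∀ i, Tendsto (fun n => eLpNorm (partialD i (v n)) 2 (volume.restrict (simplex t)))
      l (𝓝 0)) :
    Tendsto (fun n => eLpNorm (v n) 2 ((surf d).restrict (simplex (opp t a)))) l (𝓝 0) := by
  obtain ⟨C, hC, hle⟩ := h.integral_facet_sq_le hd ha
  rw [tendsto_eLpNorm_sq_iff] at h0 ⊢
  have h1' := fun i => tendsto_eLpNorm_sq_iff.1 (h1 i)
  have hlim : Tendsto (fun n => ENNReal.ofReal C *
      (eLpNorm (v n) 2 (volume.restrict (simplex t)) ^ 2 +
        ∑ i, eLpNorm (partialD i (v n)) 2 (volume.restrict (simplex t)) ^ 2)) l (𝓝 0) := by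
    have e := ENNReal.Tendsto.const_mul (a := ENNReal.ofReal C)
      (h0.add (tendsto_finsetSum Finset.univ fun i _ => h1' i)) (Or.inr ENNReal.ofReal_ne_top)
    simpa using e
  refine tendsto_of_tendsto_of_tendsto_of_le_of_le tendsto_const_nhds hlim (fun _ => zero_le)
    fun n => ?_
  dsimp only
  rw [eLpNorm_two_sq_eq_ofReal (h.memLp_facet hd ha (hv n).continuous),
    eLpNorm_two_sq_eq_ofReal (memLp_simplex t (hv n).continuous)]
  simp only [fun i => eLpNorm_two_sq_eq_ofReal (memLp_simplex t (continuous_partialD (hv n) i))]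
  have hB : ∀ i, 0 ≤ ∫ x in simplex t, partialD i (v n) x ^ 2 :=
    fun i => integral_nonneg fun x => sq_nonneg _
  rw [← ENNReal.ofReal_sum_of_nonneg fun i _ => hB i,
    ← ENNReal.ofReal_add (integral_nonneg fun x => sq_nonneg _) (Finset.sum_nonneg fun i _ => hB i),
    ← ENNReal.ofReal_mul hC]
  exact ENNReal.ofReal_le_ofReal (hle _ (hv n))

theorem tendsto_eLpNorm_sub_sub {α X : Type*} [MeasurableSpace X] {μ : Measure X} {l : Filter α}
    {f g : α → X → ℝ} {u : X → ℝ} (hf : ∀ n, AEStronglyMeasurable (f n) μ)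
    (hg : ∀ n, AEStronglyMeasurable (g n) μ) (hu : AEStronglyMeasurable u μ)
    (h1 : Tendsto (fun n => eLpNorm (f n - u) 2 μ) l (𝓝 0))
    (h2 : Tendsto (fun n => eLpNorm (g n - u) 2 μ) l (𝓝 0)) :
    Tendsto (fun n => eLpNorm (f n - g n) 2 μ) l (𝓝 0) := by
  have h3 := h1.add h2
  rw [add_zero] at h3
  refine tendsto_of_tendsto_of_tendsto_of_le_of_le tendsto_const_nhds h3 (fun _ => zero_le)
    fun n => ?_
  dsimp only
  have e : f n - g n = (f n - u) - (g n - u) := by abel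
  rw [e]
  exact eLpNorm_sub_le ((hf n).sub hu) ((hg n).sub hu) (by norm_num)

/-- Functions of class `C^∞` up to the boundary are dense in `H¹`. -/
theorem exists_H1_approx {Ω : Set (Pt d)} (hd : 0 < d) (hΩ : IsOpen Ω)
    (hb : Bornology.IsBounded Ω) (hLip : HasLipschitzBoundary Ω) {u : ScalarField d}
    (hu : MemL2 Ω u) {gr : VectorField d} (hgr : ∀ i, IsWeakDeriv Ω i u (gr i)) :
    ∃ un : ℕ → ScalarField d, (∀ n, ContDiff ℝ ∞ (un n)) ∧ TendstoL2 Ω un u ∧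
      ∀ i, TendstoL2 Ω (fun n => partialD i (un n)) (gr i) := by
  obtain ⟨A, hA, hsub, hL2, -, hdiv⟩ := exists_smoothing hd hΩ hb hLip
  refine ⟨fun n => A n u, fun n => hA n u hu, hL2 u hu, fun i => ?_⟩
  have hzero : ∀ n, A n (fun _ => 0) = fun _ => 0 := by
    intro n
    have := hsub n u u hu hu
    simpa using this
  have h0 : MemL2 Ω (fun _ => 0) := MemLp.zero'
  have h1 := hdiv (fun j => if j = i then u else fun _ => 0) (gr i) (fun j => by
    split_ifs; exacts [hu, h0]) ⟨(hgr i).1, fun φ hφ => by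
      rw [← (hgr i).2 φ hφ]
      congr 1; ext x
      rw [Finset.sum_eq_single i]
      · simp
      · intro j _ hj; simp [hj]
      · simp⟩
  refine h1.congr (fun n => ?_) ae_eq_rfl
  refine Eventually.of_forall fun x => ?_
  simp only [divV]
  rw [Finset.sum_eq_single i]
  · simp
  · intro j _ hj
    simp only [hj, if_false, hzero]
    exact partialD_const 0 x
  · simp

theorem partialD_sub_eq {i : Fin d} {f g : ScalarField d} (hf : ContDiff ℝ 1 f)
    (hg : ContDiff ℝ 1 g) : partialD i (f - g) = partialD i f - partialD i g := by
  ext x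
  exact partialD_sub ((hf.differentiable one_ne_zero) x) ((hg.differentiable one_ne_zero) x)

theorem integrableOn_simplex (t : Finset (Pt d)) {f : ScalarField d} (hf : Continuous f) :
    IntegrableOn f (simplex t) :=
  hf.continuousOn.integrableOn_compact (isCompact_simplex t)

/-- Integration by parts on an element for functions of class `C¹`. -/
theorem IsElem.integral_partialD_mul {t : Finset (Pt d)} (h : IsElem t) (hd : 0 < d) (j : Fin d)
    {f g : ScalarField d} (hf : ContDiff ℝ 1 f) (hg : ContDiff ℝ 1 g) :
    elemInt t (fun x => partialD j f x * g x) + elemInt t (fun x => f x * partialD j g x) =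
      ∑ a ∈ t, outwardNormal t a j * facetInt (opp t a) (fun x => f x * g x) := by
  have i1 : IntegrableOn (fun x => partialD j f x * g x) (StokesHDG.simplex t) :=
    integrableOn_simplex t ((continuous_partialD hf j).mul hg.continuous)
  have i2 : IntegrableOn (fun x => f x * partialD j g x) (StokesHDG.simplex t) :=
    integrableOn_simplex t (hf.continuous.mul (continuous_partialD hg j))
  rw [← h.integral_partialD hd j (hf.mul hg), elemInt, elemInt, elemInt, ← integral_add i1 i2]
  congr 1; ext x
  exact (partialD_mul ((hf.differentiable one_ne_zero) x)
    ((hg.differentiable one_ne_zero) x)).symm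

section Trace

variable {Ω : Set (Pt d)} {t : Finset (Pt d)} {a : Pt d} {u : ScalarField d}

theorem IsElem.exists_trace (h : IsElem t) (hd : 0 < d) (hΩ : IsOpen Ω)
    (hb : Bornology.IsBounded Ω) (hLip : HasLipschitzBoundary Ω)
    (ht : StokesHDG.simplex t ⊆ closure Ω) (ha : a ∈ t) (hu : MemH1 Ω u) :
    ∃ w, IsTraceOn Ω u (StokesHDG.simplex (opp t a)) w := by
  choose gr hgr using hu.2
  obtain ⟨un, hun, hlim, hlimd⟩ := exists_H1_approx hd hΩ hb hLip hu.1 hgr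
  have hun1 : ∀ n, ContDiff ℝ 1 (un n) := fun n => (hun n).of_le (by simp)
  have hT := hlim.simplex hΩ hLip ht
  have hTd := fun i => (hlimd i).simplex hΩ hLip ht
  set μ := (surf d).restrict (StokesHDG.simplex (opp t a)) with hμ
  have hmem : ∀ n, MemLp (un n) 2 μ := fun n => h.memLp_facet hd ha (hun n).continuous
  have f1 : Tendsto (Prod.fst : ℕ × ℕ → ℕ) atTop atTop := by
    rw [← prod_atTop_atTop_eq]; exact tendsto_fst
  have f2 : Tendsto (Prod.snd : ℕ × ℕ → ℕ) atTop atTop := by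
    rw [← prod_atTop_atTop_eq]; exact tendsto_snd
  have hc : CauchySeq fun n => (hmem n).toLp := by
    rw [Lp.cauchySeq_Lp_iff_cauchySeq_eLpNorm]
    have h1 : Tendsto (fun n : ℕ × ℕ => eLpNorm (un n.1 - un n.2) 2 μ) atTop (𝓝 0) := by
      refine h.tendsto_facet hd ha (fun n => (hun1 n.1).sub (hun1 n.2)) ?_ fun i => ?_
      · exact tendsto_eLpNorm_sub_sub (fun n => (hun n.1).continuous.aestronglyMeasurable)
          (fun n => (hun n.2).continuous.aestronglyMeasurable)
          (hu.1.simplex hΩ hLip ht).1 (hT.comp f1) (hT.comp f2)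
      · simp only [partialD_sub_eq (hun1 _) (hun1 _)]
        exact tendsto_eLpNorm_sub_sub
          (fun n => (continuous_partialD (hun1 n.1) i).aestronglyMeasurable)
          (fun n => (continuous_partialD (hun1 n.2) i).aestronglyMeasurable)
          ((hgr i).1.simplex hΩ hLip ht).1 ((hTd i).comp f1) ((hTd i).comp f2)
    refine h1.congr fun n => eLpNorm_congr_ae ?_
    exact ((hmem n.1).coeFn_toLp.sub (hmem n.2).coeFn_toLp).symm
  obtain ⟨w, hw⟩ := cauchySeq_tendsto_of_complete hc
  refine ⟨w, Lp.memLp w, gr, un, hgr, hun, hlim, hlimd, ?_⟩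
  rw [Lp.tendsto_Lp_iff_tendsto_eLpNorm'] at hw
  refine hw.congr fun n => eLpNorm_congr_ae ?_
  exact (hmem n).coeFn_toLp.sub ae_eq_rfl

theorem IsElem.isTraceOn_facetTrace (h : IsElem t) (hd : 0 < d) (hΩ : IsOpen Ω)
    (hb : Bornology.IsBounded Ω) (hLip : HasLipschitzBoundary Ω)
    (ht : StokesHDG.simplex t ⊆ closure Ω) (ha : a ∈ t) {u : VectorField d} {i : Fin d}
    (hu : MemH1 Ω (u i)) :
    IsTraceOn Ω (u i) (StokesHDG.simplex (opp t a)) (facetTrace Ω u (opp t a) i) :=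
  Classical.epsilon_spec (h.exists_trace hd hΩ hb hLip ht ha hu)

theorem IsElem.tendsto_trace (h : IsElem t) (hd : 0 < d) (hΩ : IsOpen Ω)
    (hLip : HasLipschitzBoundary Ω)
    (ht : StokesHDG.simplex t ⊆ closure Ω) (ha : a ∈ t) (hu : MemL2 Ω u) {w : ScalarField d}
    (hw : IsTraceOn Ω u (StokesHDG.simplex (opp t a)) w) {gr : VectorField d}
    (hgr : ∀ i, IsWeakDeriv Ω i u (gr i)) {un : ℕ → ScalarField d}
    (hun : ∀ n, ContDiff ℝ ∞ (un n)) (hlim : TendstoL2 Ω un u)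
    (hlimd : ∀ i, TendstoL2 Ω (fun n => partialD i (un n)) (gr i)) :
    Tendsto (fun n => eLpNorm (un n - w) 2 ((surf d).restrict (StokesHDG.simplex (opp t a))))
      atTop (𝓝 0) := by
  obtain ⟨hwm, gr', wn, hgr', hwn, hwlim, hwlimd, hww⟩ := hw
  have hun1 : ∀ n, ContDiff ℝ 1 (un n) := fun n => (hun n).of_le (by simp)
  have hwn1 : ∀ n, ContDiff ℝ 1 (wn n) := fun n => (hwn n).of_le (by simp)
  have h1 : Tendsto (fun n => eLpNorm (un n - wn n) 2
      ((surf d).restrict (StokesHDG.simplex (opp t a)))) atTop (𝓝 0) := by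
    refine h.tendsto_facet hd ha (fun n => (hun1 n).sub (hwn1 n)) ?_ fun i => ?_
    · exact tendsto_eLpNorm_sub_sub (fun n => (hun n).continuous.aestronglyMeasurable)
          (fun n => (hwn n).continuous.aestronglyMeasurable)
          (hu.simplex hΩ hLip ht).1 (hlim.simplex hΩ hLip ht) (hwlim.simplex hΩ hLip ht)
    · simp only [partialD_sub_eq (hun1 _) (hwn1 _)]
      exact tendsto_eLpNorm_sub_sub
          (fun n => (continuous_partialD (hun1 n) i).aestronglyMeasurable)
          (fun n => (continuous_partialD (hwn1 n) i).aestronglyMeasurable)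
          ((hgr i).1.simplex hΩ hLip ht).1 ((hlimd i).simplex hΩ hLip ht)
          (((hwlimd i).congr (fun n => ae_eq_rfl)
            ((hgr' i).ae_eq hΩ (hgr i))).simplex hΩ hLip ht)
  have h2 := h1.add hww
  rw [add_zero] at h2
  refine tendsto_of_tendsto_of_tendsto_of_le_of_le tendsto_const_nhds h2 (fun _ => zero_le)
    fun n => ?_
  have e : un n - w = (un n - wn n) + (wn n - w) := by abel
  dsimp only
  rw [e]
  exact eLpNorm_add_le ((hun n).sub (hwn n)).continuous.aestronglyMeasurable
    ((hwn n).continuous.aestronglyMeasurable.sub hwm.1) (by norm_num)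

/-- Integration by parts on an element for functions in `H¹`. -/
theorem IsElem.integral_mul_partialD (h : IsElem t) (hd : 0 < d) (hΩ : IsOpen Ω)
    (hb : Bornology.IsBounded Ω) (hLip : HasLipschitzBoundary Ω)
    (ht : StokesHDG.simplex t ⊆ closure Ω) (hu : MemL2 Ω u) {gr : VectorField d}
    (hgr : ∀ i, IsWeakDeriv Ω i u (gr i)) {w : Pt d → ScalarField d}
    (hw : ∀ a ∈ t, IsTraceOn Ω u (StokesHDG.simplex (opp t a)) (w a)) (j : Fin d)
    {ψ : ScalarField d} (hψ : ContDiff ℝ 1 ψ) :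
    elemInt t (fun x => gr j x * ψ x) + elemInt t (fun x => u x * partialD j ψ x) =
      ∑ a ∈ t, outwardNormal t a j * facetInt (opp t a) (fun x => w a x * ψ x) := by
  obtain ⟨un, hun, hlim, hlimd⟩ := exists_H1_approx hd hΩ hb hLip hu hgr
  have hun1 : ∀ n, ContDiff ℝ 1 (un n) := fun n => (hun n).of_le (by simp)
  have hT : Tendsto (fun n => elemInt t (fun x => un n x * partialD j ψ x)) atTop
      (𝓝 (elemInt t fun x => u x * partialD j ψ x)) :=
    tendsto_integral_mul (fun n => memLp_simplex t (hun n).continuous)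
      (hu.simplex hΩ hLip ht) (memLp_simplex t (continuous_partialD hψ j))
      (hlim.simplex hΩ hLip ht)
  have hTd : Tendsto (fun n => elemInt t (fun x => partialD j (un n) x * ψ x)) atTop
      (𝓝 (elemInt t fun x => gr j x * ψ x)) :=
    tendsto_integral_mul (fun n => memLp_simplex t (continuous_partialD (hun1 n) j))
      ((hgr j).1.simplex hΩ hLip ht) (memLp_simplex t hψ.continuous)
      ((hlimd j).simplex hΩ hLip ht)
  have hF : ∀ a ∈ t, Tendsto (fun n => facetInt (opp t a) fun x => un n x * ψ x) atTop
      (𝓝 (facetInt (opp t a) fun x => w a x * ψ x)) := fun a ha =>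
    tendsto_integral_mul (fun n => h.memLp_facet hd ha (hun n).continuous) (hw a ha).1
      (h.memLp_facet hd ha hψ.continuous)
      (h.tendsto_trace hd hΩ hLip ht ha hu (hw a ha) hgr hun hlim hlimd)
  refine tendsto_nhds_unique (hTd.add hT)
    ((tendsto_finsetSum t fun a ha => (hF a ha).const_mul (outwardNormal t a j)).congr fun n => ?_)
  exact (h.integral_partialD_mul hd j (hun1 n) hψ).symm

end Trace


/-! ### Geometry of triangulations -/

theorem IsElem.bary_eq_zero {t : Finset (Pt d)} (h : IsElem t) {c : Pt d} (hc : c ∈ t)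
    {s : Set (Pt d)} (hs : s ⊆ t) (hcs : c ∉ s) {x : Pt d} (hx : x ∈ convexHull ℝ s) :
    bary t c x = 0 := by
  classical
  refine ((h.mem_facet_iff hc).1 (convexHull_mono (t := (opp t c : Set (Pt d))) ?_ hx)).1
  intro y hy
  have hyc : y ≠ c := fun e => hcs (e ▸ hy)
  simpa [opp, hyc] using hs hy

theorem IsElem.surf_facet_pos {t : Finset (Pt d)} (h : IsElem t) (hd : 0 < d) {a x : Pt d}
    (ha : a ∈ t) (hx : bary t a x = 0) (hpos : ∀ b ∈ t, b ≠ a → 0 < bary t b x)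
    {O : Set (Pt d)} (hO : IsOpen O) (hxO : x ∈ O) :
    0 < surf d (O ∩ StokesHDG.simplex (opp t a)) := by
  have hO' : IsOpen (O ∩ ⋂ b ∈ t.filter (· ≠ a), {y | 0 < bary t b y}) :=
    hO.inter (isOpen_biInter_finset fun b _ => isOpen_lt continuous_const (continuous_bary t b))
  set O' := O ∩ ⋂ b ∈ t.filter (· ≠ a), {y | 0 < bary t b y} with hO'def
  have hmem : ∀ y, y ∈ O' ↔ y ∈ O ∧ ∀ b ∈ t, b ≠ a → 0 < bary t b y := by
    intro y; simp [hO'def]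
  obtain ⟨b, hb, hba⟩ := h.exists_ne hd a
  have hsub : O' ∩ hyperplane (outwardNormal t a) b ⊆ O ∩ StokesHDG.simplex (opp t a) := by
    rw [h.hyperplane_eq hd ha hb hba]
    rintro y ⟨hy, hy0⟩
    have hy0' : bary t a y = 0 := hy0
    refine ⟨((hmem y).1 hy).1, (h.mem_facet_iff ha).2 ⟨hy0, fun c hc => ?_⟩⟩
    by_cases hca : c = a
    · rw [hca, hy0']
    · exact (((hmem y).1 hy).2 c hc hca).le
  refine lt_of_lt_of_le ?_ (measure_mono hsub)
  rw [← Measure.restrict_apply hO'.measurableSet,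
    surf_restrict_hyperplane (h.norm_outwardNormal hd ha)]
  have hcont : Continuous fun w : (Submodule.span ℝ {outwardNormal t a})ᗮ => (w : Pt d) + b := by
    fun_prop
  rw [Measure.map_apply hcont.measurable hO'.measurableSet]
  refine (hO'.preimage hcont).measure_pos _ ⟨⟨x - b, ?_⟩, ?_⟩
  · rw [Submodule.mem_orthogonal_singleton_iff_inner_right]
    have : x ∈ hyperplane (outwardNormal t a) b := by
      rw [h.hyperplane_eq hd ha hb hba]; exact hx
    exact this
  · rw [mem_preimage]
    simp only [sub_add_cancel]
    exact (hmem x).2 ⟨hxO, hpos⟩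

theorem IsElem.eq_zero_of_facetInt_eq_zero {t : Finset (Pt d)} (h : IsElem t) (hd : 0 < d)
    {a x : Pt d} (ha : a ∈ t) (hx : bary t a x = 0) (hpos : ∀ b ∈ t, b ≠ a → 0 < bary t b x)
    {g : ScalarField d} (hg : Continuous g) (hg0 : ∀ y, 0 ≤ g y)
    (hint : facetInt (opp t a) g = 0) : g x = 0 := by
  by_contra hne
  have hgx : 0 < g x := lt_of_le_of_ne (hg0 x) (Ne.symm hne)
  have := h.isFiniteMeasure_facet hd ha
  have hi : Integrable g ((surf d).restrict (StokesHDG.simplex (opp t a))) :=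
    (h.memLp_facet hd ha hg).integrable (by norm_num)
  have h1 := (integral_eq_zero_iff_of_nonneg hg0 hi).1 hint
  have h2 := h.surf_facet_pos hd ha hx hpos (O := {y | 0 < g y})
    (isOpen_lt continuous_const hg) hgx
  refine h2.ne' ?_
  have h3 : ((surf d).restrict (StokesHDG.simplex (opp t a))) {y | 0 < g y} = 0 := by
    refine measure_mono_null ?_ h1
    intro y hy
    have hy' : 0 < g y := hy
    exact hy'.ne'
  rwa [Measure.restrict_apply (isOpen_lt continuous_const hg).measurableSet] at h3

namespace Triangulation

variable {Ω : Set (Pt d)} (𝒯 : Triangulation Ω) {t : Finset (Pt d)} {a : Pt d}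

theorem mem_elements : t ∈ 𝒯.elements ↔ t ∈ 𝒯.complex.faces ∧ t.card = d + 1 := by
  simp [elements]

theorem isElem (ht : t ∈ 𝒯.elements) : IsElem t where
  indep := 𝒯.complex.indep (𝒯.mem_elements.1 ht).1
  card := (𝒯.mem_elements.1 ht).2

theorem simplex_subset (ht : t ∈ 𝒯.elements) : simplex t ⊆ closure Ω := by
  rw [← 𝒯.space_eq]
  exact Geometry.SimplicialComplex.convexHull_subset_space (𝒯.mem_elements.1 ht).1

theorem exists_mem_simplex {x : Pt d} (hx : x ∈ closure Ω) : ∃ t ∈ 𝒯.elements, x ∈ simplex t := by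
  rw [← 𝒯.space_eq, Geometry.SimplicialComplex.mem_space_iff] at hx
  obtain ⟨s, hs, hxs⟩ := hx
  obtain ⟨t, ht, hst, hc⟩ := 𝒯.pure s hs
  exact ⟨t, 𝒯.mem_elements.2 ⟨ht, hc⟩, convexHull_mono (Finset.coe_subset.2 hst) hxs⟩

theorem isBounded (𝒯 : Triangulation Ω) : Bornology.IsBounded Ω := by
  have h : Ω ⊆ ⋃ t ∈ 𝒯.elements, simplex t := fun x hx => by
    obtain ⟨t, ht, hxt⟩ := 𝒯.exists_mem_simplex (subset_closure hx)
    exact mem_biUnion ht hxt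
  refine Bornology.IsBounded.subset ?_ h
  exact (Bornology.isBounded_biUnion_finset _).2 fun t _ => (isCompact_simplex t).isBounded

theorem opp_mem_faces (hd : 0 < d) (ht : t ∈ 𝒯.elements) (a : Pt d) :
    opp t a ∈ 𝒯.complex.faces := by
  classical
  refine 𝒯.complex.down_closed (𝒯.mem_elements.1 ht).1 (by simp [opp, Finset.erase_subset]) ?_
  obtain ⟨b, hb, hba⟩ := (𝒯.isElem ht).exists_ne hd a
  exact ⟨b, by simp [opp, hb, hba]⟩

theorem card_opp (ht : t ∈ 𝒯.elements) (ha : a ∈ t) : (opp t a).card = d := by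
  classical
  rw [opp, Finset.card_erase_of_mem ha, (𝒯.isElem ht).card]; rfl

theorem opp_mem_facets (hd : 0 < d) (ht : t ∈ 𝒯.elements) (ha : a ∈ t) :
    opp t a ∈ 𝒯.facets := by
  simp [facets, 𝒯.opp_mem_faces hd ht a, 𝒯.card_opp ht ha]

theorem facet_subset_closure (ht : t ∈ 𝒯.elements) (ha : a ∈ t) :
    simplex (opp t a) ⊆ closure Ω :=
  ((𝒯.isElem ht).facet_subset ha).trans (𝒯.simplex_subset ht)

theorem notMem_interior {s : Finset (Pt d)} (hs : s ∈ 𝒯.elements) (ht : t ∈ 𝒯.elements)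
    (hst : s ≠ t) {x : Pt d} (hx : x ∈ simplex s) : x ∉ interior (simplex t) := by
  intro hxt
  have h := 𝒯.isElem ht
  have hnot : ¬ t ⊆ s := fun hsub =>
    hst (Finset.eq_of_subset_of_card_le hsub (by rw [h.card, (𝒯.isElem hs).card])).symm
  obtain ⟨c, hct, hcs⟩ := Finset.not_subset.1 hnot
  have h1 := 𝒯.complex.inter_subset_convexHull (𝒯.mem_elements.1 hs).1 (𝒯.mem_elements.1 ht).1
    ⟨hx, interior_subset hxt⟩
  have h2 := h.bary_eq_zero hct inter_subset_right (fun hc => hcs hc.1) h1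
  exact ((h.mem_interior_simplex_iff.1 hxt) c hct).ne' h2

theorem glue_eq (ht : t ∈ 𝒯.elements) (v : ElemVector d) (i : Fin d) {x : Pt d}
    (hx : x ∈ interior (simplex t)) : 𝒯.glue v i x = v t i x := by
  rw [glue, Finset.sum_eq_single_of_mem t ht, indicator_of_mem hx]
  intro s hs hst
  refine indicator_of_notMem ?_ _
  exact 𝒯.notMem_interior ht hs hst.symm (interior_subset hx)

theorem integral_eq_sum (hΩ : IsOpen Ω) (hLip : HasLipschitzBoundary Ω) {f : ScalarField d}
    (hf : IntegrableOn f Ω) : ∫ x in Ω, f x = ∑ t ∈ 𝒯.elements, elemInt t f := by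
  have hsub : ∀ t ∈ 𝒯.elements, interior (simplex t) ⊆ Ω := fun t ht =>
    interior_simplex_subset hΩ hLip (𝒯.simplex_subset ht)
  have hae : (⋃ t ∈ 𝒯.elements, interior (simplex t) : Set (Pt d)) =ᵐ[volume] Ω := by
    refine (LE.le.eventuallyLE (iUnion₂_subset hsub)).antisymm ?_
    have h1 : Ω ⊆ ⋃ t ∈ 𝒯.elements, simplex t := fun x hx => by
      obtain ⟨t, ht, hxt⟩ := 𝒯.exists_mem_simplex (subset_closure hx)
      exact mem_biUnion ht hxt
    refine (LE.le.eventuallyLE h1).trans (EventuallyEq.le ?_)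
    exact (Finset.eventuallyEq_iUnion 𝒯.elements fun t _ => interior_simplex_ae_eq t).symm
  rw [← setIntegral_congr_set hae, integral_biUnion_finset]
  · exact Finset.sum_congr rfl fun t _ => setIntegral_congr_set (interior_simplex_ae_eq t)
  · exact fun t _ => isOpen_interior.measurableSet
  · intro s hs t ht hst
    rw [Function.onFun, disjoint_left]
    exact fun x hxs => 𝒯.notMem_interior hs ht hst (interior_subset hxs)
  · exact fun t ht => hf.mono_set (hsub t ht)

end Triangulation


/-! ### Jumps across facets -/

theorem exists_test {U : Set (Pt d)} (hU : IsOpen U) {x : Pt d} (hx : x ∈ U) :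
    ∃ ρ : Pt d → ℝ, ContDiff ℝ ∞ ρ ∧ HasCompactSupport ρ ∧ tsupport ρ ⊆ U ∧ (∀ y, 0 ≤ ρ y) ∧
      ρ x = 1 := by
  obtain ⟨r, hr, hb⟩ := Metric.nhds_basis_closedBall.mem_iff.1 (hU.mem_nhds hx)
  let b : ContDiffBump x := ⟨r / 2, r, by positivity, by linarith⟩
  exact ⟨b, b.contDiff, b.hasCompactSupport, by rw [b.tsupport_eq]; exact hb,
    fun y => b.nonneg, b.one_of_mem_closedBall (Metric.mem_closedBall_self (by positivity))⟩

theorem tendsto_segment (x y : Pt d) :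
    Tendsto (fun s : ℝ => x + s • (y - x)) (𝓝[>] 0) (𝓝 x) := by
  have : Continuous fun s : ℝ => x + s • (y - x) := by fun_prop
  have h2 := this.tendsto 0
  simp only [zero_smul, add_zero] at h2
  exact h2.mono_left nhdsWithin_le_nhds

theorem IsElem.exists_mem_facet_pos {t : Finset (Pt d)} (h : IsElem t) (hd : 0 < d) {a x : Pt d}
    (ha : a ∈ t) (hx : x ∈ StokesHDG.simplex (opp t a)) {O : Set (Pt d)} (hO : IsOpen O)
    (hxO : x ∈ O) :
    ∃ y ∈ StokesHDG.simplex (opp t a), y ∈ O ∧ ∀ b ∈ t, b ≠ a → 0 < bary t b y := by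
  classical
  have hmem : ∀ c, c ∈ opp t a ↔ c ≠ a ∧ c ∈ t := fun c => by simp [opp]
  have hc0 : (0 : ℝ) < (opp t a).card := by
    obtain ⟨b, hb, hba⟩ := h.exists_ne hd a
    exact_mod_cast Finset.card_pos.2 ⟨b, (hmem b).2 ⟨hba, hb⟩⟩
  set m : Pt d := (opp t a).centerMass (fun _ => (1 : ℝ)) id with hm
  have e2 : ∑ _c ∈ opp t a, ((opp t a).card : ℝ)⁻¹ = 1 := by
    rw [Finset.sum_const, nsmul_eq_mul, mul_inv_cancel₀ hc0.ne']
  have e1 : m = ∑ c ∈ opp t a, ((opp t a).card : ℝ)⁻¹ • c := by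
    rw [hm, Finset.centerMass]; simp [Finset.smul_sum]
  have hbm : ∀ b, bary t b m = ∑ c ∈ opp t a, ((opp t a).card : ℝ)⁻¹ * bary t b c := by
    intro b
    have := (opp t a).map_affineCombination (k := ℝ) (id : Pt d → Pt d)
      (fun _ => ((opp t a).card : ℝ)⁻¹) e2 (bary t b)
    rw [Finset.affineCombination_eq_linear_combination _ _ _ e2,
      Finset.affineCombination_eq_linear_combination _ _ _ e2] at this
    simpa [e1] using this
  have hmS : m ∈ StokesHDG.simplex (opp t a) := by
    refine Finset.centerMass_id_mem_convexHull _ (fun _ _ => zero_le_one) ?_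
    simpa only [Finset.sum_const, nsmul_eq_mul, mul_one] using hc0
  have hmV : ∀ b ∈ t, b ≠ a → 0 < bary t b m := by
    intro b hb hba
    rw [hbm b, Finset.sum_eq_single_of_mem b ((hmem b).2 ⟨hba, hb⟩), h.bary_self hb]
    · positivity
    · intro c hc hcb
      rw [h.bary_ne hb ((hmem c).1 hc).2 hcb, mul_zero]
  obtain ⟨s, hsO, hs⟩ := (((tendsto_segment x m).eventually (hO.mem_nhds hxO)).and
    (Ioo_mem_nhdsGT (zero_lt_one' ℝ))).exists
  refine ⟨x + s • (m - x), (convex_simplex _).add_smul_sub_mem hx hmS ⟨hs.1.le, hs.2.le⟩,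
    hsO, fun b hb hba => ?_⟩
  have e : bary t b (x + s • (m - x)) = (1 - s) * bary t b x + s * bary t b m := by
    rw [IsElem.bary_add_smul, IsElem.linear_bary_sub]; ring
  rw [e]
  have h1 := ((h.mem_facet_iff ha).1 hx).2 b hb
  have h3 : 0 ≤ (1 - s) * bary t b x := mul_nonneg (by linarith [hs.2]) h1
  have h4 : 0 < s * bary t b m := mul_pos hs.1 (hmV b hb hba)
  linarith

namespace Triangulation

variable {Ω : Set (Pt d)} (𝒯 : Triangulation Ω)

open Classical in
/-- The sum over all elements sharing the facet `e` of the boundary field `F`. -/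
noncomputable def jump (F : Finset (Pt d) → Pt d → ScalarField d) (e : Finset (Pt d)) :
    ScalarField d :=
  fun x => ∑ s ∈ (𝒯.elements.sigma fun t => t).filter (fun s => opp s.1 s.2 = e), F s.1 s.2 x

open Classical in
theorem sum_facet_eq_sum_jump (hd : 0 < d) {F : Finset (Pt d) → Pt d → ScalarField d}
    (hF : ∀ t ∈ 𝒯.elements, ∀ a ∈ t, Continuous (F t a)) {ψ : Finset (Pt d) → ScalarField d}
    (hψ : ∀ t ∈ 𝒯.elements, ∀ a ∈ t,
      MemLp (ψ (opp t a)) 2 ((surf d).restrict (simplex (opp t a)))) :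
    ∑ t ∈ 𝒯.elements, ∑ a ∈ t, facetInt (opp t a) (fun x => F t a x * ψ (opp t a) x) =
      ∑ e ∈ (𝒯.elements.sigma fun t => t).image (fun s => opp s.1 s.2),
        facetInt e (fun x => 𝒯.jump F e x * ψ e x) := by
  rw [Finset.sum_sigma']
  rw [← Finset.sum_fiberwise_of_maps_to (g := fun s : (_ : Finset (Pt d)) × Pt d => opp s.1 s.2)
    (t := (𝒯.elements.sigma fun t => t).image (fun s => opp s.1 s.2))
    (fun s hs => Finset.mem_image_of_mem _ hs)]
  refine Finset.sum_congr rfl fun e _ => ?_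
  simp only [jump, Finset.sum_mul, facetInt]
  rw [integral_finsetSum]
  · refine Finset.sum_congr rfl fun s hs => ?_
    rw [(Finset.mem_filter.1 hs).2]
  · intro s hs
    obtain ⟨hs', rfl⟩ := Finset.mem_filter.1 hs
    obtain ⟨ht, ha⟩ := Finset.mem_sigma.1 hs'
    exact ((𝒯.isElem ht).memLp_facet hd ha (hF _ ht _ ha)).integrable_mul (hψ _ ht _ ha)

theorem notMem_facet (hd : 0 < d) {t t' : Finset (Pt d)} {a a' : Pt d} (ht : t ∈ 𝒯.elements)
    (ha : a ∈ t) (ht' : t' ∈ 𝒯.elements) (ha' : a' ∈ t') (hne : opp t' a' ≠ opp t a) {x : Pt d}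
    (hx : x ∈ simplex (opp t a)) (hpos : ∀ b ∈ t, b ≠ a → 0 < bary t b x) :
    x ∉ simplex (opp t' a') := by
  classical
  intro hx'
  have hnot : ¬ opp t a ⊆ opp t' a' := fun hsub =>
    hne (Finset.eq_of_subset_of_card_le hsub
      (by rw [𝒯.card_opp ht ha, 𝒯.card_opp ht' ha'])).symm
  obtain ⟨c, hct, hcs⟩ := Finset.not_subset.1 hnot
  have hc : c ≠ a ∧ c ∈ t := by simpa [opp] using hct
  have h1 := 𝒯.complex.inter_subset_convexHull (𝒯.opp_mem_faces hd ht a)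
    (𝒯.opp_mem_faces hd ht' a') ⟨hx, hx'⟩
  have h2 := (𝒯.isElem ht).bary_eq_zero hc.2 (fun y hy => by
    have : y ∈ opp t a := hy.1
    simp only [opp, Finset.mem_erase] at this
    exact this.2) (fun hc => hcs hc.2) h1
  exact (hpos c hc.2 hc.1).ne' h2

theorem isPolyDeg_jump {k : ℕ} {F : Finset (Pt d) → Pt d → ScalarField d}
    (hF : ∀ t ∈ 𝒯.elements, ∀ a ∈ t, IsPolyDeg k (F t a)) (e : Finset (Pt d)) :
    IsPolyDeg k (𝒯.jump F e) := by
  classical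
  refine IsPolyDeg.sum _ fun s hs => ?_
  obtain ⟨hs, -⟩ := Finset.mem_filter.1 hs
  obtain ⟨h1, h2⟩ := Finset.mem_sigma.1 hs
  exact hF _ h1 _ h2

open Classical in
/-- A point of an open facet has a neighbourhood that does not meet the other facets. -/
theorem exists_isOpen_facet (hd : 0 < d) (hΩ : IsOpen Ω) {t : Finset (Pt d)} {a x : Pt d}
    (ht : t ∈ 𝒯.elements) (ha : a ∈ t) (hx : x ∈ simplex (opp t a)) (hxΩ : x ∈ Ω)
    (hpos : ∀ b ∈ t, b ≠ a → 0 < bary t b x) :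
    ∃ U : Set (Pt d), IsOpen U ∧ x ∈ U ∧ U ⊆ Ω ∧
      ∀ e ∈ (𝒯.elements.sigma fun t => t).image (fun s => opp s.1 s.2), e ≠ opp t a →
        ∀ z ∈ simplex e, z ∉ U := by
  set E := (𝒯.elements.sigma fun t => t).image (fun s => opp s.1 s.2) with hE
  set K : Set (Pt d) := ⋃ e ∈ E.filter (· ≠ opp t a), simplex e with hK
  have hKc : IsClosed K :=
    (Finset.finite_toSet _).isClosed_biUnion fun e _ => (isCompact_simplex e).isClosed
  have hxK : x ∉ K := by
    intro hxK
    obtain ⟨e, he, hxe⟩ := mem_iUnion₂.1 hxK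
    obtain ⟨he, hne⟩ := Finset.mem_filter.1 he
    obtain ⟨s, hs, rfl⟩ := Finset.mem_image.1 he
    obtain ⟨h1, h2⟩ := Finset.mem_sigma.1 hs
    exact 𝒯.notMem_facet hd ht ha h1 h2 hne hx hpos hxe
  exact ⟨Ω \ K, hΩ.sdiff hKc, ⟨hxΩ, hxK⟩, sdiff_subset, fun e he hne z hz hzU =>
    hzU.2 (mem_iUnion₂.2 ⟨e, Finset.mem_filter.2 ⟨he, hne⟩, hz⟩)⟩

theorem jump_eq_zero_of_pos (hd : 0 < d) (hΩ : IsOpen Ω) {k : ℕ}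
    {F : Finset (Pt d) → Pt d → ScalarField d}
    (hF : ∀ t ∈ 𝒯.elements, ∀ a ∈ t, IsPolyDeg k (F t a))
    (h : ∀ φ, IsTest Ω φ →
      ∑ t ∈ 𝒯.elements, ∑ a ∈ t, facetInt (opp t a) (fun x => F t a x * φ x) = 0)
    {t : Finset (Pt d)} {a x : Pt d} (ht : t ∈ 𝒯.elements) (ha : a ∈ t)
    (hx : x ∈ simplex (opp t a)) (hxΩ : x ∈ Ω) (hpos : ∀ b ∈ t, b ≠ a → 0 < bary t b x) :
    𝒯.jump F (opp t a) x = 0 := by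
  classical
  have hel := 𝒯.isElem ht
  have hJ := 𝒯.isPolyDeg_jump hF (opp t a)
  obtain ⟨U, hU, hxU, hUΩ, hUe⟩ := 𝒯.exists_isOpen_facet hd hΩ ht ha hx hxΩ hpos
  obtain ⟨ρ, hρ, hρc, hρs, hρ0, hρx⟩ := exists_test hU hxU
  generalize hJdef : 𝒯.jump F (opp t a) = J at hJ ⊢
  have hφ : IsTest Ω (fun y => ρ y * J y) :=
    ⟨hρ.mul hJ.contDiff, hρc.mul_right,
      (closure_mono (Function.support_mul_subset_left _ _)).trans (hρs.trans hUΩ)⟩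
  have h1 := h _ hφ
  rw [𝒯.sum_facet_eq_sum_jump hd (fun t ht a ha => (hF t ht a ha).continuous)
    (ψ := fun _ y => ρ y * J y)
    (fun t ht a ha => (𝒯.isElem ht).memLp_facet hd ha hφ.1.continuous),
    Finset.sum_eq_single_of_mem (opp t a)
    (Finset.mem_image.2 ⟨⟨t, a⟩, Finset.mem_sigma.2 ⟨ht, ha⟩, rfl⟩), hJdef] at h1
  · have hc : Continuous fun y => J y * (ρ y * J y) :=
      hJ.continuous.mul (hρ.continuous.mul hJ.continuous)
    have h2 := hel.eq_zero_of_facetInt_eq_zero hd ha ((hel.mem_facet_iff ha).1 hx).1 hpos hc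
      (fun y => by
        have : J y * (ρ y * J y) = ρ y * J y ^ 2 := by ring
        rw [this]
        exact mul_nonneg (hρ0 y) (sq_nonneg _)) h1
    rw [hρx, one_mul] at h2
    exact mul_self_eq_zero.1 h2
  · intro e he hne
    refine setIntegral_eq_zero_of_forall_eq_zero fun z hz => ?_
    have : ρ z = 0 := image_eq_zero_of_notMem_tsupport fun hzs => hUe e he hne z hz (hρs hzs)
    rw [this, zero_mul, mul_zero]

/-- If the total flux of a polynomial boundary field against every test function vanishes, then
its jump vanishes on every facet that is not contained in the boundary of the domain. -/
theorem jump_eq_zero (hd : 0 < d) (hΩ : IsOpen Ω) {k : ℕ}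
    {F : Finset (Pt d) → Pt d → ScalarField d}
    (hF : ∀ t ∈ 𝒯.elements, ∀ a ∈ t, IsPolyDeg k (F t a))
    (h : ∀ φ, IsTest Ω φ →
      ∑ t ∈ 𝒯.elements, ∑ a ∈ t, facetInt (opp t a) (fun x => F t a x * φ x) = 0)
    {t : Finset (Pt d)} {a : Pt d} (ht : t ∈ 𝒯.elements) (ha : a ∈ t)
    (hfr : ¬ simplex (opp t a) ⊆ frontier Ω) {y : Pt d} (hy : y ∈ simplex (opp t a)) :
    𝒯.jump F (opp t a) y = 0 := by
  obtain ⟨x₁, hx₁, hx₁f⟩ := not_subset.1 hfr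
  have hx₁Ω : x₁ ∈ Ω := by
    by_contra hn
    exact hx₁f (by rw [frontier, hΩ.interior_eq]; exact ⟨𝒯.facet_subset_closure ht ha hx₁, hn⟩)
  obtain ⟨x₂, hx₂, hx₂Ω, hx₂V⟩ := (𝒯.isElem ht).exists_mem_facet_pos hd ha hx₁ hΩ hx₁Ω
  have hpos : ∀ᶠ z in 𝓝 x₂, ∀ b ∈ t, b ≠ a → 0 < bary t b z := by
    rw [Finset.eventually_all]
    intro b hb
    by_cases hba : b = a
    · simp [hba]
    · filter_upwards [(continuous_bary t b).continuousAt.eventually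
        (lt_mem_nhds (hx₂V b hb hba))] with z hz _ using hz
  have hev := (tendsto_segment x₂ y).eventually ((hΩ.eventually_mem hx₂Ω).and hpos)
  rw [eventually_nhdsWithin_iff, Metric.eventually_nhds_iff] at hev
  obtain ⟨δ, hδ, hev⟩ := hev
  refine (𝒯.isPolyDeg_jump hF (opp t a)).eq_zero_of_segment (x := x₂) (δ := min δ 1)
    (lt_min hδ one_pos) fun s hs => ?_
  have h1 := hev (y := s) (by
    rw [Real.dist_eq, sub_zero, abs_of_pos hs.1]; exact hs.2.trans_le (min_le_left _ _)) hs.1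
  exact 𝒯.jump_eq_zero_of_pos hd hΩ hF h ht ha ((convex_simplex _).add_smul_sub_mem hx₂ hy
    ⟨hs.1.le, hs.2.le.trans (min_le_right _ _)⟩) h1.1 h1.2

theorem sum_facet_eq_zero (hd : 0 < d) (hΩ : IsOpen Ω) {k : ℕ}
    {F : Finset (Pt d) → Pt d → ScalarField d}
    (hF : ∀ t ∈ 𝒯.elements, ∀ a ∈ t, IsPolyDeg k (F t a))
    (h : ∀ φ, IsTest Ω φ →
      ∑ t ∈ 𝒯.elements, ∑ a ∈ t, facetInt (opp t a) (fun x => F t a x * φ x) = 0)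
    {ψ : Finset (Pt d) → ScalarField d}
    (hψ : ∀ t ∈ 𝒯.elements, ∀ a ∈ t,
      MemLp (ψ (opp t a)) 2 ((surf d).restrict (simplex (opp t a))))
    (h0 : ∀ t ∈ 𝒯.elements, ∀ a ∈ t, simplex (opp t a) ⊆ frontier Ω →
      ∀ x ∈ simplex (opp t a), F t a x * ψ (opp t a) x = 0) :
    ∑ t ∈ 𝒯.elements, ∑ a ∈ t, facetInt (opp t a) (fun x => F t a x * ψ (opp t a) x) = 0 := by
  classical
  rw [𝒯.sum_facet_eq_sum_jump hd (fun t ht a ha => (hF t ht a ha).continuous) hψ]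
  refine Finset.sum_eq_zero fun e he => ?_
  obtain ⟨s, hs, rfl⟩ := Finset.mem_image.1 he
  obtain ⟨ht, ha⟩ := Finset.mem_sigma.1 hs
  refine setIntegral_eq_zero_of_forall_eq_zero fun x hx => ?_
  by_cases hfr : simplex (opp s.1 s.2) ⊆ frontier Ω
  · rw [jump, Finset.sum_mul]
    refine Finset.sum_eq_zero fun s' hs' => ?_
    obtain ⟨hs', he⟩ := Finset.mem_filter.1 hs'
    obtain ⟨ht', ha'⟩ := Finset.mem_sigma.1 hs'
    have := h0 _ ht' _ ha' (by rw [he]; exact hfr) x (by rw [he]; exact hx)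
    rwa [he] at this
  · rw [𝒯.jump_eq_zero hd hΩ hF h ht ha hfr hx, zero_mul]

end Triangulation


theorem IsElem.integrable_facet {t : Finset (Pt d)} {a : Pt d} (h : IsElem t) (hd : 0 < d)
    (ha : a ∈ t) {f : ScalarField d} (hf : Continuous f) :
    Integrable f ((surf d).restrict (StokesHDG.simplex (opp t a))) := by
  have := h.isFiniteMeasure_facet hd ha
  exact (h.memLp_facet hd ha hf).integrable (by norm_num)

theorem continuous_divV {v : VectorField d} (hv : ∀ j, ContDiff ℝ 1 (v j)) :
    Continuous (divV v) :=
  continuous_finsetSum _ fun j _ => continuous_partialD (hv j) j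

/-- Integration by parts for a vector field and a scalar field of class `C¹`. -/
theorem IsElem.integral_divV_mul {t : Finset (Pt d)} (h : IsElem t) (hd : 0 < d)
    {v : VectorField d} (hv : ∀ j, ContDiff ℝ 1 (v j)) {g : ScalarField d} (hg : ContDiff ℝ 1 g) :
    elemInt t (fun x => divV v x * g x) + elemInt t (fun x => ∑ j, v j x * partialD j g x) =
      ∑ a ∈ t, facetInt (opp t a) (fun x => (∑ j, v j x * outwardNormal t a j) * g x) := by
  have e1 : elemInt t (fun x => divV v x * g x) =
      ∑ j, elemInt t (fun x => partialD j (v j) x * g x) := by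
    simp only [elemInt, divV, Finset.sum_mul]
    exact integral_finsetSum _ fun j _ =>
      integrableOn_simplex t ((continuous_partialD (hv j) j).mul hg.continuous)
  have e2 : elemInt t (fun x => ∑ j, v j x * partialD j g x) =
      ∑ j, elemInt t (fun x => v j x * partialD j g x) :=
    integral_finsetSum _ fun j _ =>
      integrableOn_simplex t ((hv j).continuous.mul (continuous_partialD hg j))
  rw [e1, e2, ← Finset.sum_add_distrib,
    Finset.sum_congr rfl fun j _ => h.integral_partialD_mul hd j (hv j) hg, Finset.sum_comm]
  refine Finset.sum_congr rfl fun a ha => ?_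
  simp only [facetInt, Finset.sum_mul, ← integral_const_mul]
  have hi : ∀ j, Integrable (fun x => v j x * outwardNormal t a j * g x)
      ((surf d).restrict (StokesHDG.simplex (opp t a))) := fun j =>
    h.integrable_facet hd ha (((hv j).continuous.mul continuous_const).mul hg.continuous)
  rw [integral_finsetSum _ fun j _ => hi j]
  refine Finset.sum_congr rfl fun j _ => ?_
  congr 1; ext x; ring

theorem IsTest.integral_partialD {Ω : Set (Pt d)} {φ : ScalarField d}
    (hφ : IsTest Ω φ) (j : Fin d) : ∫ x in Ω, partialD j φ x = 0 := by
  have h1 : ContDiff ℝ 1 φ := hφ.1.of_le (by simp)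
  have h2 : ∫ x, partialD j φ x = 0 := by
    have hi : Integrable (partialD j φ) :=
      (continuous_partialD h1 j).integrable_of_hasCompactSupport (hasCompactSupport_partialD hφ.2.1 j)
    have := integral_mul_fderiv_eq_neg_fderiv_mul_of_integrable (μ := volume)
      (f := fun _ : Pt d => (1 : ℝ)) (g := φ) (v := EuclideanSpace.single j 1)
      (by simp) (by simp only [one_mul]; exact hi)
      (by simpa using hφ.1.continuous.integrable_of_hasCompactSupport hφ.2.1)
      (fun x _ => differentiableAt_const _) (fun x _ => (h1.differentiable one_ne_zero) x)
    simpa [partialD] using this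
  rw [← h2]
  refine setIntegral_eq_integral_of_forall_compl_eq_zero fun x hx => ?_
  exact partialD_eq_zero_of_notMem_tsupport (fun h => hx (hφ.2.2 h)) j

namespace Triangulation

variable {Ω : Set (Pt d)} (𝒯 : Triangulation Ω)

/-- The normal components of a continuous field cancel against single-valued facet fields that
vanish on the boundary. -/
theorem sum_normal_facet_eq_zero (hd : 0 < d) (hΩ : IsOpen Ω) (hLip : HasLipschitzBoundary Ω)
    (j : Fin d) {ψ : Finset (Pt d) → ScalarField d}
    (hψ : ∀ t ∈ 𝒯.elements, ∀ a ∈ t,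
      MemLp (ψ (opp t a)) 2 ((surf d).restrict (simplex (opp t a))))
    (h0 : ∀ e ∈ 𝒯.facets, simplex e ⊆ frontier Ω → ∀ x ∈ simplex e, ψ e x = 0) :
    ∑ t ∈ 𝒯.elements, ∑ a ∈ t,
      facetInt (opp t a) (fun x => outwardNormal t a j * ψ (opp t a) x) = 0 := by
  refine 𝒯.sum_facet_eq_zero hd hΩ (k := 0) (F := fun t a _ => outwardNormal t a j)
    (fun t _ a _ => IsPolyDeg.const _ _) (fun φ hφ => ?_) hψ fun t ht a ha hfr x hx => by
      rw [h0 _ (𝒯.opp_mem_facets hd ht ha) hfr x hx, mul_zero]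
  have h1 : ContDiff ℝ 1 φ := hφ.1.of_le (by simp)
  have h2 := 𝒯.integral_eq_sum hΩ hLip (f := partialD j φ)
    ((continuous_partialD h1 j).integrable_of_hasCompactSupport
      (hasCompactSupport_partialD hφ.2.1 j)).integrableOn
  rw [hφ.integral_partialD] at h2
  rw [h2]
  refine Finset.sum_congr rfl fun t ht => ?_
  rw [(𝒯.isElem ht).integral_partialD hd j h1]
  exact Finset.sum_congr rfl fun a _ => integral_const_mul _ _

theorem setIntegral_interior_eq {U : Set (Pt d)} (hU : MeasurableSet U) {f : ScalarField d}
    {t : Finset (Pt d)}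
    (hsub : interior (simplex t) ⊆ U) (hf : ∀ x ∉ interior (simplex t), f x = 0) :
    ∫ x in U, f x = elemInt t f := by
  rw [elemInt, ← setIntegral_congr_set (interior_simplex_ae_eq t)]
  exact setIntegral_eq_of_subset_of_forall_sdiff_eq_zero hU hsub fun x hx => hf x hx.2

theorem ae_eq_divV (hd : 0 < d) (hΩ : IsOpen Ω) (hLip : HasLipschitzBoundary Ω)
    {v : ElemVector d} (hv : ∀ t ∈ 𝒯.elements, ∀ j, ContDiff ℝ 1 (v t j)) {D : ScalarField d}
    (hD : IsWeakDiv Ω (𝒯.glue v) D) {t : Finset (Pt d)} (ht : t ∈ 𝒯.elements) :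
    D =ᵐ[volume.restrict (interior (simplex t))] divV (v t) := by
  have hsub := interior_simplex_subset hΩ hLip (𝒯.simplex_subset ht)
  refine ae_eq_of_forall_isTest isOpen_interior
    (hD.1.mono_measure (Measure.restrict_mono hsub le_rfl))
    ((memLp_simplex t (continuous_divV (hv t ht))).mono_measure
      (Measure.restrict_mono interior_subset le_rfl)) fun φ hφ => ?_
  have h1 : ContDiff ℝ 1 φ := hφ.1.of_le (by simp)
  have hφ0 : ∀ x ∉ interior (simplex t), φ x = 0 := fun x hx =>
    image_eq_zero_of_notMem_tsupport fun h => hx (hφ.2.2 h)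
  have hpφ0 : ∀ j, ∀ x ∉ interior (simplex t), partialD j φ x = 0 := fun j x hx =>
    partialD_eq_zero_of_notMem_tsupport (fun h => hx (hφ.2.2 h)) j
  have h2 := hD.2 φ ⟨hφ.1, hφ.2.1, hφ.2.2.trans hsub⟩
  rw [setIntegral_interior_eq hΩ.measurableSet hsub (fun x hx => by simp [hpφ0 _ x hx]),
    setIntegral_interior_eq hΩ.measurableSet hsub (fun x hx => by simp [hφ0 x hx])] at h2
  rw [setIntegral_interior_eq (t := t) isOpen_interior.measurableSet subset_rfl
      (fun x hx => by simp [hφ0 x hx]),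
    setIntegral_interior_eq (t := t) isOpen_interior.measurableSet subset_rfl
      (fun x hx => by simp [hφ0 x hx])]
  have h3 : elemInt t (fun x => ∑ j, 𝒯.glue v j x * partialD j φ x) =
      elemInt t (fun x => ∑ j, v t j x * partialD j φ x) := by
    refine integral_congr_ae ?_
    rw [← Measure.restrict_congr_set (interior_simplex_ae_eq t)]
    filter_upwards [ae_restrict_mem isOpen_interior.measurableSet] with x hx
    simp only [𝒯.glue_eq ht v _ hx]
  have h4 := (𝒯.isElem ht).integral_divV_mul hd (hv t ht) h1
  rw [Finset.sum_eq_zero] at h4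
  · linarith
  · intro a ha
    refine setIntegral_eq_zero_of_forall_eq_zero fun x hx => ?_
    have : φ x = 0 := hφ0 x fun hxi => (((𝒯.isElem ht).mem_interior_simplex_iff.1 hxi) a ha).ne'
      (((𝒯.isElem ht).mem_facet_iff ha).1 hx).1
    rw [this, mul_zero]

/-- The normal components of a field in `V0` cancel against continuous functions. -/
theorem sum_flux_eq_zero (hd : 0 < d) (hΩ : IsOpen Ω) (hLip : HasLipschitzBoundary Ω) {k : ℕ}
    {v : ElemVector d} (hv : v ∈ 𝒯.V0 k) {ψ : ScalarField d} (hψ : Continuous ψ) :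
    ∑ t ∈ 𝒯.elements, ∑ a ∈ t,
      facetInt (opp t a) (fun x => (∑ i, v t i x * outwardNormal t a i) * ψ x) = 0 := by
  obtain ⟨hRT, ⟨hL2, D, hD⟩, hbd⟩ := hv
  have hpoly : ∀ t ∈ 𝒯.elements, ∀ i, IsPolyDeg (k + 1) (v t i) := fun t ht =>
    (hRT t ht).isPolyDeg_succ
  have hC1 : ∀ t ∈ 𝒯.elements, ∀ i, ContDiff ℝ 1 (v t i) := fun t ht i =>
    (hpoly t ht i).contDiff
  refine 𝒯.sum_facet_eq_zero hd hΩ (k := k + 1)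
    (F := fun t a x => ∑ i, v t i x * outwardNormal t a i) (ψ := fun _ => ψ)
    (fun t ht a _ => IsPolyDeg.sum _ fun i _ => (hpoly t ht i).mul_const _) (fun φ hφ => ?_)
    (fun t ht a ha => (𝒯.isElem ht).memLp_facet hd ha hψ) fun t ht a ha hfr x hx => by
      rw [hbd t ht a ha hfr x hx, zero_mul]
  have h1 : ContDiff ℝ 1 φ := hφ.1.of_le (by simp)
  have h2 := hD.2 φ hφ
  have i1 : IntegrableOn (fun x => D x * φ x) Ω := by
    simpa only [mul_comm, IntegrableOn] using hD.1.integrable_mul_compact hφ.1.continuous hφ.2.1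
  have i2 : IntegrableOn (fun x => ∑ j, 𝒯.glue v j x * partialD j φ x) Ω := by
    refine integrable_finsetSum _ fun j _ => ?_
    simpa only [mul_comm] using (hL2 j).integrable_mul_compact (continuous_partialD h1 j)
      (hasCompactSupport_partialD hφ.2.1 j)
  rw [𝒯.integral_eq_sum hΩ hLip i1, 𝒯.integral_eq_sum hΩ hLip i2, eq_neg_iff_add_eq_zero,
    ← Finset.sum_add_distrib] at h2
  rw [← h2]
  refine Finset.sum_congr rfl fun t ht => ?_
  rw [← (𝒯.isElem ht).integral_divV_mul hd (hC1 t ht) h1, add_comm]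
  congr 1
  · refine integral_congr_ae ?_
    rw [← Measure.restrict_congr_set (interior_simplex_ae_eq t)]
    filter_upwards [ae_restrict_mem isOpen_interior.measurableSet] with x hx
    simp only [𝒯.glue_eq ht v _ hx]
  · refine integral_congr_ae ?_
    rw [← Measure.restrict_congr_set (interior_simplex_ae_eq t)]
    filter_upwards [𝒯.ae_eq_divV hd hΩ hLip hC1 hD ht] with x hx
    rw [hx]

end Triangulation


/-! ### The extended normal pairing -/

theorem tendsto_elemInt_mul {Ω : Set (Pt d)} (hΩ : IsOpen Ω) (hLip : HasLipschitzBoundary Ω)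
    {t : Finset (Pt d)} (ht : simplex t ⊆ closure Ω) {fn : ℕ → ScalarField d} {f h : ScalarField d}
    (hfn : ∀ n, Continuous (fn n)) (hf : MemL2 Ω f) (hh : Continuous h)
    (hlim : TendstoL2 Ω fn f) :
    Tendsto (fun n => elemInt t (fun x => fn n x * h x)) atTop
      (𝓝 (elemInt t fun x => f x * h x)) :=
  tendsto_integral_mul (fun n => memLp_simplex t (hfn n)) (hf.simplex hΩ hLip ht)
    (memLp_simplex t hh) (hlim.simplex hΩ hLip ht)

theorem integrable_elem_mul {Ω : Set (Pt d)} (hΩ : IsOpen Ω) (hLip : HasLipschitzBoundary Ω)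
    {t : Finset (Pt d)} (ht : simplex t ⊆ closure Ω) {f h : ScalarField d}
    (hf : MemL2 Ω f) (hh : Continuous h) :
    Integrable (fun x => f x * h x) (volume.restrict (simplex t)) :=
  (hf.simplex hΩ hLip ht).integrable_mul (memLp_simplex t hh)

theorem contDiff_stress {L : TensorField d} {p : ScalarField d}
    (hL : ∀ i j, ContDiff ℝ 1 (L i j)) (hp : ContDiff ℝ 1 p) (i j : Fin d) :
    ContDiff ℝ 1 (stress L p i j) := by
  unfold stress
  split_ifs
  · exact (hL i j).sub hp
  · exact (hL i j).sub contDiff_const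

theorem divT_stress {L : TensorField d} {p : ScalarField d}
    (hL : ∀ i j, ContDiff ℝ 1 (L i j)) (hp : ContDiff ℝ 1 p) (i : Fin d) (x : Pt d) :
    divT (stress L p) i x = ∑ j, partialD j (L i j) x - partialD i p x := by
  have h1 : ∀ j, partialD j (stress L p i j) x =
      partialD j (L i j) x - if i = j then partialD i p x else 0 := by
    intro j
    unfold stress
    split_ifs with hij
    · subst hij
      exact partialD_sub (((hL i i).differentiable one_ne_zero) x)
        ((hp.differentiable one_ne_zero) x)
    · simp only [sub_zero]
  simp only [divT, divV, h1, Finset.sum_sub_distrib]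
  simp

namespace Triangulation

variable {Ω : Set (Pt d)} (𝒯 : Triangulation Ω)

/-- The volume form `-(D, v) - (L, ∇v) + (p, ∇·v)` of the pairing `⟨L n, v̂ - v⟩_{∂T_h}`, where `D`
is the divergence of `L - p I`. -/
noncomputable def volumePairing (L : TensorField d) (p : ScalarField d) (D : VectorField d)
    (v : ElemVector d) : ℝ :=
  - ∑ t ∈ 𝒯.elements, (∑ i, elemInt t (fun x => D i x * v t i x) +
    ∑ i, ∑ j, elemInt t (fun x => L i j x * partialD j (v t i) x) -
      elemInt t (fun x => p x * divV (v t) x))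

theorem contDiff_of_mem_V0 {k : ℕ} {v : ElemVector d} (hv : v ∈ 𝒯.V0 k) {t : Finset (Pt d)}
    (ht : t ∈ 𝒯.elements) (i : Fin d) {n : WithTop ℕ∞} : ContDiff ℝ n (v t i) :=
  ((hv.1 t ht).isPolyDeg_succ i).contDiff

theorem memLp_of_mem_Vhat0 (hd : 0 < d) {k : ℕ} {w : FacetVector d} (hw : w ∈ 𝒯.Vhat0 k)
    {t : Finset (Pt d)} (ht : t ∈ 𝒯.elements) {a : Pt d} (ha : a ∈ t) (i : Fin d)
    {f : ScalarField d} (hf : Continuous f) :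
    MemLp (fun x => f x * w (opp t a) i x) 2 ((surf d).restrict (simplex (opp t a))) := by
  obtain ⟨q, hq, heq⟩ := hw.1 _ (𝒯.opp_mem_facets hd ht ha) i
  refine (memLp_congr_ae ?_).1 ((𝒯.isElem ht).memLp_facet hd ha (hf.mul hq.continuous))
  filter_upwards [ae_restrict_mem (measurableSet_simplex _)] with x hx
  rw [Pi.mul_apply, heq hx]

theorem sum_gradient_eq_zero (hd : 0 < d) (hΩ : IsOpen Ω) (hLip : HasLipschitzBoundary Ω)
    {k : ℕ} {v : ElemVector d} (hv : v ∈ 𝒯.V0 k) {p : ScalarField d} (hp : ContDiff ℝ 1 p) :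
    ∑ t ∈ 𝒯.elements, (∑ i, elemInt t (fun x => partialD i p x * v t i x) +
      elemInt t (fun x => p x * divV (v t) x)) = 0 := by
  rw [← 𝒯.sum_flux_eq_zero hd hΩ hLip hv hp.continuous]
  refine Finset.sum_congr rfl fun t ht => ?_
  have hC : ∀ j, ContDiff ℝ 1 (v t j) := fun j => 𝒯.contDiff_of_mem_V0 hv ht j
  rw [← (𝒯.isElem ht).integral_divV_mul hd hC hp, add_comm]
  congr 1
  · simp only [mul_comm]
  · simp only [elemInt, mul_comm (v _ _ _)]
    exact (integral_finsetSum _ fun i _ => integrableOn_simplex t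
      ((continuous_partialD hp i).mul (hC i).continuous)).symm

theorem innerB_eq_volumePairing (hd : 0 < d) (hΩ : IsOpen Ω) (hLip : HasLipschitzBoundary Ω)
    {k : ℕ} {v : ElemVector d} (hv : v ∈ 𝒯.V0 k) {w : FacetVector d} (hw : w ∈ 𝒯.Vhat0 k)
    {L : TensorField d} {p : ScalarField d} (hL : ∀ i j, ContDiff ℝ 1 (L i j))
    (hp : ContDiff ℝ 1 p) :
    𝒯.innerB (normalTrace fun _ => L) (facetwise w - elemTrace v) =
      𝒯.volumePairing L p (divT (stress L p)) v := by
  have hC : ∀ t ∈ 𝒯.elements, ∀ j, ContDiff ℝ 1 (v t j) := fun t ht j =>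
    𝒯.contDiff_of_mem_V0 hv ht j
  have h1 : ∀ i j, ∑ t ∈ 𝒯.elements, ∑ a ∈ t, facetInt (opp t a) (fun x =>
      outwardNormal t a j * (L i j x * w (opp t a) i x)) = 0 := fun i j =>
    𝒯.sum_normal_facet_eq_zero hd hΩ hLip j (ψ := fun e x => L i j x * w e i x)
      (fun t ht a ha => 𝒯.memLp_of_mem_Vhat0 hd hw ht ha i (hL i j).continuous)
      fun e he hfr x hx => by rw [hw.2 e he hfr i x hx, mul_zero]
  have h2 : ∀ t ∈ 𝒯.elements, ∀ a ∈ t, facetInt (opp t a) (fun x => ∑ i,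
      normalTrace (fun _ => L) t a i x * (facetwise w - elemTrace v) t a i x) =
      ∑ i, ∑ j, (facetInt (opp t a) (fun x => outwardNormal t a j * (L i j x * w (opp t a) i x)) -
        outwardNormal t a j * facetInt (opp t a) (fun x => L i j x * v t i x)) := by
    intro t ht a ha
    have i1 : ∀ i j, Integrable (fun x => outwardNormal t a j * (L i j x * w (opp t a) i x))
        ((surf d).restrict (simplex (opp t a))) := fun i j => by
      have := (𝒯.isElem ht).isFiniteMeasure_facet hd ha
      exact ((𝒯.memLp_of_mem_Vhat0 hd hw ht ha i (hL i j).continuous).integrable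
        (by norm_num)).const_mul _
    have i2 : ∀ i j, Integrable (fun x => outwardNormal t a j * (L i j x * v t i x))
        ((surf d).restrict (simplex (opp t a))) := fun i j =>
      (𝒯.isElem ht).integrable_facet hd ha
        (continuous_const.mul ((hL i j).continuous.mul (hC t ht i).continuous))
    simp only [facetInt, ← integral_const_mul]
    simp only [← integral_sub (i1 _ _) (i2 _ _)]
    have i3 : ∀ i j, Integrable (fun x => outwardNormal t a j * (L i j x * w (opp t a) i x) -
        outwardNormal t a j * (L i j x * v t i x)) ((surf d).restrict (simplex (opp t a))) :=
      fun i j => (i1 i j).sub (i2 i j)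
    simp only [← integral_finsetSum Finset.univ fun j _ => i3 _ j]
    rw [← integral_finsetSum _ fun i _ => integrable_finsetSum _ fun j _ => i3 i j]
    congr 1; ext x
    refine Finset.sum_congr rfl fun i _ => ?_
    simp only [normalTrace, Finset.sum_mul, Pi.sub_apply, facetwise, elemTrace]
    refine Finset.sum_congr rfl fun j _ => ?_
    ring
  have h3 : ∀ t ∈ 𝒯.elements, ∑ a ∈ t, ∑ i, ∑ j,
      outwardNormal t a j * facetInt (opp t a) (fun x => L i j x * v t i x) =
      (∑ i, elemInt t (fun x => divT (stress L p) i x * v t i x) +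
        ∑ i, ∑ j, elemInt t (fun x => L i j x * partialD j (v t i) x) -
        elemInt t (fun x => p x * divV (v t) x)) +
      (∑ i, elemInt t (fun x => partialD i p x * v t i x) +
        elemInt t (fun x => p x * divV (v t) x)) := by
    intro t ht
    have e1 : ∀ i, elemInt t (fun x => divT (stress L p) i x * v t i x) =
        ∑ j, elemInt t (fun x => partialD j (L i j) x * v t i x) -
          elemInt t (fun x => partialD i p x * v t i x) := by
      intro i
      have i1 : ∀ j, Integrable (fun x => partialD j (L i j) x * v t i x)
          (volume.restrict (simplex t)) := fun j =>
        integrableOn_simplex t ((continuous_partialD (hL i j) j).mul (hC t ht i).continuous)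
      have i2 : Integrable (fun x => partialD i p x * v t i x) (volume.restrict (simplex t)) :=
        integrableOn_simplex t ((continuous_partialD hp i).mul (hC t ht i).continuous)
      simp only [elemInt, divT_stress hL hp, sub_mul, Finset.sum_mul]
      rw [integral_sub (integrable_finsetSum _ fun j _ => i1 j) i2,
        integral_finsetSum _ fun j _ => i1 j]
    have e2 : ∑ a ∈ t, ∑ i, ∑ j,
        outwardNormal t a j * facetInt (opp t a) (fun x => L i j x * v t i x) =
        ∑ i, ∑ j, (elemInt t (fun x => partialD j (L i j) x * v t i x) +
          elemInt t (fun x => L i j x * partialD j (v t i) x)) := by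
      rw [Finset.sum_comm]
      refine Finset.sum_congr rfl fun i _ => ?_
      rw [Finset.sum_comm]
      refine Finset.sum_congr rfl fun j _ => ?_
      exact ((𝒯.isElem ht).integral_partialD_mul hd j (hL i j) (hC t ht i)).symm
    rw [e2]
    simp only [e1, Finset.sum_add_distrib, Finset.sum_sub_distrib]
    ring
  rw [innerB, Finset.sum_congr rfl fun t ht => Finset.sum_congr rfl fun a ha => h2 t ht a ha]
  simp only [Finset.sum_sub_distrib]
  have h4 : ∑ t ∈ 𝒯.elements, ∑ a ∈ t, ∑ i, ∑ j, facetInt (opp t a) (fun x =>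
      outwardNormal t a j * (L i j x * w (opp t a) i x)) = 0 := by
    calc _ = ∑ i, ∑ j, ∑ t ∈ 𝒯.elements, ∑ a ∈ t, facetInt (opp t a) (fun x =>
          outwardNormal t a j * (L i j x * w (opp t a) i x)) := by
          rw [Finset.sum_congr rfl fun t _ => Finset.sum_comm, Finset.sum_comm]
          refine Finset.sum_congr rfl fun i _ => ?_
          rw [Finset.sum_congr rfl fun t _ => Finset.sum_comm, Finset.sum_comm]
      _ = 0 := by simp only [h1, Finset.sum_const_zero]
  rw [h4, Finset.sum_congr rfl h3, Finset.sum_add_distrib,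
    𝒯.sum_gradient_eq_zero hd hΩ hLip hv hp, volumePairing]
  ring

theorem tendsto_volumePairing (hΩ : IsOpen Ω) (hLip : HasLipschitzBoundary Ω) {k : ℕ}
    {v : ElemVector d} (hv : v ∈ 𝒯.V0 k) {Ln : ℕ → TensorField d} {pn : ℕ → ScalarField d}
    {Dn : ℕ → VectorField d} {L : TensorField d} {p : ScalarField d} {D : VectorField d}
    (hLn : ∀ n i j, Continuous (Ln n i j)) (hpn : ∀ n, Continuous (pn n))
    (hDn : ∀ n i, Continuous (Dn n i)) (hL : ∀ i j, MemL2 Ω (L i j)) (hp : MemL2 Ω p)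
    (hD : ∀ i, MemL2 Ω (D i)) (lL : ∀ i j, TendstoL2 Ω (fun n => Ln n i j) (L i j))
    (lp : TendstoL2 Ω pn p) (lD : ∀ i, TendstoL2 Ω (fun n => Dn n i) (D i)) :
    Tendsto (fun n => 𝒯.volumePairing (Ln n) (pn n) (Dn n) v) atTop
      (𝓝 (𝒯.volumePairing L p D v)) := by
  refine Tendsto.neg (tendsto_finsetSum _ fun t ht => ?_)
  have hC : ∀ j, ContDiff ℝ 1 (v t j) := fun j => 𝒯.contDiff_of_mem_V0 hv ht j
  have hs := 𝒯.simplex_subset ht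
  refine Tendsto.sub (Tendsto.add ?_ ?_) ?_
  · exact tendsto_finsetSum _ fun i _ => tendsto_elemInt_mul hΩ hLip hs (hDn · i) (hD i)
      (hC i).continuous (lD i)
  · exact tendsto_finsetSum _ fun i _ => tendsto_finsetSum _ fun j _ =>
      tendsto_elemInt_mul hΩ hLip hs (hLn · i j) (hL i j) (continuous_partialD (hC i) j) (lL i j)
  · exact tendsto_elemInt_mul hΩ hLip hs hpn hp (continuous_divV hC) lp

/-- The volume form of the pairing does not depend on the pressure. -/
theorem volumePairing_congr (hd : 0 < d) (hΩ : IsOpen Ω) (hLip : HasLipschitzBoundary Ω) {k : ℕ}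
    {v : ElemVector d} (hv : v ∈ 𝒯.V0 k) {L : TensorField d} {p p' : ScalarField d}
    {D D' : VectorField d} (hL : ∀ i j, MemL2 Ω (L i j)) (hp : MemL2 Ω p) (hp' : MemL2 Ω p')
    (hD : ∀ i, IsWeakDiv Ω (stress L p i) (D i))
    (hD' : ∀ i, IsWeakDiv Ω (stress L p' i) (D' i)) :
    𝒯.volumePairing L p D v = 𝒯.volumePairing L p' D' v := by
  have hr : MemL2 Ω (p - p') := hp.sub hp'
  have hgr : ∀ i, IsWeakDeriv Ω i (p - p') (D' i - D i) := by
    intro i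
    refine ⟨(hD' i).1.sub (hD i).1, fun φ hφ => ?_⟩
    have hφ1 : ContDiff ℝ 1 φ := hφ.1.of_le (by simp)
    have hi : ∀ (q : ScalarField d), MemL2 Ω q → ∀ j,
        Integrable (fun x => stress L q i j x * partialD j φ x) (volume.restrict Ω) := by
      intro q hq j
      have hm : MemL2 Ω (stress L q i j) := by
        unfold stress
        split_ifs
        · exact (hL i j).sub hq
        · exact (hL i j).sub MemLp.zero'
      simpa only [mul_comm] using hm.integrable_mul_compact (continuous_partialD hφ1 j)
        (hasCompactSupport_partialD hφ.2.1 j)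
    have i1 : Integrable (fun x => D i x * φ x) (volume.restrict Ω) := by
      simpa only [mul_comm] using (hD i).1.integrable_mul_compact hφ.1.continuous hφ.2.1
    have i2 : Integrable (fun x => D' i x * φ x) (volume.restrict Ω) := by
      simpa only [mul_comm] using (hD' i).1.integrable_mul_compact hφ.1.continuous hφ.2.1
    have e1 := (hD i).2 φ hφ
    have e2 := (hD' i).2 φ hφ
    simp only [Pi.sub_apply, sub_mul]
    rw [integral_sub i2 i1]
    have e3 : ∫ x in Ω, (p x * partialD i φ x - p' x * partialD i φ x) =
        (∫ x in Ω, ∑ j, stress L p' i j x * partialD j φ x) -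
          ∫ x in Ω, ∑ j, stress L p i j x * partialD j φ x := by
      rw [← integral_sub (integrable_finsetSum _ fun j _ => hi p' hp' j)
        (integrable_finsetSum _ fun j _ => hi p hp j)]
      congr 1; ext x
      rw [← Finset.sum_sub_distrib, Finset.sum_eq_single i]
      · simp only [stress, if_true]; ring
      · intro j _ hj
        simp only [stress, if_neg hj.symm]; ring
      · simp
    rw [e3, e1, e2]; ring
  obtain ⟨rn, hrn, hlim, hlimd⟩ := exists_H1_approx hd hΩ 𝒯.isBounded hLip hr hgr
  have hrn1 : ∀ n, ContDiff ℝ 1 (rn n) := fun n => (hrn n).of_le (by simp)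
  have hz : ∑ t ∈ 𝒯.elements, (∑ i, elemInt t (fun x => (D' i - D i) x * v t i x) +
      elemInt t (fun x => (p - p') x * divV (v t) x)) = 0 := by
    refine tendsto_nhds_unique (l := atTop) (tendsto_finsetSum _ fun t ht => ?_)
      (tendsto_const_nhds.congr fun n =>
        (𝒯.sum_gradient_eq_zero hd hΩ hLip hv (hrn1 n)).symm)
    have hC : ∀ j, ContDiff ℝ 1 (v t j) := fun j => 𝒯.contDiff_of_mem_V0 hv ht j
    have hs := 𝒯.simplex_subset ht
    refine Tendsto.add (tendsto_finsetSum _ fun i _ => ?_) ?_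
    · exact tendsto_elemInt_mul hΩ hLip hs (fun n => continuous_partialD (hrn1 n) i) (hgr i).1
        (hC i).continuous (hlimd i)
    · exact tendsto_elemInt_mul hΩ hLip hs (fun n => (hrn n).continuous) hr (continuous_divV hC)
        hlim
  rw [← sub_eq_zero, volumePairing, volumePairing, ← hz, neg_sub_neg, ← Finset.sum_sub_distrib]
  refine Finset.sum_congr rfl fun t ht => ?_
  have hC : ∀ j, ContDiff ℝ 1 (v t j) := fun j => 𝒯.contDiff_of_mem_V0 hv ht j
  have hs := 𝒯.simplex_subset ht
  have e1 : ∀ i, elemInt t (fun x => (D' i - D i) x * v t i x) =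
      elemInt t (fun x => D' i x * v t i x) - elemInt t (fun x => D i x * v t i x) := fun i => by
    simp only [Pi.sub_apply, sub_mul]
    exact integral_sub (integrable_elem_mul hΩ hLip hs (hD' i).1 (hC i).continuous)
      (integrable_elem_mul hΩ hLip hs (hD i).1 (hC i).continuous)
  have e2 : elemInt t (fun x => (p - p') x * divV (v t) x) =
      elemInt t (fun x => p x * divV (v t) x) - elemInt t (fun x => p' x * divV (v t) x) := by
    simp only [Pi.sub_apply, sub_mul]
    exact integral_sub (integrable_elem_mul hΩ hLip hs hp (continuous_divV hC))
      (integrable_elem_mul hΩ hLip hs hp' (continuous_divV hC))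
  simp only [e1, e2, Finset.sum_sub_distrib]
  ring

theorem exists_isSmoothApprox (hd : 0 < d) (hΩ : IsOpen Ω) (hb : Bornology.IsBounded Ω)
    (hLip : HasLipschitzBoundary Ω) {ε : ℝ} (hε0 : 0 < ε) (hε1 : ε < 1) {L : TensorField d}
    {p : ScalarField d} {D : VectorField d} (hL : ∀ i j, MemHs Ω ε (L i j)) (hp : MemHs Ω ε p)
    (hD : ∀ i, IsWeakDiv Ω (stress L p i) (D i)) :
    ∃ Ln pn, IsSmoothApprox Ω ε L p Ln pn := by
  obtain ⟨A, hA, hsub, -, hHs, hdiv⟩ := exists_smoothing hd hΩ hb hLip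
  refine ⟨fun n i j => A n (L i j), fun n => A n p, hp, fun n i j => hA n _ (hL i j).1,
    fun n => hA n _ hp.1, fun i j => hHs ε _ hε0 hε1 (hL i j), hHs ε _ hε0 hε1 hp, D, hD,
    fun i => ?_⟩
  have hm : ∀ j, MemL2 Ω (stress L p i j) := fun j => by
    unfold stress
    split_ifs
    · exact (hL i j).1.sub hp.1
    · exact (hL i j).1.sub MemLp.zero'
  refine (hdiv (stress L p i) (D i) hm (hD i)).congr (fun n => ?_) ae_eq_rfl
  have e : ∀ j, A n (stress L p i j) = stress (fun i j => A n (L i j)) (A n p) i j := by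
    intro j
    unfold stress
    split_ifs
    · exact hsub n _ _ (hL i j).1 hp.1
    · simp only [sub_zero]
  simp only [divT, e]
  rfl

theorem hasNormalPairing (hd : 0 < d) (hΩ : IsOpen Ω) (hLip : HasLipschitzBoundary Ω) {k : ℕ}
    {ε : ℝ} (hε0 : 0 < ε) (hε1 : ε < 1) {v : ElemVector d} (hv : v ∈ 𝒯.V0 k)
    {w : FacetVector d} (hw : w ∈ 𝒯.Vhat0 k) {L : TensorField d} {p : ScalarField d}
    {D : VectorField d} (hL : ∀ i j, MemHs Ω ε (L i j)) (hp : MemHs Ω ε p)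
    (hD : ∀ i, IsWeakDiv Ω (stress L p i) (D i)) :
    𝒯.HasNormalPairing ε L (facetwise w - elemTrace v) (𝒯.volumePairing L p D v) := by
  refine ⟨⟨p, exists_isSmoothApprox hd hΩ 𝒯.isBounded hLip hε0 hε1 hL hp hD⟩, ?_⟩
  rintro p' Ln pn ⟨hp', hLn, hpn, lL, lp, D', hD', lD⟩
  have hLn1 : ∀ n i j, ContDiff ℝ 1 (Ln n i j) := fun n i j => (hLn n i j).of_le (by simp)
  have hpn1 : ∀ n, ContDiff ℝ 1 (pn n) := fun n => (hpn n).of_le (by simp)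
  rw [𝒯.volumePairing_congr hd hΩ hLip hv (fun i j => (hL i j).1) hp.1 hp'.1 hD hD']
  refine (𝒯.tendsto_volumePairing hΩ hLip hv (fun n i j => (hLn n i j).continuous)
    (fun n => (hpn n).continuous)
    (fun n i => continuous_divV fun j => contDiff_stress (hLn1 n) (hpn1 n) i j)
    (fun i j => (hL i j).1) hp'.1 (fun i => (hD' i).1) (fun i j => (lL i j).1) lp.1 lD).congr
    fun n => ?_
  exact (𝒯.innerB_eq_volumePairing hd hΩ hLip hv hw (hLn1 n) (hpn1 n)).symm

theorem HasNormalPairing.unique {ε : ℝ} {L : TensorField d} {W : BdryVector d} {l l' : ℝ}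
    (h : 𝒯.HasNormalPairing ε L W l) (h' : 𝒯.HasNormalPairing ε L W l') : l = l' := by
  obtain ⟨⟨p, Ln, pn, hap⟩, hlim⟩ := h
  exact tendsto_nhds_unique (hlim p Ln pn hap) (h'.2 p Ln pn hap)

end Triangulation


/-! ### The consistency identity -/

theorem isWeakDiv_of_isWeakDeriv {Ω : Set (Pt d)} {u : VectorField d} {gr : VectorField d}
    (hu : ∀ j, MemL2 Ω (u j)) (hgr : ∀ j, IsWeakDeriv Ω j (u j) (gr j)) :
    IsWeakDiv Ω u (fun x => ∑ j, gr j x) := by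
  refine ⟨memLp_finsetSum _ fun j _ => (hgr j).1, fun φ hφ => ?_⟩
  have hφ1 : ContDiff ℝ 1 φ := hφ.1.of_le (by simp)
  have i1 : ∀ j, Integrable (fun x => u j x * partialD j φ x) (volume.restrict Ω) := fun j => by
    simpa only [mul_comm] using (hu j).integrable_mul_compact (continuous_partialD hφ1 j)
      (hasCompactSupport_partialD hφ.2.1 j)
  have i2 : ∀ j, Integrable (fun x => gr j x * φ x) (volume.restrict Ω) := fun j => by
    simpa only [mul_comm] using (hgr j).1.integrable_mul_compact hφ.1.continuous hφ.2.1
  simp only [Finset.sum_mul]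
  rw [integral_finsetSum _ fun j _ => i1 j, integral_finsetSum _ fun j _ => i2 j,
    ← Finset.sum_neg_distrib]
  exact Finset.sum_congr rfl fun j _ => (hgr j).2 φ hφ

theorem elemInt_sum {ι : Type*} (s : Finset ι) (t : Finset (Pt d)) {f : ι → ScalarField d}
    (hf : ∀ i ∈ s, Integrable (f i) (volume.restrict (simplex t))) :
    elemInt t (fun x => ∑ i ∈ s, f i x) = ∑ i ∈ s, elemInt t (f i) :=
  integral_finsetSum _ hf

theorem facetInt_sum {ι : Type*} (s : Finset ι) (e : Finset (Pt d)) {f : ι → ScalarField d}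
    (hf : ∀ i ∈ s, Integrable (f i) ((surf d).restrict (simplex e))) :
    facetInt e (fun x => ∑ i ∈ s, f i x) = ∑ i ∈ s, facetInt e (f i) :=
  integral_finsetSum _ hf

theorem facetInt_const_mul (e : Finset (Pt d)) (c : ℝ) (f : ScalarField d) :
    facetInt e (fun x => c * f x) = c * facetInt e f :=
  integral_const_mul _ _

section Element

variable {Ω : Set (Pt d)} {t : Finset (Pt d)} {k : ℕ} {u : VectorField d}

theorem IsElem.memLp_facetTrace (h : IsElem t) (hd : 0 < d) (hΩ : IsOpen Ω)
    (hb : Bornology.IsBounded Ω) (hLip : HasLipschitzBoundary Ω)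
    (ht : StokesHDG.simplex t ⊆ closure Ω) (hu : ∀ i, MemH1 Ω (u i)) {a : Pt d} (ha : a ∈ t)
    (i : Fin d) :
    MemLp (facetTrace Ω u (opp t a) i) 2 ((surf d).restrict (StokesHDG.simplex (opp t a))) :=
  (h.isTraceOn_facetTrace hd hΩ hb hLip ht ha (hu i)).1

theorem IsElem.isRTProj_projRT (h : IsElem t) (hd : 0 < d) (hΩ : IsOpen Ω)
    (hb : Bornology.IsBounded Ω) (hLip : HasLipschitzBoundary Ω)
    (ht : StokesHDG.simplex t ⊆ closure Ω) (hk : 1 ≤ k) (hu : ∀ i, MemH1 Ω (u i)) :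
    IsRTProj Ω k u t (projRT Ω k u t) :=
  Classical.epsilon_spec (h.exists_RT hd hk
    (g := fun a x => ∑ i, facetTrace Ω u (opp t a) i x * outwardNormal t a i)
    (fun _ ha => memLp_finsetSum _ fun i _ =>
      (h.memLp_facetTrace hd hΩ hb hLip ht hu ha i).mul_const _)
    fun i => (hu i).1.simplex hΩ hLip ht)

/-- The Raviart–Thomas projection preserves the divergence moments. -/
theorem IsElem.elemInt_divV_projRT (h : IsElem t) (hd : 0 < d) (hΩ : IsOpen Ω)
    (hb : Bornology.IsBounded Ω) (hLip : HasLipschitzBoundary Ω)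
    (ht : StokesHDG.simplex t ⊆ closure Ω) (hk : 1 ≤ k) (hu : ∀ i, MemH1 Ω (u i))
    {gr : TensorField d} (hgr : ∀ i j, IsWeakDeriv Ω j (u i) (gr i j)) {q : ScalarField d}
    (hq : IsPolyDeg k q) :
    elemInt t (fun x => divV (projRT Ω k u t) x * q x) =
      elemInt t (fun x => (∑ j, gr j j x) * q x) := by
  obtain ⟨hRT, hfac, hint⟩ := h.isRTProj_projRT hd hΩ hb hLip ht hk hu
  have hC : ∀ j, ContDiff ℝ 1 (projRT Ω k u t j) := fun j => (hRT.isPolyDeg_succ j).contDiff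
  have h1 := h.integral_divV_mul hd hC (hq.contDiff (n := 1))
  rw [hint (fun j => partialD j q) fun j => hq.partialD j,
    Finset.sum_congr rfl fun a ha => hfac a ha q hq] at h1
  have hj : ∀ j, elemInt t (fun x => gr j j x * q x) + elemInt t (fun x => u j x * partialD j q x) =
      ∑ a ∈ t, outwardNormal t a j *
        facetInt (opp t a) (fun x => facetTrace Ω u (opp t a) j x * q x) := fun j =>
    h.integral_mul_partialD hd hΩ hb hLip ht (hu j).1 (hgr j)
      (w := fun a => facetTrace Ω u (opp t a) j)
      (fun a ha => h.isTraceOn_facetTrace hd hΩ hb hLip ht ha (hu j)) j hq.contDiff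
  have e1 : elemInt t (fun x => ∑ j, u j x * partialD j q x) =
      ∑ j, elemInt t (fun x => u j x * partialD j q x) :=
    elemInt_sum _ t fun j _ => integrable_elem_mul hΩ hLip ht (hu j).1 (hq.partialD j).continuous
  have e2 : elemInt t (fun x => (∑ j, gr j j x) * q x) =
      ∑ j, elemInt t (fun x => gr j j x * q x) := by
    simp only [Finset.sum_mul]
    exact elemInt_sum _ t fun j _ => integrable_elem_mul hΩ hLip ht (hgr j j).1 hq.continuous
  have e3 : ∀ a ∈ t, facetInt (opp t a) (fun x =>
      (∑ i, facetTrace Ω u (opp t a) i x * outwardNormal t a i) * q x) =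
      ∑ j, outwardNormal t a j *
        facetInt (opp t a) (fun x => facetTrace Ω u (opp t a) j x * q x) := by
    intro a ha
    simp only [← facetInt_const_mul]
    rw [← facetInt_sum]
    · congr 1; ext x
      rw [Finset.sum_mul]
      exact Finset.sum_congr rfl fun j _ => by ring
    · exact fun j _ => ((h.memLp_facetTrace hd hΩ hb hLip ht hu ha j).integrable_mul
        (h.memLp_facet hd ha hq.continuous)).const_mul _
  rw [Finset.sum_congr rfl e3, Finset.sum_comm, ← Finset.sum_congr rfl fun j _ => hj j,
    Finset.sum_add_distrib, e1, ← e2] at h1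
  linarith

theorem IsElem.divV_projRT_eq_zero (h : IsElem t) (hd : 0 < d) (hΩ : IsOpen Ω)
    (hb : Bornology.IsBounded Ω) (hLip : HasLipschitzBoundary Ω)
    (ht : StokesHDG.simplex t ⊆ closure Ω) (hk : 1 ≤ k) (hu : ∀ i, MemH1 Ω (u i))
    {gr : TensorField d} (hgr : ∀ i j, IsWeakDeriv Ω j (u i) (gr i j)) (hdiv : IsWeakDiv Ω u 0)
    (x : Pt d) : divV (projRT Ω k u t) x = 0 := by
  have hRT := (h.isRTProj_projRT hd hΩ hb hLip ht hk hu).1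
  refine h.poly_eq_zero hRT.divV ?_ x
  rw [h.elemInt_divV_projRT hd hΩ hb hLip ht hk hu hgr hRT.divV]
  have h1 := (isWeakDiv_of_isWeakDeriv (fun j => (hu j).1) fun j => hgr j j).ae_eq hΩ hdiv
  have h2 := ae_mono (restrict_simplex_le hΩ hLip ht) h1
  refine integral_eq_zero_of_ae ?_
  filter_upwards [h2] with y hy
  rw [Pi.zero_apply] at hy
  rw [hy, zero_mul, Pi.zero_apply]

/-- The discrete gradient equation holds for the projections. -/
theorem IsElem.gradient_consistency (h : IsElem t) (hd : 0 < d) (hΩ : IsOpen Ω)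
    (hb : Bornology.IsBounded Ω) (hLip : HasLipschitzBoundary Ω)
    (ht : StokesHDG.simplex t ⊆ closure Ω) (hk : 1 ≤ k) (hu : ∀ i, MemH1 Ω (u i)) {ν : ℝ}
    {L : TensorField d} (hL : ∀ i j, MemL2 Ω (L i j))
    (hgr : ∀ i j, IsWeakDeriv Ω j (u i) (fun x => ν⁻¹ * L i j x)) {G : TensorField d}
    (hG : ∀ i j, IsPolyDeg k (G i j)) :
    ν⁻¹ * elemInt t (fun x => ∑ i, ∑ j, projTensor k L t i j x * G i j x) +
      elemInt t (fun x => ∑ i, projRT Ω k u t i x * divT G i x) =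
      ∑ a ∈ t, facetInt (opp t a) (fun x => ∑ i, projFacet Ω k u (opp t a) i x *
        ∑ j, G i j x * outwardNormal t a j) := by
  obtain ⟨hRT, hfac, hint⟩ := h.isRTProj_projRT hd hΩ hb hLip ht hk hu
  have hLt := fun i j => (hL i j).simplex hΩ hLip ht
  have hdG : ∀ i, IsPolyDeg (k - 1) (divT G i) := fun i =>
    IsPolyDeg.sum Finset.univ fun j _ => (hG i j).partialD j
  have e1 : elemInt t (fun x => ∑ i, ∑ j, projTensor k L t i j x * G i j x) =
      ∑ i, ∑ j, elemInt t (fun x => L i j x * G i j x) := by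
    have hi : ∀ i j, Integrable (fun x => projTensor k L t i j x * G i j x)
        (volume.restrict (StokesHDG.simplex t)) := fun i j => integrableOn_simplex t
      ((elemProj_spec k t (hLt i j)).1.continuous.mul (hG i j).continuous)
    rw [elemInt_sum _ t fun i _ => integrable_finsetSum _ fun j _ => hi i j]
    refine Finset.sum_congr rfl fun i _ => ?_
    rw [elemInt_sum _ t fun j _ => hi i j]
    exact Finset.sum_congr rfl fun j _ => (elemProj_spec k t (hLt i j)).2 _ (hG i j)
  have e2 : elemInt t (fun x => ∑ i, u i x * divT G i x) =
      ∑ i, ∑ j, elemInt t (fun x => u i x * partialD j (G i j) x) := by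
    rw [elemInt_sum _ t fun i _ => integrable_elem_mul hΩ hLip ht (hu i).1 (hdG i).continuous]
    refine Finset.sum_congr rfl fun i _ => ?_
    simp only [divT, divV, Finset.mul_sum]
    exact elemInt_sum _ t fun j _ => integrable_elem_mul hΩ hLip ht (hu i).1
      ((hG i j).partialD j).continuous
  have e3 : ∀ a ∈ t, facetInt (opp t a) (fun x => ∑ i, projFacet Ω k u (opp t a) i x *
        ∑ j, G i j x * outwardNormal t a j) = ∑ i, ∑ j, outwardNormal t a j *
        facetInt (opp t a) (fun x => facetTrace Ω u (opp t a) i x * G i j x) := by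
    intro a ha
    have hspec := fun i => h.facetProj_spec k hd ha (h.memLp_facetTrace hd hΩ hb hLip ht hu ha i)
    have hGn : ∀ i, IsPolyDeg k (fun x => ∑ j, G i j x * outwardNormal t a j) := fun i =>
      IsPolyDeg.sum _ fun j _ => (hG i j).mul_const _
    have hi : ∀ i, Integrable (fun x => projFacet Ω k u (opp t a) i x *
        ∑ j, G i j x * outwardNormal t a j) ((surf d).restrict (StokesHDG.simplex (opp t a))) :=
      fun i => h.integrable_facet hd ha ((hspec i).1.continuous.mul (hGn i).continuous)
    rw [facetInt_sum _ _ fun i _ => hi i]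
    refine Finset.sum_congr rfl fun i _ => ?_
    refine ((hspec i).2 _ (hGn i)).trans ?_
    simp only [← facetInt_const_mul, Finset.mul_sum]
    rw [facetInt_sum]
    · refine Finset.sum_congr rfl fun j _ => ?_
      congr 1; ext x; ring
    · exact fun j _ => (h.memLp_facetTrace hd hΩ hb hLip ht hu ha i).integrable_mul
        (h.memLp_facet hd ha ((hG i j).continuous.mul continuous_const))
  rw [e1, hint _ hdG, e2, Finset.sum_congr rfl e3, Finset.mul_sum, ← Finset.sum_add_distrib,
    Finset.sum_comm]
  refine Finset.sum_congr rfl fun i _ => ?_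
  rw [Finset.mul_sum, ← Finset.sum_add_distrib, Finset.sum_comm]
  refine Finset.sum_congr rfl fun j _ => ?_
  rw [← h.integral_mul_partialD hd hΩ hb hLip ht (hu i).1 (gr := fun j x => ν⁻¹ * L i j x)
    (hgr i) (w := fun a => facetTrace Ω u (opp t a) i)
      (fun a ha => h.isTraceOn_facetTrace hd hΩ hb hLip ht ha (hu i)) j (hG i j).contDiff]
  simp only [elemInt, mul_assoc, integral_const_mul]

/-- Elementwise form of the momentum part of the bilinear form. -/
theorem IsElem.momentum_consistency (h : IsElem t) (hd : 0 < d) {L : TensorField d}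
    {p : ScalarField d} (hL : ∀ i j, MemLp (L i j) 2 (volume.restrict (StokesHDG.simplex t)))
    (hp : MemLp p 2 (volume.restrict (StokesHDG.simplex t))) {v : VectorField d} (hv : IsRT k v)
    {w : Pt d → VectorField d}
    (hw : ∀ a ∈ t, ∀ i, MemLp (w a i) 2 ((surf d).restrict (StokesHDG.simplex (opp t a)))) :
    - elemInt t (fun x => ∑ i, divT (projTensor k L t) i x * v i x) +
      ∑ a ∈ t, facetInt (opp t a) (fun x => ∑ i, normalTrace (projTensor k L) t a i x * w a i x) -
      elemInt t (fun x => projScalar k p t x * divV v x) =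
    ∑ a ∈ t, facetInt (opp t a)
        (fun x => ∑ i, normalTrace (projTensor k L) t a i x * (w a i x - v i x)) +
      ∑ i, ∑ j, elemInt t (fun x => L i j x * partialD j (v i) x) -
      elemInt t (fun x => p x * divV v x) := by
  have hspec := fun i j => elemProj_spec k t (hL i j)
  have hPC : ∀ i j, ContDiff ℝ 1 (projTensor k L t i j) := fun i j => (hspec i j).1.contDiff
  have hvC : ∀ i, ContDiff ℝ 1 (v i) := fun i => (hv.isPolyDeg_succ i).contDiff
  have e1 : elemInt t (fun x => projScalar k p t x * divV v x) =
      elemInt t (fun x => p x * divV v x) := (elemProj_spec k t hp).2 _ hv.divV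
  have hn : ∀ a i, Continuous (normalTrace (projTensor k L) t a i) := fun a i =>
    continuous_finsetSum _ fun j _ => (hPC i j).continuous.mul continuous_const
  have e2 : ∀ i, elemInt t (fun x => divT (projTensor k L t) i x * v i x) +
      ∑ j, elemInt t (fun x => L i j x * partialD j (v i) x) =
      ∑ a ∈ t, facetInt (opp t a) (fun x => normalTrace (projTensor k L) t a i x * v i x) := by
    intro i
    have h1 := h.integral_divV_mul hd (hPC i) (hvC i)
    have hi : ∀ j, Integrable (fun x => projTensor k L t i j x * partialD j (v i) x)
        (volume.restrict (StokesHDG.simplex t)) := fun j => integrableOn_simplex t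
      ((hPC i j).continuous.mul (hv.partialD i j).continuous)
    have e0 : ∀ j, elemInt t (fun x => projTensor k L t i j x * partialD j (v i) x) =
        elemInt t (fun x => L i j x * partialD j (v i) x) := fun j =>
      (hspec i j).2 _ (hv.partialD i j)
    rw [elemInt_sum _ t fun j _ => hi j, Finset.sum_congr rfl fun j _ => e0 j] at h1
    exact h1
  have e3 : elemInt t (fun x => ∑ i, divT (projTensor k L t) i x * v i x) =
      ∑ i, elemInt t (fun x => divT (projTensor k L t) i x * v i x) :=
    elemInt_sum _ t fun i _ => integrableOn_simplex t
      ((continuous_divV (hPC i)).mul (hvC i).continuous)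
  have e4 : ∀ a ∈ t, facetInt (opp t a)
      (fun x => ∑ i, normalTrace (projTensor k L) t a i x * (w a i x - v i x)) =
      facetInt (opp t a) (fun x => ∑ i, normalTrace (projTensor k L) t a i x * w a i x) -
      ∑ i, facetInt (opp t a) (fun x => normalTrace (projTensor k L) t a i x * v i x) := by
    intro a ha
    have i1 : ∀ i, Integrable (fun x => normalTrace (projTensor k L) t a i x * w a i x)
        ((surf d).restrict (StokesHDG.simplex (opp t a))) := fun i =>
      (h.memLp_facet hd ha (hn a i)).integrable_mul (hw a ha i)
    have i2 : ∀ i, Integrable (fun x => normalTrace (projTensor k L) t a i x * v i x)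
        ((surf d).restrict (StokesHDG.simplex (opp t a))) := fun i =>
      h.integrable_facet hd ha ((hn a i).mul (hvC i).continuous)
    rw [← facetInt_sum _ _ fun i _ => i2 i, facetInt, facetInt, facetInt,
      ← integral_sub (integrable_finsetSum _ fun i _ => i1 i)
        (integrable_finsetSum _ fun i _ => i2 i)]
    simp only [mul_sub, Finset.sum_sub_distrib]
  rw [Finset.sum_congr rfl e4, Finset.sum_sub_distrib, Finset.sum_comm (s := t),
    ← Finset.sum_congr rfl fun i _ => e2 i, Finset.sum_add_distrib, e3, e1]
  ring

/-- The facet projections in the stabilization may be dropped against polynomials. -/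
theorem IsElem.stabilization_consistency (h : IsElem t) (hd : 0 < d) {a : Pt d} (ha : a ∈ t)
    (c : ℝ) {w s z : VectorField d} (hw : ∀ i, Continuous (w i))
    (hs : ∀ i, MemLp (s i) 2 ((surf d).restrict (StokesHDG.simplex (opp t a))))
    (hz : ∀ i, ∃ q, IsPolyDeg k q ∧ EqOn (z i) q (StokesHDG.simplex (opp t a))) :
    facetInt (opp t a) (fun x => ∑ i, c * (facetProj k (opp t a) (w i) x -
        facetProj k (opp t a) (s i) x) * z i x) =
      facetInt (opp t a) (fun x => ∑ i, c * (w i x - s i x) * z i x) := by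
  choose q hq hzq using hz
  have hws := fun i => h.facetProj_spec k hd ha (h.memLp_facet hd ha (hw i))
  have hss := fun i => h.facetProj_spec k hd ha (hs i)
  have hex : ∀ f g : VectorField d,
      (∀ i, MemLp (f i) 2 ((surf d).restrict (StokesHDG.simplex (opp t a)))) →
      (∀ i, MemLp (g i) 2 ((surf d).restrict (StokesHDG.simplex (opp t a)))) →
      facetInt (opp t a) (fun x => ∑ i, c * (f i x - g i x) * z i x) =
        ∑ i, c * (facetInt (opp t a) (fun x => f i x * q i x) -
          facetInt (opp t a) (fun x => g i x * q i x)) := by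
    intro f g hf hg
    have i1 : ∀ i, Integrable (fun x => f i x * q i x)
        ((surf d).restrict (StokesHDG.simplex (opp t a))) := fun i =>
      (hf i).integrable_mul (h.memLp_facet hd ha (hq i).continuous)
    have i2 : ∀ i, Integrable (fun x => g i x * q i x)
        ((surf d).restrict (StokesHDG.simplex (opp t a))) := fun i =>
      (hg i).integrable_mul (h.memLp_facet hd ha (hq i).continuous)
    have e : facetInt (opp t a) (fun x => ∑ i, c * (f i x - g i x) * z i x) =
        facetInt (opp t a) (fun x => ∑ i, c * (f i x * q i x - g i x * q i x)) := by
      refine setIntegral_congr_fun (measurableSet_simplex _) fun x hx => ?_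
      refine Finset.sum_congr rfl fun i _ => ?_
      rw [hzq i hx]; ring
    have i3 : ∀ i, Integrable (fun x => c * (f i x * q i x - g i x * q i x))
        ((surf d).restrict (StokesHDG.simplex (opp t a))) := fun i =>
      ((i1 i).sub (i2 i)).const_mul c
    rw [e, facetInt_sum _ _ fun i _ => i3 i]
    refine Finset.sum_congr rfl fun i _ => ?_
    rw [facetInt_const_mul, facetInt, integral_sub (i1 i) (i2 i)]
    rfl
  rw [hex _ _ (fun i => h.memLp_facet hd ha (hws i).1.continuous)
      (fun i => h.memLp_facet hd ha (hss i).1.continuous),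
    hex _ _ (fun i => h.memLp_facet hd ha (hw i)) hs]
  refine Finset.sum_congr rfl fun i _ => ?_
  rw [(hws i).2 _ (hq i), (hss i).2 _ (hq i)]

end Element

end StokesHDG
open StokesHDG
theorem RT_consistency {d : ℕ} (hd : d = 2 ∨ d = 3)
    (Ω : Set (Pt d)) (hΩ : IsOpen Ω) (hLip : HasLipschitzBoundary Ω)
    (𝒯 : Triangulation Ω) (k : ℕ) (hk : 1 ≤ k) (ν : ℝ) (hν : 0 < ν)
    (ε : ℝ) (hε0 : 0 < ε) (hε : ε < 1 / 2)
    (f g : VectorField d) (hf : ∀ i, MemL2 Ω (f i))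
    (L : TensorField d) (u : VectorField d) (p : ScalarField d)
    (hL : ∀ i j, MemHs Ω ε (L i j)) (hu : ∀ i, MemH1 Ω (u i))
    (hp : MemHs Ω ε p) (hp0 : ∫ x in Ω, p x = 0)
    (hsol : IsStokesSolution Ω ν f g L u p) :
    (∀ G ∈ 𝒯.Sigma k, ∀ v ∈ 𝒯.V0 k, ∀ vhat ∈ 𝒯.Vhat0 k, ∀ q ∈ 𝒯.Q k,
      𝒯.HasNormalPairing ε L (facetwise vhat - elemTrace v)
          (𝒯.normalPairing ε L (facetwise vhat - elemTrace v)) ∧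
        𝒯.R ν k (projTensor k L) (projRT Ω k u) (projFacet Ω k u) (projScalar k p) G v vhat q
          = 𝒯.innerV (fun _ => f) v + 𝒯.consistencyError ε ν k L u v vhat) ∧
    ∀ t ∈ 𝒯.elements,
      (∀ x ∈ simplex t, divV (projRT Ω k u t) x = 0) ∧ ∀ i, IsPolyDeg k (projRT Ω k u t i) := by
  have hd0 : 0 < d := by omega
  have hb : Bornology.IsBounded Ω := 𝒯.isBounded
  have hRT : ∀ t ∈ 𝒯.elements, IsRTProj Ω k u t (projRT Ω k u t) := fun t ht =>
    (𝒯.isElem ht).isRTProj_projRT hd0 hΩ hb hLip (𝒯.simplex_subset ht) hk hu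
  have hdiv : ∀ t ∈ 𝒯.elements, ∀ x, divV (projRT Ω k u t) x = 0 := fun t ht =>
    (𝒯.isElem ht).divV_projRT_eq_zero hd0 hΩ hb hLip (𝒯.simplex_subset ht) hk hu hsol.gradient
      hsol.divergence
  refine ⟨fun G hG v hv w hw q _ => ?_, fun t ht => ⟨fun x _ => hdiv t ht x, fun i =>
    (hRT t ht).1.isPolyDeg_of_divV_eq_zero hk (hdiv t ht) i⟩⟩
  have hNP := 𝒯.hasNormalPairing hd0 hΩ hLip hε0 (by linarith) hv hw hL hp hsol.momentum
  have hspec : 𝒯.HasNormalPairing ε L (facetwise w - elemTrace v)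
      (𝒯.normalPairing ε L (facetwise w - elemTrace v)) := Classical.epsilon_spec ⟨_, hNP⟩
  refine ⟨hspec, ?_⟩
  have hvC : ∀ t ∈ 𝒯.elements, ∀ i, Continuous (v t i) := fun t ht i =>
    (𝒯.contDiff_of_mem_V0 hv ht i (n := 1)).continuous
  have hgrad : ν⁻¹ * 𝒯.innerT (projTensor k L) G +
      𝒯.innerV (projRT Ω k u) (fun t => divT (G t)) =
      𝒯.innerB (facetwise (projFacet Ω k u)) (normalTrace G) := by
    rw [Triangulation.innerT, Triangulation.innerV, Triangulation.innerB, Finset.mul_sum,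
      ← Finset.sum_add_distrib]
    exact Finset.sum_congr rfl fun t ht => (𝒯.isElem ht).gradient_consistency hd0 hΩ hb hLip
      (𝒯.simplex_subset ht) hk hu (fun i j => (hL i j).1) hsol.gradient (hG t ht)
  have hmass : 𝒯.innerS (fun t => divV (projRT Ω k u t)) q = 0 :=
    Finset.sum_eq_zero fun t ht => by simp [hdiv t ht, elemInt]
  have hstab : 𝒯.innerB (etaMul (projBdry k (elemTrace (projRT Ω k u)) -
        facetwise (projFacet Ω k u))) (projBdry k (elemTrace v) - facetwise w) =
      𝒯.innerB (etaMul (elemTrace (projRT Ω k u) - facetwise (facetTrace Ω u)))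
        (projBdry k (elemTrace v) - facetwise w) := by
    refine Finset.sum_congr rfl fun t ht => Finset.sum_congr rfl fun a ha => ?_
    have h := 𝒯.isElem ht
    refine h.stabilization_consistency (k := k) hd0 ha (Metric.diam (simplex t))⁻¹
      (w := projRT Ω k u t) (s := facetTrace Ω u (opp t a))
      (z := (projBdry k (elemTrace v) - facetwise w) t a)
      (fun i => ((hRT t ht).1.isPolyDeg_succ i).continuous)
      (fun i => h.memLp_facetTrace hd0 hΩ hb hLip (𝒯.simplex_subset ht) hu ha i) fun i => ?_
    obtain ⟨r, hr, heq⟩ := hw.1 _ (𝒯.opp_mem_facets hd0 ht ha) i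
    refine ⟨_, (h.facetProj_spec k hd0 ha (h.memLp_facet hd0 ha (hvC t ht i))).1.sub hr,
      fun x hx => ?_⟩
    exact congrArg (facetProj k (opp t a) (v t i) x - ·) (heq hx)
  have hmom : - 𝒯.innerV (fun t => divT (projTensor k L t)) v +
      𝒯.innerB (normalTrace (projTensor k L)) (facetwise w) -
      𝒯.innerS (projScalar k p) (fun t => divV (v t)) =
      𝒯.innerB (normalTrace (projTensor k L)) (facetwise w - elemTrace v) +
      ∑ t ∈ 𝒯.elements, (∑ i, ∑ j, elemInt t (fun x => L i j x * partialD j (v t i) x) -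
        elemInt t (fun x => p x * divV (v t) x)) := by
    rw [Triangulation.innerV, Triangulation.innerB, Triangulation.innerB, Triangulation.innerS,
      ← Finset.sum_neg_distrib, ← Finset.sum_add_distrib, ← Finset.sum_sub_distrib,
      ← Finset.sum_add_distrib]
    refine Finset.sum_congr rfl fun t ht => ?_
    have hs := 𝒯.simplex_subset ht
    refine ((𝒯.isElem ht).momentum_consistency hd0 (fun i j => (hL i j).1.simplex hΩ hLip hs)
      (hp.1.simplex hΩ hLip hs) (hv.1 t ht) (w := fun a => w (opp t a)) fun a ha i => by
        simpa using 𝒯.memLp_of_mem_Vhat0 hd0 hw ht ha i (f := fun _ => 1)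
          continuous_const).trans (add_sub_assoc _ _ _)
  have hvol : 𝒯.volumePairing L p (fun i x => - f i x) v = 𝒯.innerV (fun _ => f) v -
      ∑ t ∈ 𝒯.elements, (∑ i, ∑ j, elemInt t (fun x => L i j x * partialD j (v t i) x) -
        elemInt t (fun x => p x * divV (v t) x)) := by
    rw [Triangulation.volumePairing, Triangulation.innerV, ← Finset.sum_sub_distrib,
      ← Finset.sum_neg_distrib]
    refine Finset.sum_congr rfl fun t ht => ?_
    rw [elemInt_sum _ t fun i _ => integrable_elem_mul hΩ hLip (𝒯.simplex_subset ht) (hf i)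
      (hvC t ht i)]
    have e : ∀ i, elemInt t (fun x => - f i x * v t i x) =
        - elemInt t (fun x => f i x * v t i x) := fun i => by
      simp only [neg_mul, elemInt, integral_neg]
    simp only [e, Finset.sum_neg_distrib]
    ring
  rw [Triangulation.R, Triangulation.consistencyError, hspec.unique 𝒯 hNP, hvol, hstab, hmass,
    hgrad]
  linarith
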